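/- Let n ≥ 5 and let F ⊆ E(Q_n) with |F| ≤ 4n − 17. Suppose every vertex of Q_n − F has degree at least 2 and at most one vertex of Q_n − F has degree exactly 2. Then Q_n − F is Hamiltonian laceable: for any two vertices x, y with p(x) ≠ p(y), there is a Hamiltonian path from x to y in Q_n − F. -/

import Mathlib

open SimpleGraph Finset
open scoped Classical

/-- The `n`-dimensional hypercube graph: vertices are `Fin n → Bool`,
adjacent iff they differ in exactly one coordinate. -/
def Q (n : ℕ) : SimpleGraph (Fin n → Bool) :=
  SimpleGraph.fromRel fun x y => (Finset.univ.filter fun i => x i ≠ y i).card = 1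

/-- Parity of a vertex of the hypercube: sum of coordinates mod 2. -/
def qparity {n : ℕ} (x : Fin n → Bool) : ZMod 2 :=
  ∑ i, if x i then 1 else 0

/-- Degree of a vertex after deleting the faulty edges. -/
noncomputable def faultyDeg {n : ℕ} (F : Finset (Sym2 (Fin n → Bool)))
    (v : Fin n → Bool) : ℕ :=
  (((Q n).deleteEdges ↑F).neighborSet v).ncard

namespace HC

/-- Vertices of the ambient cube. -/
abbrev V (n : ℕ) := Fin n → Bool

variable {n : ℕ}

/-- The neighbour of `z` in direction `i`. -/
def flip (i : Fin n) (z : V n) : V n := Function.update z i (!z i)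

@[simp] theorem flip_flip (i : Fin n) (z : V n) : flip i (flip i z) = z := by
  ext k; by_cases h : k = i <;> simp [flip, Function.update, h]

theorem flip_comm (i k : Fin n) (z : V n) : flip i (flip k z) = flip k (flip i z) := by
  ext l
  by_cases h : i = k
  · rw [h]
  · by_cases h1 : l = i <;> by_cases h2 : l = k <;> simp_all [flip, Function.update]

@[simp] theorem flip_same (i : Fin n) (z : V n) : flip i z i = !z i := by simp [flip]

theorem flip_other {i k : Fin n} (h : k ≠ i) (z : V n) : flip i z k = z k := by simp [flip, h]

@[simp] theorem flip_inj (i : Fin n) (z w : V n) : flip i z = flip i w ↔ z = w :=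
  ⟨fun h => by rw [← flip_flip i z, h, flip_flip], fun h => by rw [h]⟩

@[simp] theorem flip_dir_inj (i k : Fin n) (z : V n) : flip i z = flip k z ↔ i = k := by
  refine ⟨fun h => ?_, fun h => by rw [h]⟩
  by_contra hne
  have := congrFun h i
  rw [flip_other hne] at this
  simp at this

theorem eq_flip_iff {i : Fin n} {z w : V n} : z = flip i w ↔ w = flip i z := by
  constructor <;> rintro rfl <;> simp

/-- Parity of a vertex as a Boolean. -/
noncomputable def par (z : V n) : Bool := decide (qparity z = 1)

theorem qparity_flip (i : Fin n) (z : V n) : qparity (flip i z) = qparity z + 1 := by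
  unfold qparity
  rw [← Finset.add_sum_erase _ _ (Finset.mem_univ i), ← Finset.add_sum_erase _ _ (Finset.mem_univ i)]
  have : ∀ x ∈ Finset.univ.erase i, (if flip i z x then (1 : ZMod 2) else 0) = if z x then 1 else 0 := by
    intro x hx
    rw [flip_other (Finset.ne_of_mem_erase hx)]
  rw [Finset.sum_congr rfl this, flip_same]
  cases z i <;> simp
  · rw [add_comm]
  · have h2 : (1 : ZMod 2) + 1 = 0 := by decide
    linear_combination -h2

@[simp] theorem par_flip (i : Fin n) (z : V n) : par (flip i z) = !par z := by
  unfold par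
  rw [qparity_flip]
  generalize qparity z = q
  revert q; decide

theorem par_ne_iff (x y : V n) : par x ≠ par y ↔ qparity x ≠ qparity y := by
  unfold par
  generalize qparity x = q
  generalize qparity y = r
  revert q r; decide

@[simp] theorem flip_ne (i : Fin n) (z : V n) : flip i z ≠ z := fun h => by
  have := congrArg par h; simp at this

@[simp] theorem ne_flip (i : Fin n) (z : V n) : z ≠ flip i z := fun h => flip_ne i z h.symm

/-- The subcube with free coordinates `I` through `b`. -/
def S (I : Finset (Fin n)) (b : V n) : Finset (V n) :=
  Finset.univ.filter fun z => ∀ i, i ∉ I → z i = b i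

variable {I : Finset (Fin n)} {b c z w x y : V n} {i j k : Fin n}

theorem mem_S : z ∈ S I b ↔ ∀ i, i ∉ I → z i = b i := by simp [S]

@[simp] theorem self_mem_S : b ∈ S I b := by simp [mem_S]

theorem S_eq (h : z ∈ S I b) : S I z = S I b := by
  ext w; rw [mem_S] at h; simp only [mem_S]
  exact forall₂_congr fun i hi => by rw [h i hi]

@[simp] theorem S_flip (h : i ∈ I) : S I (flip i b) = S I b := by
  apply S_eq; rw [mem_S]; intro k hk; exact flip_other (by rintro rfl; exact hk h) _

theorem mem_S_comm : z ∈ S I b ↔ b ∈ S I z := by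
  simp only [mem_S]; exact forall₂_congr fun i _ => eq_comm

theorem flip_mem (h : i ∈ I) : flip i z ∈ S I b ↔ z ∈ S I b := by
  rw [mem_S_comm, S_flip h, mem_S_comm]

theorem flip_mem_flip : flip j z ∈ S I (flip j b) ↔ z ∈ S I b := by
  simp only [mem_S]
  refine forall₂_congr fun i _ => ?_
  by_cases h : i = j
  · subst h; simp
  · rw [flip_other h, flip_other h]

theorem flip_mem_swap : flip j z ∈ S I b ↔ z ∈ S I (flip j b) := by
  rw [← flip_mem_flip (j := j), flip_flip]

theorem S_mono {J : Finset (Fin n)} (h : J ⊆ I) : S J b ⊆ S I b := by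
  intro z hz; rw [mem_S] at *; exact fun i hi => hz i fun h' => hi (h h')

theorem mem_erase_iff (hj : j ∈ I) : z ∈ S (I.erase j) b ↔ z ∈ S I b ∧ z j = b j := by
  simp only [mem_S, mem_erase, not_and_or, not_not]
  constructor
  · exact fun h => ⟨fun i hi => h i (Or.inr hi), h j (Or.inl rfl)⟩
  · rintro ⟨h1, h2⟩ i (rfl | hi)
    · exact h2
    · exact h1 i hi

theorem mem_erase_flip_iff (hj : j ∈ I) : z ∈ S (I.erase j) (flip j b) ↔ z ∈ S I b ∧ z j ≠ b j := by
  rw [mem_erase_iff hj, S_flip hj, flip_same]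
  have : (z j = !b j) ↔ z j ≠ b j := by cases z j <;> cases b j <;> simp
  rw [this]

theorem halves (hj : j ∈ I) : S I b = S (I.erase j) b ∪ S (I.erase j) (flip j b) := by
  ext z; rw [mem_union, mem_erase_iff hj, mem_erase_flip_iff hj]; tauto

theorem halves_disj : Disjoint (S (I.erase j) b) (S (I.erase j) (flip j b)) := by
  rw [Finset.disjoint_left]
  intro z h1 h2
  rw [mem_S] at h1 h2
  have h1 := h1 j (by simp)
  have h2 := h2 j (by simp)
  rw [h1] at h2; simp at h2

theorem halves_val (hj : j ∈ I) :
    (S I b).val = (S (I.erase j) b).val + (S (I.erase j) (flip j b)).val := by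
  rw [halves hj, ← Finset.disjUnion_eq_union _ _ halves_disj, Finset.disjUnion_val]

theorem S_empty : S ∅ b = {b} := by
  ext z; simp only [mem_S, mem_singleton]; simp [funext_iff]

theorem S_succ (hj : j ∈ I) : (S I b).card = 2 * (S (I.erase j) b).card := by
  rw [halves hj, Finset.card_union_of_disjoint halves_disj, two_mul]
  congr 1
  refine (Finset.card_bij (fun z _ => flip j z) (fun z hz => flip_mem_flip.2 hz) ?_ ?_).symm
  · intro _ _ _ _ h; simpa using h
  · intro z hz; exact ⟨flip j z, by rwa [flip_mem_swap], by simp⟩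

theorem card_S : (S I b).card = 2 ^ I.card := by
  induction I using Finset.induction_on generalizing b with
  | empty => simp [S_empty]
  | insert a s ha ih => rw [S_succ (mem_insert_self a s), erase_insert ha, ih, card_insert_of_notMem ha]; ring

theorem card_par (q : Bool) (hI : I.Nonempty) :
    ((S I b).filter fun z => par z = q).card = 2 ^ (I.card - 1) := by
  obtain ⟨j, hj⟩ := hI
  have h1 : ((S I b).filter fun z => par z = q).card = ((S I b).filter fun z => ¬ par z = q).card := by
    refine Finset.card_bij (fun z _ => flip j z) ?_ ?_ ?_
    · intro z hz
      simp only [mem_filter, flip_mem hj, par_flip] at hz ⊢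
      exact ⟨hz.1, by rw [hz.2]; simp⟩
    · intro _ _ _ _ h; simpa using h
    · intro z hz
      simp only [mem_filter] at hz
      refine ⟨flip j z, ?_, by simp⟩
      simp only [mem_filter, flip_mem hj, par_flip]
      refine ⟨hz.1, ?_⟩
      have := hz.2
      cases h : par z <;> cases q <;> simp_all
  have h2 := Finset.card_filter_add_card_filter_not (s := S I b) (fun z => par z = q)
  rw [card_S] at h2
  have h3 : 0 < I.card := Finset.card_pos.2 ⟨j, hj⟩
  obtain ⟨m, hm⟩ : ∃ m, I.card = m + 1 := ⟨I.card - 1, by omega⟩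
  rw [hm] at h2 ⊢
  simp only [Nat.add_sub_cancel]
  rw [pow_succ] at h2
  omega

/-- A vertex of given parity avoiding a small set. -/
theorem exists_conn (q : Bool) (hI : I.Nonempty) (b : V n) (X : Finset (V n))
    (hX : X.card < 2 ^ (I.card - 1)) : ∃ s ∈ S I b, par s = q ∧ s ∉ X := by
  rw [← card_par (b := b) q hI] at hX
  obtain ⟨s, hs, hs'⟩ := Finset.exists_mem_notMem_of_card_lt_card hX
  rw [mem_filter] at hs
  exact ⟨s, hs.1, hs.2, hs'⟩

end HC

namespace HC

/-- `Path R M x y`: a walk along `R` from `x` to `y` whose multiset of vertices is `M`. -/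
inductive Path {α : Type*} (R : α → α → Prop) : Multiset α → α → α → Prop
  | single (x : α) : Path R {x} x x
  | cons {x z y : α} {M : Multiset α} : R x z → Path R M z y → Path R (x ::ₘ M) x y

namespace Path

variable {α : Type*} {R R' : α → α → Prop} {M N : Multiset α} {x y s t r a b : α}

theorem of_eq (h : Path R M x y) (e : M = N) : Path R N x y := e ▸ h

theorem start_mem (h : Path R M x y) : x ∈ M := by cases h <;> simp

theorem end_mem (h : Path R M x y) : y ∈ M := by
  induction h with
  | single => simp
  | cons _ _ ih => simp [ih]

theorem join (h : Path R M x s) (e : R s t) (h' : Path R N t y) : Path R (M + N) x y := by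
  induction h with
  | single => simpa using Path.cons e h'
  | cons e' _ ih => rw [Multiset.cons_add]; exact Path.cons e' (ih e)

theorem rev (hR : ∀ u w, R u w → R w u) (h : Path R M x y) : Path R M y x := by
  induction h with
  | single x => exact Path.single x
  | cons e _ ih => exact (ih.join (hR _ _ e) (Path.single _)).of_eq (by rw [add_comm, Multiset.singleton_add])

theorem single_of_end (h : Path R M x y) (hM : M.Nodup) (e : x = y) : M = {x} := by
  cases h with
  | single => rfl
  | cons _ h => subst e; exact absurd h.end_mem (Multiset.nodup_cons.1 hM).1

theorem cut_before (h : Path R M x y) (hr : r ∈ M) (hx : r ≠ x) :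
    ∃ M1 M2 s, M = M1 + M2 ∧ Path R M1 x s ∧ R s r ∧ Path R M2 r y := by
  induction h with
  | single => simp at hr; exact absurd hr hx
  | @cons x z y M e h ih =>
    by_cases hz : r = z
    · subst hz; exact ⟨{x}, M, x, by simp, Path.single x, e, h⟩
    · obtain ⟨M1, M2, s, rfl, h1, e1, h2⟩ := ih (by simpa [hx] using hr) hz
      exact ⟨x ::ₘ M1, M2, s, by simp, Path.cons e h1, e1, h2⟩

theorem cut_after (hR : ∀ u w, R u w → R w u) (h : Path R M x y) (hr : r ∈ M) (hy : r ≠ y) :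
    ∃ M1 M2 s, M = M1 + M2 ∧ Path R M1 x r ∧ R r s ∧ Path R M2 s y := by
  obtain ⟨M1, M2, s, rfl, h1, e, h2⟩ := (h.rev hR).cut_before hr hy
  exact ⟨M2, M1, s, add_comm _ _, h2.rev hR, hR _ _ e, h1.rev hR⟩

/-- A path with few vertices in `X` has an edge avoiding `X`. -/
theorem cut_edge (h : Path R M x y) (X : α → Prop)
    (hX : 2 * M.countP X + (if X x then 1 else 2) ≤ Multiset.card M) :
    ∃ M1 M2 s t, M = M1 + M2 ∧ Path R M1 x s ∧ R s t ∧ Path R M2 t y ∧ ¬ X s ∧ ¬ X t := by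
  induction h with
  | single x =>
    rw [← Multiset.cons_zero, Multiset.countP_cons] at hX
    by_cases h : X x <;> simp [h] at hX
  | @cons x z y M e h ih =>
    by_cases hx : X x
    · simp only [Multiset.countP_cons, hx, if_true, Multiset.card_cons] at hX
      obtain ⟨M1, M2, s, t, rfl, h1, e1, h2, hs⟩ := ih (by split_ifs <;> omega)
      exact ⟨x ::ₘ M1, M2, s, t, by simp, Path.cons e h1, e1, h2, hs⟩
    · by_cases hz : X z
      · simp only [Multiset.countP_cons, hx, if_false, Multiset.card_cons] at hX
        obtain ⟨M1, M2, s, t, rfl, h1, e1, h2, hs⟩ := ih (by rw [if_pos hz]; omega)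
        exact ⟨x ::ₘ M1, M2, s, t, by simp, Path.cons e h1, e1, h2, hs⟩
      · exact ⟨{x}, M, x, z, by simp, Path.single x, e, h, hx, hz⟩

theorem unfault (h : Path R' M x y) (hM : M.Nodup)
    (hR : ∀ u w, R' u w → R u w ∨ (u = a ∧ w = b) ∨ (u = b ∧ w = a)) :
    Path R M x y ∨ (∃ M1 M2, M = M1 + M2 ∧ Path R M1 x a ∧ Path R M2 b y) ∨
      (∃ M1 M2, M = M1 + M2 ∧ Path R M1 x b ∧ Path R M2 a y) := by
  induction h with
  | single x => exact Or.inl (Path.single x)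
  | @cons x z y M e h ih =>
    rw [Multiset.nodup_cons] at hM
    rcases hR _ _ e with e' | ⟨rfl, rfl⟩ | ⟨rfl, rfl⟩
    · rcases ih hM.2 with h1 | ⟨M1, M2, rfl, h1, h2⟩ | ⟨M1, M2, rfl, h1, h2⟩
      · exact Or.inl (Path.cons e' h1)
      · exact Or.inr (Or.inl ⟨x ::ₘ M1, M2, by simp, Path.cons e' h1, h2⟩)
      · exact Or.inr (Or.inr ⟨x ::ₘ M1, M2, by simp, Path.cons e' h1, h2⟩)
    · rcases ih hM.2 with h1 | ⟨M1, M2, rfl, h1, h2⟩ | ⟨M1, M2, rfl, h1, h2⟩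
      · exact Or.inr (Or.inl ⟨{x}, M, by simp, Path.single _, h1⟩)
      · exact absurd (Multiset.mem_add.2 (Or.inl h1.end_mem)) hM.1
      · exact absurd (Multiset.mem_add.2 (Or.inr h2.start_mem)) hM.1
    · rcases ih hM.2 with h1 | ⟨M1, M2, rfl, h1, h2⟩ | ⟨M1, M2, rfl, h1, h2⟩
      · exact Or.inr (Or.inr ⟨{x}, M, by simp, Path.single _, h1⟩)
      · exact absurd (Multiset.mem_add.2 (Or.inr h2.start_mem)) hM.1
      · exact absurd (Multiset.mem_add.2 (Or.inl h1.end_mem)) hM.1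

/-- Among many vertices of a path one has its predecessor outside a small set. -/
theorem exists_pred (h : Path R M x y) (hM : M.Nodup) (W X : Finset α)
    (hW : ∀ r ∈ W, r ∈ M ∧ r ≠ x) (hc : X.card < W.card) :
    ∃ r ∈ W, ∃ M1 M2 s, M = M1 + M2 ∧ Path R M1 x s ∧ R s r ∧ Path R M2 r y ∧ s ∉ X := by
  induction h generalizing W X with
  | single x =>
    obtain ⟨r, hr⟩ := Finset.card_pos.1 (lt_of_le_of_lt (Nat.zero_le _) hc)
    have := hW r hr
    simp at this
  | @cons x z y M e h ih =>
    rw [Multiset.nodup_cons] at hM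
    by_cases hz : z ∈ W ∧ x ∉ X
    · exact ⟨z, hz.1, {x}, M, x, by simp, Path.single x, e, h, hz.2⟩
    · obtain ⟨r, hr, M1, M2, s, rfl, h1, e1, h2, hs⟩ := ih hM.2 (W.erase z) (X.erase x) (by
        intro r hr
        rw [mem_erase] at hr
        obtain ⟨h1, h2⟩ := hW r hr.2
        exact ⟨by simpa [h2] using h1, hr.1⟩) (by
        by_cases hzW : z ∈ W
        · have hx : x ∈ X := by_contra fun h => hz ⟨hzW, h⟩
          have := Finset.card_pos.2 ⟨x, hx⟩
          rw [card_erase_of_mem hzW, card_erase_of_mem hx]; omega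
        · rw [erase_eq_of_notMem hzW]; exact lt_of_le_of_lt (card_erase_le) hc)
      refine ⟨r, mem_of_mem_erase hr, x ::ₘ M1, M2, s, by simp, Path.cons e h1, e1, h2, fun h => hs ?_⟩
      rw [mem_erase]
      refine ⟨?_, h⟩
      rintro rfl
      exact hM.1 (Multiset.mem_add.2 (Or.inl h1.end_mem))

end Path
end HC

namespace HC

/-- A set of faulty edges, given as a symmetric predicate on (vertex, direction). -/
structure Flt (n : ℕ) where
  p : V n → Fin n → Prop
  symm : ∀ z i, p (flip i z) i ↔ p z i

instance (n : ℕ) : CoeFun (Flt n) fun _ => V n → Fin n → Prop := ⟨Flt.p⟩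

variable {n : ℕ} {f : Flt n} {I J : Finset (Fin n)} {b c z w x y : V n} {i j k : Fin n}

@[simp] theorem Flt.flip_iff (f : Flt n) (z : V n) (i : Fin n) : f (flip i z) i ↔ f z i := f.symm z i

/-- Adjacency along a non-faulty edge. -/
def R (f : Flt n) (z w : V n) : Prop := ∃ i, w = flip i z ∧ ¬ f z i

theorem R_symm (u w : V n) (h : R f u w) : R f w u := by
  obtain ⟨i, rfl, h⟩ := h; exact ⟨i, by simp, by simpa using h⟩

theorem R_flip (h : ¬ f z i) : R f z (flip i z) := ⟨i, rfl, h⟩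

theorem R_flip' (h : ¬ f z i) : R f (flip i z) z := R_symm _ _ (R_flip h)

theorem R_par (h : R f z w) : par w = !par z := by
  obtain ⟨i, rfl, -⟩ := h; simp

/-- Number of faulty edges at a vertex inside directions `I`. -/
noncomputable def d (f : Flt n) (I : Finset (Fin n)) (z : V n) : ℕ := (I.filter (f z)).card

/-- Twice the number of faulty edges in a subcube. -/
noncomputable def E (f : Flt n) (I : Finset (Fin n)) (b : V n) : ℕ := ∑ z ∈ S I b, d f I z

/-- The vertices of a subcube whose edge in direction `j` is faulty. -/
noncomputable def Bl (f : Flt n) (J : Finset (Fin n)) (c : V n) (j : Fin n) : Finset (V n) :=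
  (S J c).filter fun z => f z j

theorem mem_Bl : z ∈ Bl f J c j ↔ z ∈ S J c ∧ f z j := by simp [Bl]

theorem E_congr (h : z ∈ S I b) : E f I z = E f I b := by rw [E, E, S_eq h]

theorem d_erase (hj : j ∈ I) : d f I z = d f (I.erase j) z + if f z j then 1 else 0 := by
  unfold d
  conv_lhs => rw [← insert_erase hj]
  rw [filter_insert]
  split_ifs <;> simp

theorem card_Bl_flip : (Bl f (I.erase j) (flip j c) j).card = (Bl f (I.erase j) c j).card := by
  refine Finset.card_bij (fun z _ => flip j z) ?_ (fun _ _ _ _ h => by simpa using h) ?_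
  · intro z hz
    rw [mem_Bl] at *
    exact ⟨by rw [flip_mem_swap]; exact hz.1, by simpa using hz.2⟩
  · intro z hz
    rw [mem_Bl] at hz
    exact ⟨flip j z, by rw [mem_Bl, flip_mem_flip]; simpa using hz, by simp⟩

theorem sum_halves (hj : j ∈ I) (g : V n → ℕ) : ∑ z ∈ S I c, g z =
    ∑ z ∈ S (I.erase j) c, g z + ∑ z ∈ S (I.erase j) (flip j c), g z := by
  rw [halves hj, sum_union halves_disj]

theorem E_split (hj : j ∈ I) : E f I c =
    E f (I.erase j) c + E f (I.erase j) (flip j c) + 2 * (Bl f (I.erase j) c j).card := by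
  have h : ∀ b, ∑ z ∈ S (I.erase j) b, d f I z = E f (I.erase j) b + (Bl f (I.erase j) b j).card := by
    intro b
    rw [sum_congr rfl fun z _ => d_erase hj, sum_add_distrib, Bl, card_filter]; rfl
  rw [E, sum_halves hj, h, h, card_Bl_flip]; ring

theorem exists_fault (h : E f I b ≠ 0) : ∃ z ∈ S I b, ∃ i ∈ I, f z i := by
  by_contra hc
  push Not at hc
  refine h (sum_eq_zero fun z hz => ?_)
  rw [d, card_eq_zero, filter_eq_empty_iff]
  exact fun i hi => hc z hz i hi

/-- Hamiltonian laceability of a subcube. -/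
def Lace (f : Flt n) (I : Finset (Fin n)) (b : V n) : Prop :=
  ∀ x ∈ S I b, ∀ y ∈ S I b, par x ≠ par y → Path (R f) (S I b).val x y

/-- Two disjoint paths covering a subcube. -/
def Two (f : Flt n) (I : Finset (Fin n)) (b x1 y1 x2 y2 : V n) : Prop :=
  ∃ M1 M2, (S I b).val = M1 + M2 ∧ Path (R f) M1 x1 y1 ∧ Path (R f) M2 x2 y2

theorem Lace_congr (h : z ∈ S I b) : Lace f I z ↔ Lace f I b := by rw [Lace, Lace, S_eq h]

theorem Two_congr (h : z ∈ S I b) {x1 y1 x2 y2 : V n} :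
    Two f I z x1 y1 x2 y2 ↔ Two f I b x1 y1 x2 y2 := by rw [Two, Two, S_eq h]

theorem Two.swap {x1 y1 x2 y2 : V n} : Two f I b x1 y1 x2 y2 → Two f I b x2 y2 x1 y1 :=
  fun ⟨M1, M2, h, h1, h2⟩ => ⟨M2, M1, by rw [h, add_comm], h2, h1⟩

theorem Two.rev1 {x1 y1 x2 y2 : V n} : Two f I b x1 y1 x2 y2 → Two f I b y1 x1 x2 y2 :=
  fun ⟨M1, M2, h, h1, h2⟩ => ⟨M1, M2, h, h1.rev R_symm, h2⟩

theorem Two.rev2 {x1 y1 x2 y2 : V n} : Two f I b x1 y1 x2 y2 → Two f I b x1 y1 y2 x2 :=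
  fun h => h.swap.rev1.swap

theorem mem_of_add {T : Finset (V n)} {M N : Multiset (V n)} (h : T.val = M + N) (hz : z ∈ M) : z ∈ T := by
  rw [← Finset.mem_val, h]; exact Multiset.mem_add.2 (Or.inl hz)

theorem mem_of_add' {T : Finset (V n)} {M N : Multiset (V n)} (h : T.val = M + N) (hz : z ∈ N) : z ∈ T := by
  rw [← Finset.mem_val, h]; exact Multiset.mem_add.2 (Or.inr hz)

theorem countP_Bl : (S J c).val.countP (fun z => f z j) = (Bl f J c j).card := by
  rw [Bl, Finset.card_def, Finset.filter_val, Multiset.countP_eq_card_filter]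

theorem card_val : Multiset.card (S J c).val = 2 ^ J.card := by rw [← card_S (b := c)]; rfl

/-- Insert a path of the other half into a path, given an unblocked edge. -/
theorem detour (h1 : Lace f (I.erase j) (flip j c)) {M : Multiset (V n)} {x y : V n}
    (hM : M ≤ (S (I.erase j) c).val)
    (h : Path (R f) M x y)
    (hc : 2 * M.countP (fun z => f z j) + 2 ≤ Multiset.card M) :
    Path (R f) (M + (S (I.erase j) (flip j c)).val) x y := by
  obtain ⟨M1, M2, s, t, rfl, p1, e, p2, hs, ht⟩ := h.cut_edge (fun z => f z j) (by split_ifs <;> omega)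
  have hs' : s ∈ S (I.erase j) c := Multiset.mem_of_le hM (Multiset.mem_add.2 (Or.inl p1.end_mem))
  have ht' : t ∈ S (I.erase j) c := Multiset.mem_of_le hM (Multiset.mem_add.2 (Or.inr p2.start_mem))
  have q := h1 (flip j s) (flip_mem_flip.2 hs') (flip j t) (flip_mem_flip.2 ht') (by
    rw [par_flip, par_flip, R_par e]; simp)
  exact ((p1.join (R_flip hs) (q.join (R_flip' ht) p2))).of_eq (by abel)

theorem lace_split_aux (hj : j ∈ I) (h0 : Lace f (I.erase j) c) (h1 : Lace f (I.erase j) (flip j c))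
    (hB : 2 * (Bl f (I.erase j) c j).card + 2 ≤ 2 ^ (I.erase j).card)
    (hx : x ∈ S (I.erase j) c) (hy : y ∈ S I c) (hxy : par x ≠ par y) :
    Path (R f) (S I c).val x y := by
  rw [halves hj, mem_union] at hy
  rw [halves_val hj]
  rcases hy with hy | hy
  · exact detour h1 le_rfl (h0 x hx y hy hxy) (by rw [countP_Bl, card_val]; exact hB)
  · have hne : (I.erase j).Nonempty := by
      rw [nonempty_iff_ne_empty]; intro h; rw [h] at hB; simp at hB
    obtain ⟨s, hs, hps, hsB⟩ := exists_conn (!par x) hne c (Bl f (I.erase j) c j) (by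
      obtain ⟨m, hm⟩ : ∃ m, (I.erase j).card = m + 1 :=
        ⟨(I.erase j).card - 1, by have := card_pos.2 hne; omega⟩
      rw [hm, pow_succ] at hB; rw [hm]; simp only [Nat.add_sub_cancel]; omega)
    have hsf : ¬ f s j := fun h => hsB (mem_Bl.2 ⟨hs, h⟩)
    exact (h0 x hx s hs (by rw [hps]; simp)).join (R_flip hsf) (h1 _ (flip_mem_flip.2 hs) y hy (by
      rw [par_flip, hps]; simpa using hxy))

/-- If both halves are laceable and few vertical edges are faulty, the cube is laceable. -/
theorem lace_split (hj : j ∈ I) (h0 : Lace f (I.erase j) c) (h1 : Lace f (I.erase j) (flip j c))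
    (hB : 2 * (Bl f (I.erase j) c j).card + 2 ≤ 2 ^ (I.erase j).card) : Lace f I c := by
  intro x hx y hy hxy
  rw [halves hj, mem_union] at hx
  rcases hx with hx | hx
  · exact lace_split_aux hj h0 h1 hB hx hy hxy
  · rw [← S_flip hj] at hy ⊢
    exact lace_split_aux hj h1 (by simpa using h0) (by rw [card_Bl_flip]; exact hB) hx hy hxy

theorem S_single : S {i} b = {b, flip i b} := by
  rw [halves (mem_singleton_self i)]; simp [S_empty]

theorem lin_lt_pow (m : ℕ) (h : 2 ≤ m) : 2 * m ≤ 2 ^ m := by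
  induction m, h using Nat.le_induction with
  | base => norm_num
  | succ k hk ih => rw [pow_succ]; omega

/-- Cubes with at most `|I| - 2` faulty edges are laceable. -/
theorem lace_of_few (hI : I.Nonempty) (hE : E f I b + 4 ≤ 2 * I.card ∨ E f I b = 0) : Lace f I b := by
  induction hm : I.card generalizing I b with
  | zero => simp [card_eq_zero.1 hm] at hI
  | succ m ih =>
    rcases Nat.eq_zero_or_pos m with rfl | hm0
    · obtain ⟨i, rfl⟩ := card_eq_one.1 hm
      have h0 : E f {i} b = 0 := by rcases hE with h | h; · simp at h
                                    · exact h
      have hf : ¬ f b i := by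
        intro h
        have : d f {i} b = 0 := (sum_eq_zero_iff.1 h0) b self_mem_S
        simp [d, h] at this
      intro x hx y hy hxy
      rw [S_single] at *
      have hv : ({b, flip i b} : Finset (V n)).val = b ::ₘ {flip i b} := by
        rw [insert_val_of_notMem (by simp)]; rfl
      have p : Path (R f) (b ::ₘ {flip i b}) b (flip i b) := Path.cons (R_flip hf) (Path.single _)
      rw [hv]
      simp only [mem_insert, mem_singleton] at hx hy
      rcases hx with rfl | rfl <;> rcases hy with rfl | rfl <;> try exact absurd rfl hxy
      · exact p
      · exact p.rev R_symm
    · obtain ⟨z, hz, j, hj, hf⟩ : ∃ z ∈ S I b, ∃ j ∈ I, E f I b ≠ 0 → f z j := by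
        by_cases h : E f I b = 0
        · obtain ⟨j, hj⟩ := hI
          exact ⟨b, self_mem_S, j, hj, fun h' => absurd h h'⟩
        · obtain ⟨z, hz, j, hj, hf⟩ := exists_fault h
          exact ⟨z, hz, j, hj, fun _ => hf⟩
      rw [← Lace_congr hz]
      rw [← E_congr hz] at hE hf
      have hs := E_split (f := f) (c := z) hj
      have hpos : E f I z ≠ 0 → 0 < (Bl f (I.erase j) z j).card := fun h =>
        card_pos.2 ⟨z, mem_Bl.2 ⟨self_mem_S, hf h⟩⟩
      have hcard : (I.erase j).card = m := by rw [card_erase_of_mem hj]; omega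
      have hne : (I.erase j).Nonempty := card_pos.1 (by omega)
      refine lace_split hj (ih hne ?_ hcard) (ih hne ?_ hcard) ?_
      · rw [hcard]; by_cases h : E f I z = 0
        · omega
        · have := hpos h; omega
      · rw [hcard]; by_cases h : E f I z = 0
        · omega
        · have := hpos h; omega
      · rw [hcard]
        by_cases h : m = 1
        · subst h; omega
        · have := lin_lt_pow m (by omega); omega
end HC

namespace HC

variable {n : ℕ} {f : Flt n} {I J : Finset (Fin n)} {b c z w x y : V n} {i j k : Fin n}

theorem pair_adj (hij : i ≠ j) (hx : x ∈ S {i, j} z) (h : par x ≠ par z) : x = flip i z ∨ x = flip j z := by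
  rw [halves (j := i) (by simp), erase_insert (by simpa using hij), S_single, S_single] at hx
  simp only [mem_union, mem_insert, mem_singleton] at hx
  rcases hx with (rfl | rfl) | rfl | rfl
  · exact absurd rfl h
  · exact Or.inr rfl
  · exact Or.inl rfl
  · simp at h

/-- Laceability for every pair in a cube with at most `|I| - 3` faults: two disjoint paths. -/
def TwoAll (f : Flt n) (I : Finset (Fin n)) (b : V n) : Prop :=
  ∀ x1 ∈ S I b, ∀ y1 ∈ S I b, ∀ x2 ∈ S I b, ∀ y2 ∈ S I b, par x1 ≠ par y1 → par x2 ≠ par y2 →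
    x1 ≠ x2 → x1 ≠ y2 → y1 ≠ x2 → y1 ≠ y2 → Two f I b x1 y1 x2 y2

section step
variable {x1 y1 x2 y2 : V n}

theorem two_a (hj : j ∈ I) (T0 : TwoAll f (I.erase j) c) (h1 : Lace f (I.erase j) (flip j c))
    (hB : 2 * (Bl f (I.erase j) c j).card + 2 < 2 ^ (I.erase j).card)
    (a1 : x1 ∈ S (I.erase j) c) (b1 : y1 ∈ S (I.erase j) c)
    (a2 : x2 ∈ S (I.erase j) c) (b2 : y2 ∈ S (I.erase j) c)
    (p1 : par x1 ≠ par y1) (p2 : par x2 ≠ par y2)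
    (d1 : x1 ≠ x2) (d2 : x1 ≠ y2) (d3 : y1 ≠ x2) (d4 : y1 ≠ y2) : Two f I c x1 y1 x2 y2 := by
  obtain ⟨M1, M2, hM, q1, q2⟩ := T0 x1 a1 y1 b1 x2 a2 y2 b2 p1 p2 d1 d2 d3 d4
  have hc1 := countP_Bl (f := f) (J := I.erase j) (c := c) (j := j)
  have hc2 := card_val (J := I.erase j) (c := c)
  rw [hM] at hc1 hc2
  rw [Multiset.countP_add] at hc1
  rw [Multiset.card_add] at hc2
  rw [← hc1, ← hc2] at hB
  by_cases h : 2 * M1.countP (fun z => f z j) + 2 ≤ Multiset.card M1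
  · refine ⟨_, M2, ?_, detour h1 (hM ▸ Multiset.le_add_right _ _) q1 h, q2⟩
    rw [halves_val hj, hM]; abel
  · refine ⟨M1, _, ?_, q1, detour h1 (hM ▸ Multiset.le_add_left _ _) q2 (by omega)⟩
    rw [halves_val hj, hM]; abel

theorem two_b (hj : j ∈ I) (h0 : Lace f (I.erase j) c) (h1 : Lace f (I.erase j) (flip j c))
    (a1 : x1 ∈ S (I.erase j) c) (b1 : y1 ∈ S (I.erase j) c)
    (a2 : x2 ∈ S (I.erase j) (flip j c)) (b2 : y2 ∈ S (I.erase j) (flip j c))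
    (p1 : par x1 ≠ par y1) (p2 : par x2 ≠ par y2) : Two f I c x1 y1 x2 y2 :=
  ⟨_, _, halves_val hj, h0 x1 a1 y1 b1 p1, h1 x2 a2 y2 b2 p2⟩

theorem not_Bl_iff {s : V n} (hs : s ∈ S J c) (h : s ∉ Bl f J c j) : ¬ f s j :=
  fun h' => h (mem_Bl.2 ⟨hs, h'⟩)

theorem two_c (hj : j ∈ I) (T0 : TwoAll f (I.erase j) c) (h1 : Lace f (I.erase j) (flip j c))
    (hB : (Bl f (I.erase j) c j).card + 1 < 2 ^ ((I.erase j).card - 1)) (hne : (I.erase j).Nonempty)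
    (a1 : x1 ∈ S (I.erase j) c) (b1 : y1 ∈ S (I.erase j) c)
    (a2 : x2 ∈ S (I.erase j) c) (b2 : y2 ∈ S (I.erase j) (flip j c))
    (p1 : par x1 ≠ par y1) (p2 : par x2 ≠ par y2)
    (d1 : x1 ≠ x2) (d3 : y1 ≠ x2) : Two f I c x1 y1 x2 y2 := by
  obtain ⟨s, hs, ps, hsX⟩ := exists_conn (!par x2) hne c
    (insert (if par x1 = par x2 then y1 else x1) (Bl f (I.erase j) c j))
    (lt_of_le_of_lt (card_insert_le _ _) hB)
  rw [mem_insert, not_or] at hsX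
  have e1 : x1 ≠ s := by
    rintro rfl; have := hsX.1; split_ifs at this with h
    · rw [h] at ps; simp at ps
    · exact this rfl
  have e2 : y1 ≠ s := by
    rintro rfl; have := hsX.1; split_ifs at this with h
    · exact this rfl
    · cases h1 : par x1 <;> cases h2 : par x2 <;> simp_all
  obtain ⟨M1, M2, hM, q1, q2⟩ := T0 x1 a1 y1 b1 x2 a2 s hs p1 (by rw [ps]; simp) d1 e1 d3 e2
  refine ⟨M1, _, ?_, q1, q2.join (R_flip (not_Bl_iff hs hsX.2))
    (h1 (flip j s) (flip_mem_flip.2 hs) y2 b2 (by rw [par_flip, ps]; simpa using p2))⟩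
  rw [halves_val hj, hM]; abel

theorem two_d (hj : j ∈ I) (T0 : TwoAll f (I.erase j) c) (T1 : TwoAll f (I.erase j) (flip j c))
    (hB : (Bl f (I.erase j) c j).card + 2 < 2 ^ ((I.erase j).card - 1) ∨ (par x1 = par x2 ∧
      (Bl f (I.erase j) c j).card + 1 < 2 ^ ((I.erase j).card - 1))) (hne : (I.erase j).Nonempty)
    (a1 : x1 ∈ S (I.erase j) c) (b1 : y1 ∈ S (I.erase j) (flip j c))
    (a2 : x2 ∈ S (I.erase j) c) (b2 : y2 ∈ S (I.erase j) (flip j c))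
    (p1 : par x1 ≠ par y1) (p2 : par x2 ≠ par y2)
    (d1 : x1 ≠ x2) (d4 : y1 ≠ y2) : Two f I c x1 y1 x2 y2 := by
  have key : ∃ s1 ∈ S (I.erase j) c, ∃ s2 ∈ S (I.erase j) c, par s1 = !par x1 ∧ par s2 = !par x2 ∧
      ¬ f s1 j ∧ ¬ f s2 j ∧ s1 ≠ s2 ∧ s1 ≠ x2 ∧ s2 ≠ x1 ∧ flip j s1 ≠ y2 ∧ flip j s2 ≠ y1 := by
    by_cases hp : par x1 = par x2
    · obtain ⟨s1, hs1, ps1, h1⟩ := exists_conn (!par x1) hne c (Bl f (I.erase j) c j) (by omega)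
      obtain ⟨s2, hs2, ps2, h2⟩ := exists_conn (!par x2) hne c (insert s1 (Bl f (I.erase j) c j))
        (lt_of_le_of_lt (card_insert_le _ _) (by omega))
      rw [mem_insert, not_or] at h2
      refine ⟨s1, hs1, s2, hs2, ps1, ps2, not_Bl_iff hs1 h1, not_Bl_iff hs2 h2.2, Ne.symm h2.1, ?_, ?_, ?_, ?_⟩
      · rintro rfl; simp [hp] at ps1
      · rintro rfl; simp [hp] at ps2
      · rintro rfl; simp [ps1, hp] at p2
      · rintro rfl; simp [ps2, hp] at p1
    · have hB : (Bl f (I.erase j) c j).card + 2 < 2 ^ ((I.erase j).card - 1) := by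
        rcases hB with h | h
        · exact h
        · exact absurd h.1 hp
      have hc : ∀ a b : V n, (insert a (insert b (Bl f (I.erase j) c j))).card < 2 ^ ((I.erase j).card - 1) :=
        fun a b => lt_of_le_of_lt ((card_insert_le _ _).trans (Nat.succ_le_succ (card_insert_le _ _))) hB
      obtain ⟨s1, hs1, ps1, h1⟩ := exists_conn (!par x1) hne c _ (hc x2 (flip j y2))
      obtain ⟨s2, hs2, ps2, h2⟩ := exists_conn (!par x2) hne c _ (hc x1 (flip j y1))
      simp only [mem_insert, not_or] at h1 h2
      refine ⟨s1, hs1, s2, hs2, ps1, ps2, not_Bl_iff hs1 h1.2.2, not_Bl_iff hs2 h2.2.2, ?_, h1.1, h2.1, ?_, ?_⟩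
      · rintro rfl; rw [ps1] at ps2; exact hp (by simpa using ps2)
      · exact fun h => h1.2.1 (by rw [← h]; simp)
      · exact fun h => h2.2.1 (by rw [← h]; simp)
  obtain ⟨s1, hs1, s2, hs2, ps1, ps2, f1, f2, e1, e2, e3, e4, e5⟩ := key
  obtain ⟨M1, M2, hM, q1, q2⟩ := T0 x1 a1 s1 hs1 x2 a2 s2 hs2 (by rw [ps1]; simp) (by rw [ps2]; simp) d1
    (Ne.symm e3) e2 e1
  obtain ⟨N1, N2, hN, r1, r2⟩ := T1 (flip j s1) (flip_mem_flip.2 hs1) y1 b1 (flip j s2) (flip_mem_flip.2 hs2)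
    y2 b2 (by rw [par_flip, ps1]; simpa using p1) (by rw [par_flip, ps2]; simpa using p2)
    (by simpa using e1) e4 (Ne.symm e5) d4
  refine ⟨_, _, ?_, q1.join (R_flip f1) r1, q2.join (R_flip f2) r2⟩
  rw [halves_val hj, hM, hN]; abel

/-- The step, assuming `x1` lies in the half of `c`. -/
theorem two_step (hj : j ∈ I) (T0 : TwoAll f (I.erase j) c) (T1 : TwoAll f (I.erase j) (flip j c))
    (h0 : Lace f (I.erase j) c) (h1 : Lace f (I.erase j) (flip j c))
    (hB : (Bl f (I.erase j) c j).card + 1 < 2 ^ ((I.erase j).card - 1)) (hne : (I.erase j).Nonempty)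
    (hd : (Bl f (I.erase j) c j).card + 2 < 2 ^ ((I.erase j).card - 1) ∨ x1 j = y1 j ∨ x2 j = y2 j ∨
      (x1 j = x2 j ↔ par x1 = par x2))
    (a1 : x1 ∈ S (I.erase j) c) (b1 : y1 ∈ S I c) (a2 : x2 ∈ S I c) (b2 : y2 ∈ S I c)
    (p1 : par x1 ≠ par y1) (p2 : par x2 ≠ par y2)
    (d1 : x1 ≠ x2) (d2 : x1 ≠ y2) (d3 : y1 ≠ x2) (d4 : y1 ≠ y2) : Two f I c x1 y1 x2 y2 := by
  have hB2 : 2 * (Bl f (I.erase j) c j).card + 2 < 2 ^ (I.erase j).card := by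
    obtain ⟨m, hm⟩ : ∃ m, (I.erase j).card = m + 1 :=
        ⟨(I.erase j).card - 1, by have := card_pos.2 hne; omega⟩
    rw [hm] at hB ⊢; rw [pow_succ]; simp only [Nat.add_sub_cancel] at hB; omega
  have ff : flip j (flip j c) = c := flip_flip j c
  have hBf := card_Bl_flip (f := f) (I := I) (c := c) (j := j)
  have hval : ∀ {z}, z ∈ S (I.erase j) c → z j = c j := fun h => mem_S.1 h j (by simp)
  have hval' : ∀ {z}, z ∈ S (I.erase j) (flip j c) → z j = !c j := fun h => by
    rw [mem_S.1 h j (by simp)]; simp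
  rw [halves hj, mem_union] at b1 a2 b2
  rcases b1 with b1 | b1
  · rcases a2 with a2 | a2 <;> rcases b2 with b2 | b2
    · exact two_a hj T0 h1 hB2 a1 b1 a2 b2 p1 p2 d1 d2 d3 d4
    · exact two_c hj T0 h1 hB hne a1 b1 a2 b2 p1 p2 d1 d3
    · exact (two_c hj T0 h1 hB hne a1 b1 b2 a2 p1 p2.symm d2 d4).rev2
    · exact two_b hj h0 h1 a1 b1 a2 b2 p1 p2
  · rcases a2 with a2 | a2 <;> rcases b2 with b2 | b2
    · exact (two_c hj T0 h1 hB hne a2 b2 a1 b1 p2 p1 d1.symm d2.symm).swap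
    · refine two_d hj T0 T1 ?_ hne a1 b1 a2 b2 p1 p2 d1 d4
      rcases hd with h | h | h | h
      · exact Or.inl h
      · rw [hval a1, hval' b1] at h; simp at h
      · rw [hval a2, hval' b2] at h; simp at h
      · exact Or.inr ⟨h.1 (by rw [hval a1, hval a2]), hB⟩
    · refine (two_d hj T0 T1 ?_ hne a1 b1 b2 a2 p1 p2.symm d2 d3).rev2
      rcases hd with h | h | h | h
      · exact Or.inl h
      · rw [hval a1, hval' b1] at h; simp at h
      · rw [hval b2, hval' a2] at h; simp at h
      · refine Or.inr ⟨?_, hB⟩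
        rw [hval a1, hval' a2] at h
        have : par x1 ≠ par x2 := fun h' => by have := h.2 h'; simp at this
        cases h1 : par x1 <;> cases h2 : par x2 <;> cases h3 : par y2 <;> simp_all
    · have := two_c (f := f) (c := flip j c) (x1 := x2) (y1 := y2) (x2 := y1) (y2 := x1) hj T1
        (by rwa [ff]) (by rwa [hBf]) hne a2 b2 b1
        (by rwa [ff]) p2 p1.symm d3.symm d4.symm
      rw [Two_congr (by rw [flip_mem hj]; exact self_mem_S)] at this
      exact this.swap.rev1

end step

/-- Two disjoint covering paths when at most `|I| - 3` edges are faulty. -/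
theorem twoAll_of_few (hI : 2 ≤ I.card) (hE : E f I b + 6 ≤ 2 * I.card ∨ E f I b = 0) : TwoAll f I b := by
  induction hm : I.card generalizing I b with
  | zero => omega
  | succ m ih =>
  intro x1 a1 y1 b1 x2 a2 y2 b2 p1 p2 d1 d2 d3 d4
  by_cases hm1 : m = 1
  · subst hm1
    obtain ⟨i, j, hij, rfl⟩ := card_eq_two.1 hm
    have hE0 : E f {i, j} b = 0 := by omega
    have main : ∀ i j : Fin n, i ≠ j → S {i, j} x1 = S {i,j} b → E f {i, j} b = 0 → x2 ∈ S {i, j} x1 →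
        y2 ∈ S {i, j} x1 → y1 = flip i x1 → Two f {i, j} b x1 y1 x2 y2 := by
      rintro i j hij hSe hE0 a2 b2 rfl
      have hx1 : x1 ∈ S {i, j} b := by rw [← hSe]; exact self_mem_S
      rw [← Two_congr hx1]
      rw [← E_congr hx1] at hE0
      have hji : ({i, j} : Finset (Fin n)).erase j = {i} := by
        rw [pair_comm]; exact erase_insert (by simpa using hij.symm)
      have hj : j ∈ ({i, j} : Finset (Fin n)) := by simp
      have hs := E_split (f := f) (c := x1) hj
      have ho : ∀ z, z ∈ S {i, j} x1 → z ≠ x1 → z ≠ flip i x1 →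
          z ∈ S (({i, j} : Finset (Fin n)).erase j) (flip j x1) := by
        intro z hz h1 h2
        rw [halves hj, mem_union] at hz
        rcases hz with h | h
        · rw [hji, S_single] at h; simp [h1, h2] at h
        · exact h
      refine two_b hj (lace_of_few (by simp [hji]) (by omega)) (lace_of_few (by simp [hji]) (by omega)) self_mem_S ?_
        (ho _ a2 d1.symm d3.symm) (ho _ b2 d2.symm d4.symm) p1 p2
      rw [flip_mem (by simp [hji])]; exact self_mem_S
    rw [← S_eq a1] at b1 a2 b2
    rcases pair_adj hij b1 (Ne.symm p1) with h | h
    · exact main i j hij (S_eq a1) hE0 a2 b2 h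
    · rw [pair_comm i j] at *
      exact main j i hij.symm (S_eq a1) hE0 a2 b2 h
  · -- the inductive step
    have hm2 : 2 ≤ m := by omega
    have step : ∀ j ∈ I, ∀ z ∈ S I b, (E f I z ≠ 0 → f z j) →
        (E f I z ≠ 0 ∨ x1 j = y1 j ∨ x2 j = y2 j ∨ (x1 j = x2 j ↔ par x1 = par x2)) →
        Two f I b x1 y1 x2 y2 := by
      intro j hj z hz hf hd
      have hcard : (I.erase j).card = m := by rw [card_erase_of_mem hj]; omega
      have hne : (I.erase j).Nonempty := card_pos.1 (by omega)
      rw [← E_congr hz] at hE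
      have hpos : E f I z ≠ 0 → 0 < (Bl f (I.erase j) z j).card := fun h =>
        card_pos.2 ⟨z, mem_Bl.2 ⟨self_mem_S, hf h⟩⟩
      have hs := E_split (f := f) (c := z) hj
      have hE0 : ∀ c, c = z ∨ c = flip j z → E f (I.erase j) c + 6 ≤ 2 * m ∨ E f (I.erase j) c = 0 := by
        rintro c (rfl | rfl)
        · by_cases h : E f I c = 0
          · omega
          · have := hpos h; omega
        · by_cases h : E f I z = 0
          · omega
          · have := hpos h; omega
      have T : ∀ c, c = z ∨ c = flip j z → TwoAll f (I.erase j) c ∧ Lace f (I.erase j) c := by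
        intro c hc
        have := hE0 c hc
        exact ⟨ih (by omega) (by rwa [hcard]) hcard, lace_of_few hne (by omega)⟩
      have hlt : 2 * (m - 1) ≤ 2 ^ (m - 1) := by
        by_cases h : m = 2
        · subst h; norm_num
        · exact lin_lt_pow _ (by omega)
      have hlt' : m ≠ 2 → m < 2 ^ (m - 1) := by omega
      have hd' : (Bl f (I.erase j) z j).card + 2 < 2 ^ ((I.erase j).card - 1) ∨ x1 j = y1 j ∨ x2 j = y2 j ∨
          (x1 j = x2 j ↔ par x1 = par x2) := by
        rcases hd with h | h
        · left; rw [hcard]; have := hpos h; omega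
        · exact Or.inr h
      have hx1 := a1
      rw [← S_eq hz, halves hj, mem_union] at hx1
      rw [← S_eq hz] at a1 a2 b1 b2
      rw [← Two_congr hz]
      rcases hx1 with h | h
      · exact two_step hj (T z (Or.inl rfl)).1 (T _ (Or.inr rfl)).1 (T z (Or.inl rfl)).2 (T _ (Or.inr rfl)).2
          (by rw [hcard]; omega) hne hd' h b1 a2 b2 p1 p2 d1 d2 d3 d4
      · have hzf : flip j z ∈ S I z := by rw [flip_mem hj]; exact self_mem_S
        rw [← S_eq hzf] at a1 a2 b1 b2
        rw [← Two_congr hzf]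
        refine two_step hj (T _ (Or.inr rfl)).1 (by rw [flip_flip]; exact (T z (Or.inl rfl)).1)
          (T _ (Or.inr rfl)).2 (by rw [flip_flip]; exact (T z (Or.inl rfl)).2)
          (by rw [card_Bl_flip, hcard]; omega) hne (by rw [card_Bl_flip]; exact hd') h b1 a2 b2 p1 p2 d1 d2 d3 d4
    by_cases h0 : E f I b = 0
    · have any : ∀ j ∈ I, (x1 j = y1 j ∨ x2 j = y2 j ∨ (x1 j = x2 j ↔ par x1 = par x2)) →
          Two f I b x1 y1 x2 y2 := fun j hj h => step j hj b self_mem_S (fun h => absurd h0 h) (Or.inr h)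
      by_contra hc
      have any' : ∀ j ∈ I, x1 j ≠ y1 j ∧ x2 j ≠ y2 j ∧ ¬ (x1 j = x2 j ↔ par x1 = par x2) := by
        intro j hj
        by_contra h
        exact hc (any j hj (by tauto))
      by_cases hp : par x1 = par x2
      · apply d3
        ext i
        by_cases hi : i ∈ I
        · obtain ⟨h1, h2, h3⟩ := any' i hi
          have h4 : x1 i ≠ x2 i := fun h => h3 ⟨fun _ => hp, fun _ => h⟩
          cases h5 : x1 i <;> cases h6 : x2 i <;> cases h7 : y1 i <;> simp_all
        · rw [mem_S.1 b1 i hi, mem_S.1 a2 i hi]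
      · apply d4
        ext i
        by_cases hi : i ∈ I
        · obtain ⟨h1, h2, h3⟩ := any' i hi
          have h4 : x1 i = x2 i := by
            by_contra h; exact h3 ⟨fun h' => absurd h' h, fun h' => absurd h' hp⟩
          cases h5 : x1 i <;> cases h6 : x2 i <;> cases h7 : y1 i <;> cases h8 : y2 i <;> simp_all
        · rw [mem_S.1 b1 i hi, mem_S.1 b2 i hi]
    · obtain ⟨z, hz, j, hj, hf⟩ := exists_fault h0
      exact step j hj z hz (fun _ => hf) (Or.inl (by rwa [E_congr hz]))
end HC

namespace HC

variable {n : ℕ} {f : Flt n} {I J : Finset (Fin n)} {b c z w x y g h : V n} {i j k : Fin n}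

/-- Hamiltonian paths between vertices of one class after removing a vertex of the other class. -/
def Hyp (f : Flt n) (I : Finset (Fin n)) (b : V n) : Prop :=
  ∀ y ∈ S I b, ∀ g ∈ S I b, ∀ h ∈ S I b, par g ≠ par y → par h ≠ par y → g ≠ h →
    Path (R f) ((S I b).val.erase y) g h

theorem hyp_step (hj : j ∈ I) (H0 : Hyp f (I.erase j) c)
    (h1 : Lace f (I.erase j) (flip j c)) (T1 : TwoAll f (I.erase j) (flip j c))
    (hB : (Bl f (I.erase j) c j).card + 1 < 2 ^ ((I.erase j).card - 1)) (hne : (I.erase j).Nonempty)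
    (hy : y ∈ S (I.erase j) c) (hg : g ∈ S I c) (hh : h ∈ S I c) (pg : par g ≠ par y)
    (ph : par h ≠ par y) (hgh : g ≠ h) : Path (R f) ((S I c).val.erase y) g h := by
  have hval : (S I c).val.erase y = (S (I.erase j) c).val.erase y + (S (I.erase j) (flip j c)).val := by
    rw [halves_val hj, Multiset.erase_add_left_pos _ hy]
  have pgh : par g = par h := by cases h1 : par g <;> cases h2 : par h <;> cases h3 : par y <;> simp_all
  have mixed : ∀ g h, g ≠ h → par g ≠ par y → par h ≠ par y → g ∈ S (I.erase j) c →
      h ∈ S (I.erase j) (flip j c) → Path (R f) ((S I c).val.erase y) g h := by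
    intro g h hgh pg ph hg hh
    have pgh : par g = par h := by cases h1 : par g <;> cases h2 : par h <;> cases h3 : par y <;> simp_all
    obtain ⟨s, hs, ps, hsX⟩ := exists_conn (par g) hne c (insert g (Bl f (I.erase j) c j))
      (lt_of_le_of_lt (card_insert_le _ _) hB)
    rw [mem_insert, not_or] at hsX
    rw [hval]
    exact (H0 y hy g hg s hs pg (ps ▸ pg) (Ne.symm hsX.1)).join (R_flip (not_Bl_iff hs hsX.2))
      (h1 _ (flip_mem_flip.2 hs) h hh (by rw [par_flip, ps, pgh]; simp))
  rw [halves hj, mem_union] at hg hh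
  rcases hg with hg | hg <;> rcases hh with hh | hh
  · rw [hval]
    refine detour h1 (Multiset.erase_le _ _) (H0 y hy g hg h hh pg ph hgh) ?_
    have : Multiset.card ((S (I.erase j) c).val.erase y) + 1 = 2 ^ (I.erase j).card := by
      rw [← card_val (c := c), Multiset.card_erase_add_one hy]
    have h2 : ((S (I.erase j) c).val.erase y).countP (fun z => f z j) ≤ (Bl f (I.erase j) c j).card := by
      rw [← countP_Bl]; exact Multiset.countP_le_of_le _ (Multiset.erase_le _ _)
    obtain ⟨m, hm⟩ : ∃ m, (I.erase j).card = m + 1 :=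
        ⟨(I.erase j).card - 1, by have := card_pos.2 hne; omega⟩
    rw [hm] at this hB; rw [pow_succ] at this; simp only [Nat.add_sub_cancel] at hB; omega
  · exact mixed g h hgh pg ph hg hh
  · exact (mixed h g hgh.symm ph pg hh hg).rev R_symm
  · obtain ⟨s, hs, ps, hsX⟩ := exists_conn (par g) hne c (Bl f (I.erase j) c j) (by omega)
    obtain ⟨t, ht, pt, htX⟩ := exists_conn (par g) hne c (insert s (Bl f (I.erase j) c j))
      (lt_of_le_of_lt (card_insert_le _ _) hB)
    rw [mem_insert, not_or] at htX
    obtain ⟨M1, M2, hM, q1, q2⟩ := T1 g hg (flip j s) (flip_mem_flip.2 hs) (flip j t) (flip_mem_flip.2 ht) h hh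
      (by rw [par_flip, ps]; simp) (by rw [par_flip, pt, pgh]; simp)
      (by rintro rfl; simp at pt) hgh (by simpa using Ne.symm htX.1) (by rintro rfl; simp [ps] at pgh)
    rw [hval, hM]
    exact ((q1.join (R_flip' (not_Bl_iff hs hsX)) (H0 y hy s hs t ht (ps ▸ pg) (pt ▸ pg) (Ne.symm htX.1))).join
      (R_flip (not_Bl_iff ht htX.2)) q2).of_eq (by abel)

theorem hyp_of_few (hI : 2 ≤ I.card) (hE : E f I b + 6 ≤ 2 * I.card ∨ E f I b = 0) : Hyp f I b := by
  induction hm : I.card generalizing I b with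
  | zero => omega
  | succ m ih =>
  intro y hy g hg h hh pg ph hgh
  rw [← S_eq hy] at hg hh ⊢
  rw [← E_congr hy] at hE
  by_cases hm1 : m = 1
  · subst hm1
    obtain ⟨i, j, hij, rfl⟩ := card_eq_two.1 hm
    have hE0 : E f {i, j} y = 0 := by omega
    have main : ∀ i j : Fin n, i ≠ j → E f {i, j} y = 0 →
        Path (R f) ((S {i, j} y).val.erase y) (flip i y) (flip j y) := by
      intro i j hij hE0
      have hno : ∀ z ∈ S {i, j} y, ∀ k ∈ ({i, j} : Finset (Fin n)), ¬ f z k := by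
        intro z hz k hk hf
        have : d f {i, j} z = 0 := (sum_eq_zero_iff.1 hE0) z hz
        rw [d, card_eq_zero, filter_eq_empty_iff] at this
        exact this hk hf
      have hji : ({i, j} : Finset (Fin n)).erase j = {i} := by
        rw [pair_comm]; exact erase_insert (by simpa using hij.symm)
      have e : (S {i, j} y).val.erase y = flip i y ::ₘ (flip j (flip i y) ::ₘ {flip j y}) := by
        rw [halves_val (j := j) (by simp), hji, S_single, S_single, insert_val_of_notMem (by simp),
          insert_val_of_notMem (by simp), Multiset.cons_add, Multiset.erase_cons_head, flip_comm i j]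
        simp only [singleton_val, Multiset.singleton_add, flip_comm]
        rw [← Multiset.cons_zero, ← Multiset.cons_zero, Multiset.cons_swap (flip j y)]
      rw [e]
      have m1 : flip i y ∈ S {i, j} y := by rw [flip_mem (by simp)]; exact self_mem_S
      have m2 : flip j y ∈ S {i, j} y := by rw [flip_mem (by simp)]; exact self_mem_S
      exact Path.cons (R_flip (hno _ m1 _ (by simp))) (Path.cons (by
        rw [flip_comm]; exact R_flip' (hno _ m2 _ (by simp))) (Path.single _))
    rcases pair_adj hij hg pg with rfl | rfl <;> rcases pair_adj hij hh ph with rfl | rfl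
    · exact absurd rfl hgh
    · exact main i j hij hE0
    · rw [pair_comm] at *; exact main j i hij.symm hE0
    · exact absurd rfl hgh
  · obtain ⟨w, hw, j, hj, hf⟩ : ∃ z ∈ S I y, ∃ j ∈ I, E f I y ≠ 0 → f z j := by
      by_cases h : E f I y = 0
      · obtain ⟨j, hj⟩ : I.Nonempty := card_pos.1 (by omega)
        exact ⟨y, self_mem_S, j, hj, fun h' => absurd h h'⟩
      · obtain ⟨z, hz, j, hj, hf⟩ := exists_fault h
        exact ⟨z, hz, j, hj, fun _ => hf⟩
    have hcard : (I.erase j).card = m := by rw [card_erase_of_mem hj]; omega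
    have hne : (I.erase j).Nonempty := card_pos.1 (by omega)
    have hs := E_split (f := f) (c := y) hj
    have hpos : E f I y ≠ 0 → 0 < (Bl f (I.erase j) y j).card := fun h => by
      rw [halves hj, mem_union] at hw
      rcases hw with hw | hw
      · exact card_pos.2 ⟨w, mem_Bl.2 ⟨hw, hf h⟩⟩
      · exact card_pos.2 ⟨flip j w, mem_Bl.2 ⟨by rwa [flip_mem_swap], by simpa using hf h⟩⟩
    have hE0 : (E f (I.erase j) y + 6 ≤ 2 * m ∨ E f (I.erase j) y = 0) ∧
        (E f (I.erase j) (flip j y) + 6 ≤ 2 * m ∨ E f (I.erase j) (flip j y) = 0) ∧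
        ((Bl f (I.erase j) y j).card = 0 ∨ 2 * (Bl f (I.erase j) y j).card + 6 ≤ 2 * (m + 1)) := by
      by_cases h : E f I y = 0
      · omega
      · have := hpos h; omega
    have hlt : 2 * (m - 1) ≤ 2 ^ (m - 1) := by
      by_cases h : m = 2
      · subst h; norm_num
      · exact lin_lt_pow _ (by omega)
    exact hyp_step hj (ih (by omega) (by rw [hcard]; omega) hcard) (lace_of_few hne (by omega))
      (twoAll_of_few (by omega) (by rw [hcard]; omega)) (by rw [hcard]; omega) hne
      self_mem_S hg hh pg ph hgh
end HC

namespace HC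

variable {n : ℕ} {f : Flt n} {I J : Finset (Fin n)} {c z w x y a b : V n} {i j k : Fin n}

theorem flip_eq_iff : flip k a = z ↔ a = flip k z := by rw [eq_comm, eq_flip_iff]

/-- Declare the edge from `a` in direction `i` non-faulty. -/
def Flt.un (f : Flt n) (a : V n) (i : Fin n) : Flt n where
  p z k := f z k ∧ ¬ (k = i ∧ (z = a ∨ z = flip i a))
  symm z k := by
    rw [f.flip_iff]
    refine and_congr_right fun _ => not_congr (and_congr_right ?_)
    rintro rfl
    rw [flip_inj, flip_eq_iff, or_comm]

theorem un_iff : f.un a i z k ↔ f z k ∧ ¬ (k = i ∧ (z = a ∨ z = flip i a)) := Iff.rfl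

theorem R_un (h : R (f.un a i) z w) : R f z w ∨ (z = a ∧ w = flip i a) ∨ (z = flip i a ∧ w = a) := by
  obtain ⟨k, rfl, h⟩ := h
  rw [un_iff, not_and_or, not_not] at h
  rcases h with h | ⟨rfl, rfl | rfl⟩
  · exact Or.inl ⟨k, rfl, h⟩
  · simp
  · simp

/-- Number of good directions at a vertex. -/
noncomputable def gd (f : Flt n) (J : Finset (Fin n)) (a : V n) : ℕ := (J.filter fun k => ¬ f a k).card

theorem gd_add_d : gd f J a + d f J a = J.card := by
  rw [gd, d, add_comm]; exact card_filter_add_card_filter_not _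

/-- The exit condition at an end `a` of a detour edge. -/
def Cond (f : Flt n) (J : Finset (Fin n)) (c : V n) (j : Fin n) (a : V n) : Prop :=
  (∃ k ∈ J, ¬ f a k ∧ ¬ f (flip k a) j) ∨ (2 ≤ gd f J a ∧ ∀ z ∈ S J c, par z = par a → ¬ f z j)

/-- The exit condition at an end of a detour edge in terms of its other end `b`. -/
def Cond' (f : Flt n) (J : Finset (Fin n)) (c : V n) (j : Fin n) (b : V n) : Prop :=
  ((Bl f J c j).filter fun z => par z = par b).card < gd f J b

/-- The rotation condition at an end `a` of a detour edge. -/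
def Rot (f : Flt n) (J : Finset (Fin n)) (c : V n) (j : Fin n) (a : V n) : Prop :=
  2 + ((Bl f J c j).filter fun z => par z = par a).card ≤ gd f J a

/-- A faulty edge `ab` of one half such that the half becomes laceable when `ab` is repaired. -/
structure Det (f : Flt n) (I : Finset (Fin n)) (c : V n) (j i : Fin n) (a b : V n) : Prop where
  hj : j ∈ I
  hi : i ∈ I.erase j
  ha : a ∈ S (I.erase j) c
  hb : b = flip i a
  fab : f a i
  na : ¬ f a j
  nb : ¬ f b j
  L : Lace (f.un a i) (I.erase j) c
  L1 : Lace f (I.erase j) (flip j c)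
  P1 : ∀ p ∈ S (I.erase j) (flip j c), ∀ q ∈ S (I.erase j) (flip j c), par p ≠ par q → p ≠ flip j a → p ≠ flip j b →
    q ≠ flip j a → q ≠ flip j b → Two f (I.erase j) (flip j c) (flip j a) (flip j b) p q
  P2 : ∀ p ∈ S (I.erase j) (flip j c), ∀ q ∈ S (I.erase j) (flip j c), par p = par b → par q = par a → p ≠ flip j a →
    q ≠ flip j b → Two f (I.erase j) (flip j c) p (flip j b) (flip j a) q
  Ha : ∀ h ∈ S (I.erase j) (flip j c), par h = par a → h ≠ flip j b →
    Path (R f) ((S (I.erase j) (flip j c)).val.erase (flip j a)) (flip j b) h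
  Hb : ∀ h ∈ S (I.erase j) (flip j c), par h = par b → h ≠ flip j a →
    Path (R f) ((S (I.erase j) (flip j c)).val.erase (flip j b)) (flip j a) h
  hB : (Bl f (I.erase j) c j).card + 1 < 2 ^ ((I.erase j).card - 1)

namespace Det

variable (D : Det f I c j i a b)
include D

theorem hne : (I.erase j).Nonempty := ⟨i, D.hi⟩

theorem hb' : b ∈ S (I.erase j) c := by rw [D.hb, flip_mem D.hi]; exact D.ha

theorem pab : par b = !par a := by rw [D.hb, par_flip]

theorem swap : Det f I c j i b a where
  hj := D.hj
  hi := D.hi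
  ha := D.hb'
  hb := by rw [D.hb, flip_flip]
  fab := by rw [D.hb, f.flip_iff]; exact D.fab
  na := D.nb
  nb := D.na
  L := by
    have : f.un b i = f.un a i := by
      rw [D.hb]; unfold Flt.un; congr; ext z k; rw [flip_flip]; tauto
    rw [this]; exact D.L
  L1 := D.L1
  P1 := fun p hp q hq h h1 h2 h3 h4 => (D.P1 p hp q hq h h2 h1 h4 h3).rev1
  P2 := fun p hp q hq h h1 h2 h3 => (D.P2 q hq p hp h1 h h3 h2).swap.rev1.rev2
  Ha := D.Hb
  Hb := D.Ha
  hB := D.hB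

theorem lace_or (hx : x ∈ S (I.erase j) c) (hy : y ∈ S (I.erase j) c) (hxy : par x ≠ par y) :
    Path (R f) (S (I.erase j) c).val x y ∨
    (∃ M1 M2, (S (I.erase j) c).val = M1 + M2 ∧ Path (R f) M1 x a ∧ Path (R f) M2 b y) ∨
    (∃ M1 M2, (S (I.erase j) c).val = M1 + M2 ∧ Path (R f) M1 x b ∧ Path (R f) M2 a y) :=
  (D.L x hx y hy hxy).unfault (Finset.nodup _) fun u w h => by rw [D.hb]; exact R_un h

theorem pow2 : 2 * (Bl f (I.erase j) c j).card + 2 < 2 ^ (I.erase j).card := by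
  have hB := D.hB
  obtain ⟨m, hm⟩ : ∃ m, (I.erase j).card = m + 1 :=
      ⟨(I.erase j).card - 1, by have := card_pos.2 D.hne; omega⟩
  rw [hm] at hB ⊢; rw [pow_succ]; simp only [Nat.add_sub_cancel] at hB; omega

theorem alpha (hx : x ∈ S (I.erase j) c) (hy : y ∈ S (I.erase j) c) (hxy : par x ≠ par y) :
    Path (R f) (S I c).val x y := by
  rw [halves_val D.hj]
  rcases D.lace_or hx hy hxy with h | ⟨M1, M2, hM, h1, h2⟩ | ⟨M1, M2, hM, h1, h2⟩
  · exact detour D.L1 le_rfl h (by rw [countP_Bl, card_val]; exact D.pow2.le)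
  · exact ((h1.join (R_flip D.na) (D.L1 (flip j a) (flip_mem_flip.2 D.ha) (flip j b) (flip_mem_flip.2 D.hb')
      (by simp [D.pab]))).join (R_flip' D.nb) h2).of_eq (by rw [hM]; abel)
  · exact ((h1.join (R_flip D.nb) (D.L1 (flip j b) (flip_mem_flip.2 D.hb') (flip j a) (flip_mem_flip.2 D.ha)
      (by simp [D.pab]))).join (R_flip' D.na) h2).of_eq (by rw [hM]; abel)

/-- An unblocked vertex of given parity outside `{a, b}`. -/
theorem exists_exit (q : Bool) : ∃ s ∈ S (I.erase j) c, par s = q ∧ s ≠ a ∧ s ≠ b ∧ ¬ f s j := by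
  obtain ⟨s, hs, ps, hX⟩ := exists_conn q D.hne c (insert (if par a = q then a else b) (Bl f (I.erase j) c j))
    (lt_of_le_of_lt (card_insert_le _ _) D.hB)
  rw [mem_insert, not_or] at hX
  have hp := D.pab
  refine ⟨s, hs, ps, ?_, ?_, not_Bl_iff hs hX.2⟩
  · rintro rfl; simp [ps] at hX
  · rintro rfl
    have : ¬ par a = q := by rw [← ps, hp]; simp
    simp [this] at hX

theorem beta (hx : x ∈ S (I.erase j) c) (hy : y ∈ S (I.erase j) (flip j c)) (hxy : par x ≠ par y)
    (ya : y ≠ flip j a) (yb : y ≠ flip j b) : Path (R f) (S I c).val x y := by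
  obtain ⟨s, hs, ps, sa, sb, hsf⟩ := D.exists_exit (!par x)
  have hs' := (flip_mem_flip (j := j)).2 hs
  have ha' := (flip_mem_flip (j := j)).2 D.ha
  have hb' := (flip_mem_flip (j := j)).2 D.hb'
  have py : par (flip j s) ≠ par y := by rw [par_flip, ps]; simpa using hxy
  rw [halves_val D.hj]
  rcases D.lace_or hx hs (by rw [ps]; simp) with h | ⟨M1, M2, hM, h1, h2⟩ | ⟨M1, M2, hM, h1, h2⟩
  · exact h.join (R_flip hsf) (D.L1 _ hs' y hy py)
  · obtain ⟨N1, N2, hN, q1, q2⟩ := D.P1 _ hs' y hy py (by simpa using sa) (by simpa using sb) ya yb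
    exact ((h1.join (R_flip D.na) (q1.join (R_flip' D.nb) h2)).join (R_flip hsf) q2).of_eq (by
      rw [hM, hN]; abel)
  · obtain ⟨N1, N2, hN, q1, q2⟩ := (D.P1 _ hs' y hy py (by simpa using sa) (by simpa using sb) ya yb).rev1
    exact ((h1.join (R_flip D.nb) (q1.join (R_flip' D.na) h2)).join (R_flip hsf) q2).of_eq (by
      rw [hM, hN]; abel)

theorem beta_conf1 (hx : x ∈ S (I.erase j) c) (hxy : par x = par a) (hk : k ∈ I.erase j) (hak : ¬ f a k)
    (hkj : ¬ f (flip k a) j) : Path (R f) (S I c).val x (flip j a) := by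
  have hr : flip k a ∈ S (I.erase j) c := by rw [flip_mem hk]; exact D.ha
  have hr' := (flip_mem_flip (j := j)).2 hr
  have ha' := (flip_mem_flip (j := j)).2 D.ha
  have hb' := (flip_mem_flip (j := j)).2 D.hb'
  rw [halves_val D.hj]
  rcases D.lace_or hx hr (by simp [hxy]) with h | ⟨M1, M2, hM, h1, h2⟩ | ⟨M1, M2, hM, h1, h2⟩
  · exact h.join (R_flip hkj) (D.L1 _ hr' _ ha' (by simp))
  · exact ((h1.join (R_flip hak) (h2.rev R_symm)).join (R_flip D.nb)
      (D.L1 _ hb' _ ha' (by simp [D.pab]))).of_eq (by rw [hM])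
  · have q := D.Ha _ hr' (by simp) (by
      rw [D.hb]; simp; rintro rfl; exact hak D.fab)
    exact (((h1.join (R_flip D.nb) q).join (R_flip' hkj) (h2.rev R_symm)).join (R_flip D.na)
      (Path.single _)).of_eq (by
        rw [hM, ← Multiset.cons_erase ha', ← Multiset.singleton_add]
        simp only [Multiset.erase_cons_head, Multiset.singleton_add]
        rw [← Multiset.singleton_add]; abel)

theorem beta_conf2 (hx : x ∈ S (I.erase j) c) (hxy : par x = par a) (hg : 2 ≤ gd f (I.erase j) a)
    (hB : ∀ z ∈ S (I.erase j) c, par z = par a → ¬ f z j) : Path (R f) (S I c).val x (flip j a) := by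
  obtain ⟨s, hs, ps, sa, sb, hsf⟩ := D.exists_exit (!par a)
  have hs' := (flip_mem_flip (j := j)).2 hs
  have ha' := (flip_mem_flip (j := j)).2 D.ha
  have hb' := (flip_mem_flip (j := j)).2 D.hb'
  set W : Finset (V n) := ((I.erase j).filter fun k => ¬ f a k).image fun k => flip k a with hW
  have hWc : W.card = gd f (I.erase j) a := card_image_of_injective _ fun k l h => by simpa using h
  have hWm : ∀ r ∈ W, R f a r ∧ r ≠ b ∧ r ≠ a ∧ r ∈ S (I.erase j) c ∧ par r = !par a := by
    intro r hr
    obtain ⟨k, hk, rfl⟩ := mem_image.1 hr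
    rw [mem_filter] at hk
    refine ⟨R_flip hk.2, ?_, by simp, ?_, by simp⟩
    · rw [D.hb]; simp; rintro rfl; exact hk.2 D.fab
    · rw [flip_mem hk.1]; exact D.ha
  have one : ∀ {t}, t ∈ S (I.erase j) c → par t = par a → t ≠ a →
      Two f (I.erase j) (flip j c) (flip j a) (flip j b) (flip j s) (flip j t) := fun ht pt ta =>
    D.P1 _ hs' _ (flip_mem_flip.2 ht) (by simp [ps, pt]) (by simpa using sa) (by simpa using sb) (by simpa using ta)
      (by simp only [ne_eq, flip_inj]; rintro rfl; rw [D.pab] at pt; simp at pt)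
  have two : ∀ {t}, t ∈ S (I.erase j) c → par t = par a → t ≠ a →
      Two f (I.erase j) (flip j c) (flip j t) (flip j b) (flip j a) (flip j s) := fun ht pt ta =>
    D.P2 _ (flip_mem_flip.2 ht) _ hs' (by simp [pt, D.pab]) (by simp [ps]) (by simpa using ta) (by simpa using sb)
  rw [halves_val D.hj]
  have ba : b ≠ a := by rw [D.hb]; simp
  rcases D.lace_or hx hs (by simp [hxy, ps]) with h | ⟨M1, M2, hM, h1, h2⟩ | ⟨M1, M2, hM, h1, h2⟩
  · exact h.join (R_flip hsf) (D.L1 _ hs' _ ha' (by simp [ps]))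
  · by_cases hc : ∃ r ∈ W, r ∈ M2
    · obtain ⟨r, hr, hr2⟩ := hc
      obtain ⟨e, rb, ra, hrS, pr⟩ := hWm r hr
      obtain ⟨N1, N2, t, rfl, q1, e1, q2⟩ := h2.cut_before hr2 rb
      have ht : t ∈ S (I.erase j) c := mem_of_add' hM (Multiset.mem_add.2 (Or.inl q1.end_mem))
      have pt : par t = par a := by have := R_par e1; rw [pr] at this; simpa using this.symm
      have ta : t ≠ a := by
        rintro rfl
        have := Finset.nodup (S (I.erase j) c); rw [hM] at this
        exact Multiset.disjoint_left.1 (Multiset.nodup_add.1 this).2.2 h1.end_mem (Multiset.mem_add.2 (Or.inl q1.end_mem))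
      obtain ⟨K1, K2, hK, k1, k2⟩ := (one ht pt ta).swap.rev2
      refine (((h1.join e q2).join (R_flip hsf) k1).join (R_flip' (hB t ht pt)) ((q1.rev R_symm).join (R_flip D.nb) k2)).of_eq ?_
      rw [hM, hK]; abel
    · have hn1 : M1.Nodup := by
        have := Finset.nodup (S (I.erase j) c); rw [hM] at this
        exact (Multiset.nodup_add.1 this).1
      obtain ⟨r, hr, N1, N2, t, rfl, q1, e1, q2, ht⟩ := (h1.rev R_symm).exists_pred hn1 W {a} (by
        intro r hr
        obtain ⟨e, rb, ra, hrS, pr⟩ := hWm r hr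
        refine ⟨?_, ra⟩
        have h3 : r ∈ M1 + M2 := hM ▸ hrS
        rcases Multiset.mem_add.1 h3 with h | h
        · exact h
        · exact absurd ⟨r, hr, h⟩ hc) (by rw [hWc, card_singleton]; omega)
      obtain ⟨e, rb, ra, hrS, pr⟩ := hWm r hr
      have htS : t ∈ S (I.erase j) c := mem_of_add hM (Multiset.mem_add.2 (Or.inl q1.end_mem))
      have pt : par t = par a := by have := R_par e1; rw [pr] at this; simpa using this.symm
      rw [mem_singleton] at ht
      obtain ⟨K1, K2, hK, k1, k2⟩ := (two htS pt ht).rev2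
      refine ((((q2.rev R_symm).join (R_symm _ _ e) q1).join (R_flip (hB t htS pt)) k1).join (R_flip' D.nb)
        (h2.join (R_flip hsf) k2)).of_eq ?_
      rw [hM, hK]; abel
  · by_cases hc : ∃ r ∈ W, r ∈ M1
    · obtain ⟨r, hr, hr2⟩ := hc
      obtain ⟨e, rb, ra, hrS, pr⟩ := hWm r hr
      obtain ⟨N1, N2, t, rfl, q1, e1, q2⟩ := h1.cut_after R_symm hr2 rb
      have ht : t ∈ S (I.erase j) c := mem_of_add hM (Multiset.mem_add.2 (Or.inr q2.start_mem))
      have pt : par t = par a := by have := R_par e1; rw [pr] at this; simpa using this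
      have ta : t ≠ a := by
        rintro rfl
        have := Finset.nodup (S (I.erase j) c); rw [hM] at this
        exact Multiset.disjoint_left.1 (Multiset.nodup_add.1 this).2.2 (Multiset.mem_add.2 (Or.inr q2.start_mem)) h2.start_mem
      obtain ⟨K1, K2, hK, k1, k2⟩ := (one ht pt ta).swap.rev2
      refine (((q1.join (R_symm _ _ e) h2).join (R_flip hsf) k1).join (R_flip' (hB t ht pt)) (q2.join (R_flip D.nb) k2)).of_eq ?_
      rw [hM, hK]; abel
    · have hn2 : M2.Nodup := by
        have := Finset.nodup (S (I.erase j) c); rw [hM] at this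
        exact (Multiset.nodup_add.1 this).2.1
      obtain ⟨r, hr, N1, N2, t, rfl, q1, e1, q2, ht⟩ := h2.exists_pred hn2 W {a} (by
        intro r hr
        obtain ⟨e, rb, ra, hrS, pr⟩ := hWm r hr
        refine ⟨?_, ra⟩
        have h3 : r ∈ M1 + M2 := hM ▸ hrS
        rcases Multiset.mem_add.1 h3 with h | h
        · exact absurd ⟨r, hr, h⟩ hc
        · exact h) (by rw [hWc, card_singleton]; omega)
      obtain ⟨e, rb, ra, hrS, pr⟩ := hWm r hr
      have htS : t ∈ S (I.erase j) c := mem_of_add' hM (Multiset.mem_add.2 (Or.inl q1.end_mem))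
      have pt : par t = par a := by have := R_par e1; rw [pr] at this; simpa using this.symm
      rw [mem_singleton] at ht
      obtain ⟨K1, K2, hK, k1, k2⟩ := (two htS pt ht).rev1.rev2
      refine ((h1.join (R_flip D.nb) k1).join (R_flip' (hB t htS pt)) (((q1.rev R_symm).join e q2).join (R_flip hsf) k2)).of_eq ?_
      rw [hM, hK]; abel

theorem beta_conf3 (hx : x ∈ S (I.erase j) c) (hxy : par x = par a) (h : Cond' f (I.erase j) c j b) :
    Path (R f) (S I c).val x (flip j a) := by
  have ha' := (flip_mem_flip (j := j)).2 D.ha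
  have hb' := (flip_mem_flip (j := j)).2 D.hb'
  have hn := Finset.nodup (S (I.erase j) c)
  rw [halves_val D.hj]
  rcases D.lace_or hx D.hb' (by simp [hxy, D.pab]) with q | ⟨M1, M2, hM, h1, h2⟩ | ⟨M1, M2, hM, h1, h2⟩
  · exact q.join (R_flip D.nb) (D.L1 _ hb' _ ha' (by simp [D.pab]))
  · rw [hM, Multiset.nodup_add] at hn
    have hM2 := h2.single_of_end hn.2.1 rfl
    subst hM2
    have hbM : b ∉ M1 := fun hb => Multiset.disjoint_left.1 hn.2.2 hb (by simp)
    set W : Finset (V n) := ((I.erase j).filter fun k => ¬ f b k).image fun k => flip k b with hW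
    have hWc : W.card = gd f (I.erase j) b := card_image_of_injective _ fun k l h => by simpa using h
    have hWm : ∀ r ∈ W, R f b r ∧ r ∈ M1 ∧ r ≠ a ∧ par r = par a := by
      intro r hr
      obtain ⟨k, hk, rfl⟩ := mem_image.1 hr
      rw [mem_filter] at hk
      refine ⟨R_flip hk.2, ?_, ?_, by simp [D.pab]⟩
      · have : flip k b ∈ M1 + {b} := hM ▸ (flip_mem hk.1).2 D.hb'
        simpa using this
      · rintro e
        rw [flip_eq_iff, D.hb, flip_dir_inj] at e
        subst e
        exact hk.2 (by rw [D.hb, f.flip_iff]; exact D.fab)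
    obtain ⟨r, hr, N1, N2, t, rfl, q1, e1, q2, ht⟩ := (h1.rev R_symm).exists_pred hn.1 W
      ((Bl f (I.erase j) c j).filter fun z => par z = par b) (fun r hr => ⟨(hWm r hr).2.1, (hWm r hr).2.2.1⟩)
      (by rw [hWc]; exact h)
    obtain ⟨e, hrM, ra, pr⟩ := hWm r hr
    have htS : t ∈ S (I.erase j) c := mem_of_add hM (Multiset.mem_add.2 (Or.inl q1.end_mem))
    have pt : par t = par b := by have := R_par e1; rw [pr] at this; rw [D.pab, this]; simp
    rw [mem_filter, mem_Bl] at ht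
    have tf : ¬ f t j := fun h => ht ⟨⟨htS, h⟩, pt⟩
    have q := D.Ha _ (flip_mem_flip.2 htS) (by simp [D.pab, pt]) (by
      simp only [ne_eq, flip_inj]; rintro rfl; exact hbM (Multiset.mem_add.2 (Or.inl q1.end_mem)))
    refine (((((q2.rev R_symm).join (R_symm _ _ e) h2).join (R_flip D.nb) q).join (R_flip' tf) (q1.rev R_symm)).join
      (R_flip D.na) (Path.single _)).of_eq ?_
    rw [hM]
    conv_rhs => rw [← Multiset.cons_erase ha', ← Multiset.singleton_add]
    abel
  · rw [hM, Multiset.nodup_add] at hn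
    exact absurd h2.end_mem (Multiset.disjoint_left.1 hn.2.2 h1.end_mem)

theorem beta_conf (hx : x ∈ S (I.erase j) c) (hxy : par x = par a)
    (hc : Cond f (I.erase j) c j a ∨ Cond' f (I.erase j) c j b) : Path (R f) (S I c).val x (flip j a) := by
  rcases hc with (⟨k, hk, h1, h2⟩ | ⟨h1, h2⟩) | h
  · exact D.beta_conf1 hx hxy hk h1 h2
  · exact D.beta_conf2 hx hxy h1 h2
  · exact D.beta_conf3 hx hxy h

theorem through : Path (R f) (S (I.erase j) c).val a b := by
  have big := D.pow2
  have ba : b ≠ a := by rw [D.hb]; simp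
  have hn := Finset.nodup (S (I.erase j) c)
  have hc := card_val (J := I.erase j) (c := c)
  rcases D.lace_or D.ha D.hb' (by simp [D.pab]) with h | ⟨M1, M2, hM, h1, h2⟩ | ⟨M1, M2, hM, h1, h2⟩
  · exact h
  · rw [hM] at hn hc
    rw [Multiset.nodup_add] at hn
    rw [h1.single_of_end hn.1 rfl, h2.single_of_end hn.2.1 rfl] at hc
    simp at hc; omega
  · rw [hM] at hn
    rw [Multiset.nodup_add] at hn
    exact absurd h2.start_mem (Multiset.disjoint_left.1 hn.2.2 h1.start_mem)

theorem gamma (hx : x ∈ S (I.erase j) (flip j c)) (hy : y ∈ S (I.erase j) (flip j c)) (hxb : par x = par b)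
    (hxy : par x ≠ par y) (xa : x ≠ flip j a) (yb : y ≠ flip j b) : Path (R f) (S I c).val x y := by
  have ha' := (flip_mem_flip (j := j)).2 D.ha
  have hb' := (flip_mem_flip (j := j)).2 D.hb'
  have pab := D.pab
  obtain ⟨N1, N2, hN, q1, q2⟩ := D.P2 x hx y hy hxb (by
    rw [hxb, D.pab] at hxy; simpa using hxy.symm) xa yb
  rw [halves_val D.hj]
  exact ((q1.join (R_flip' D.nb) (D.through.rev R_symm)).join (R_flip D.na) q2).of_eq (by rw [hN]; abel)

theorem gamma_single (hy : y ∈ S (I.erase j) (flip j c)) (hy' : par y = par a) (yb : y ≠ flip j b) :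
    Path (R f) (S I c).val (flip j a) y := by
  have ha' := (flip_mem_flip (j := j)).2 D.ha
  have hb' := (flip_mem_flip (j := j)).2 D.hb'
  have q := D.Ha y hy hy' yb
  rw [halves_val D.hj, ← Multiset.cons_erase ha', Multiset.add_cons]
  exact Path.cons (R_flip' D.na) (D.through.join (R_flip D.nb) q)

theorem gamma_double (h : Rot f (I.erase j) c j a) : Path (R f) (S I c).val (flip j a) (flip j b) := by
  have ha' := (flip_mem_flip (j := j)).2 D.ha
  have hb' := (flip_mem_flip (j := j)).2 D.hb'
  set W : Finset (V n) := ((I.erase j).filter fun k => ¬ f a k).image fun k => flip k a with hW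
  have hWc : W.card = gd f (I.erase j) a := card_image_of_injective _ fun k l h => by simpa using h
  obtain ⟨r, hr, N1, N2, t, hN, q1, e1, q2, ht⟩ := D.through.exists_pred (Finset.nodup _) W
    (insert a ((Bl f (I.erase j) c j).filter fun z => par z = par a)) (by
      intro r hr
      obtain ⟨k, hk, rfl⟩ := mem_image.1 hr
      rw [mem_filter] at hk
      exact ⟨(flip_mem hk.1).2 D.ha, by simp⟩) (by
      rw [hWc]; have := card_insert_le a ((Bl f (I.erase j) c j).filter fun z => par z = par a)
      unfold Rot at h; omega)
  obtain ⟨k, hk, rfl⟩ := mem_image.1 hr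
  rw [mem_filter] at hk
  have htS : t ∈ S (I.erase j) c := mem_of_add hN q1.end_mem
  have pt : par t = par a := by have := R_par e1; rw [par_flip] at this; simpa using this.symm
  rw [mem_insert, mem_filter, mem_Bl, not_or] at ht
  have tf : ¬ f t j := fun h => ht.2 ⟨⟨htS, h⟩, pt⟩
  have q := D.Hb _ (flip_mem_flip.2 htS) (by simp [D.pab, pt]) (by simpa using ht.1)
  rw [halves_val D.hj]
  refine (((q.join (R_flip' tf) (q1.rev R_symm)).join (R_flip hk.2) q2).join (R_flip D.nb) (Path.single _)).of_eq ?_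
  rw [hN]
  conv_rhs => rw [← Multiset.cons_erase hb', ← Multiset.singleton_add]
  abel

theorem path_zero (hx : x ∈ S (I.erase j) c) (hy : y ∈ S I c) (hxy : par x ≠ par y)
    (ca : Cond f (I.erase j) c j a ∨ Cond' f (I.erase j) c j b)
    (cb : Cond f (I.erase j) c j b ∨ Cond' f (I.erase j) c j a) : Path (R f) (S I c).val x y := by
  rw [halves D.hj, mem_union] at hy
  rcases hy with hy | hy
  · exact D.alpha hx hy hxy
  · by_cases ya : y = flip j a
    · subst ya; exact D.beta_conf hx (by simpa using hxy) ca
    · by_cases yb : y = flip j b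
      · subst yb; exact D.swap.beta_conf hx (by simpa using hxy) cb
      · exact D.beta hx hy hxy ya yb

theorem path_one (hx : x ∈ S (I.erase j) (flip j c)) (hy : y ∈ S (I.erase j) (flip j c)) (hxy : par x ≠ par y)
    (hxb : par x = par b)
    (hr : x = flip j a → y = flip j b → Rot f (I.erase j) c j a ∨ Rot f (I.erase j) c j b) :
    Path (R f) (S I c).val x y := by
  have pab := D.pab
  by_cases xa : x = flip j a
  · by_cases yb : y = flip j b
    · rcases hr xa yb with h | h
      · subst xa yb; exact D.gamma_double h
      · subst xa yb; exact (D.swap.gamma_double h).rev R_symm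
    · subst xa
      refine D.gamma_single hy ?_ yb
      simpa using hxy.symm
  · by_cases yb : y = flip j b
    · subst yb; exact (D.swap.gamma_single hx hxb xa).rev R_symm
    · exact D.gamma hx hy hxb hxy xa yb

/-- Hamiltonian paths from a detour edge. -/
theorem path (hx : x ∈ S I c) (hy : y ∈ S I c) (hxy : par x ≠ par y)
    (ca : Cond f (I.erase j) c j a ∨ Cond' f (I.erase j) c j b)
    (cb : Cond f (I.erase j) c j b ∨ Cond' f (I.erase j) c j a)
    (hr : (x = flip j a ∧ y = flip j b) ∨ (x = flip j b ∧ y = flip j a) →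
      Rot f (I.erase j) c j a ∨ Rot f (I.erase j) c j b) : Path (R f) (S I c).val x y := by
  have hx' := hx
  have hy' := hy
  rw [halves D.hj, mem_union] at hx hy
  rcases hx with hx | hx
  · exact D.path_zero hx hy' hxy ca cb
  · rcases hy with hy | hy
    · exact (D.path_zero hy hx' hxy.symm ca cb).rev R_symm
    · have pab := D.pab
      by_cases hxb : par x = par b
      · exact D.path_one hx hy hxy hxb fun h1 h2 => hr (Or.inl ⟨h1, h2⟩)
      · refine D.swap.path_one hx hy hxy ?_ fun h1 h2 => (hr (Or.inr ⟨h1, h2⟩)).symm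
        rw [pab] at hxb; simpa using hxb

theorem lace (ca : Cond f (I.erase j) c j a ∨ Cond' f (I.erase j) c j b)
    (cb : Cond f (I.erase j) c j b ∨ Cond' f (I.erase j) c j a)
    (hr : Rot f (I.erase j) c j a ∨ Rot f (I.erase j) c j b) : Lace f I c :=
  fun _ hx _ hy hxy => D.path hx hy hxy ca cb fun _ => hr

end Det

theorem cond_of_few (ha : a ∈ S J c) (h2 : 2 ≤ gd f J a) (hB : (Bl f J c j).card ≤ gd f J a) : Cond f J c j a := by
  by_contra hc
  rw [Cond, not_or] at hc
  obtain ⟨h1, h3⟩ := hc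
  push Not at h1
  apply h3
  refine ⟨h2, fun z hz pz hf => ?_⟩
  set W : Finset (V n) := (J.filter fun k => ¬ f a k).image fun k => flip k a with hW
  have hWc : W.card = gd f J a := card_image_of_injective _ fun k l h => by simpa using h
  have hsub : W ⊆ Bl f J c j := by
    intro r hr
    obtain ⟨k, hk, rfl⟩ := mem_image.1 hr
    rw [mem_filter] at hk
    exact mem_Bl.2 ⟨(flip_mem hk.1).2 ha, h1 k hk.1 hk.2⟩
  have he := eq_of_subset_of_card_le hsub (by omega)
  have : z ∈ W := by rw [he]; exact mem_Bl.2 ⟨hz, hf⟩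
  obtain ⟨k, hk, rfl⟩ := mem_image.1 this
  simp at pz

/-- The clean criterion: few blocked vertices compared with the good degrees of the detour edge. -/
theorem Det.lace_clean (D : Det f I c j i a b) (ha : 2 ≤ gd f (I.erase j) a) (hb : 2 ≤ gd f (I.erase j) b)
    (h : (Bl f (I.erase j) c j).card + 3 ≤ gd f (I.erase j) a + gd f (I.erase j) b)
    (hBa : (Bl f (I.erase j) c j).card ≤ gd f (I.erase j) a)
    (hBb : (Bl f (I.erase j) c j).card ≤ gd f (I.erase j) b) : Lace f I c := by
  refine D.lace (Or.inl (cond_of_few D.ha ha hBa)) (Or.inl (cond_of_few D.hb' hb hBb)) ?_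
  have hs : ((Bl f (I.erase j) c j).filter fun z => par z = par a).card +
      ((Bl f (I.erase j) c j).filter fun z => par z = par b).card = (Bl f (I.erase j) c j).card := by
    rw [← card_filter_add_card_filter_not (s := Bl f (I.erase j) c j) fun z => par z = par a]
    congr 2
    refine filter_congr fun z _ => ?_
    rw [D.pab]; cases par z <;> cases par a <;> simp
  unfold Rot
  omega

/-- A single end of large good degree suffices for the clean criterion. -/
theorem Det.lace_one_end (D : Det f I c j i a b) (ha : Cond f (I.erase j) c j b)
    (h : ((Bl f (I.erase j) c j).filter fun z => par z = par b).card + 2 ≤ gd f (I.erase j) b) : Lace f I c :=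
  D.lace (Or.inr (by unfold Cond'; omega)) (Or.inl ha) (Or.inr (by unfold Rot; omega))

theorem Det.of_two (hj : j ∈ I) (hi : i ∈ I.erase j) (ha : a ∈ S (I.erase j) c) (fab : f a i) (na : ¬ f a j)
    (nb : ¬ f (flip i a) j) (L : Lace (f.un a i) (I.erase j) c) (L1 : Lace f (I.erase j) (flip j c))
    (T1 : TwoAll f (I.erase j) (flip j c)) (H1 : Hyp f (I.erase j) (flip j c))
    (hB : (Bl f (I.erase j) c j).card + 1 < 2 ^ ((I.erase j).card - 1)) : Det f I c j i a (flip i a) := by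
  have ha' := (flip_mem_flip (j := j)).2 ha
  have hb' := (flip_mem_flip (j := j)).2 ((flip_mem hi).2 ha)
  refine ⟨hj, hi, ha, rfl, fab, na, nb, L, L1, ?_, ?_, ?_, ?_, hB⟩
  · exact fun p hp q hq h h1 h2 h3 h4 => T1 _ ha' _ hb' p hp q hq (by simp) h h1.symm h3.symm h2.symm h4.symm
  · exact fun p hp q hq h h1 h2 h3 => T1 p hp _ hb' _ ha' q hq (by simp [h]) (by simp [h1]) h2
      (by rintro rfl; simp [h1] at h) (by simp) h3.symm
  · exact fun h hh p1 p2 => H1 _ ha' _ hb' h hh (by simp) (by simp [p1]) p2.symm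
  · exact fun h hh p1 p2 => H1 _ hb' _ ha' h hh (by simp) (by simp [p1]) p2.symm

end HC

namespace HC

variable {n : ℕ} {f : Flt n} {I J K : Finset (Fin n)} {b c u v z w x y a : V n} {i j k : Fin n}

theorem E_even : Even (E f I b) := by
  induction I using Finset.induction_on generalizing b with
  | empty => simp [E, d]
  | insert j s hj ih =>
    rw [E_split (mem_insert_self j s), erase_insert hj]
    exact ((ih.add ih).add (even_two_mul _))

theorem E_mono (h : J ⊆ I) : E f J b ≤ E f I b := by
  unfold E d
  refine (sum_le_sum_of_subset (S_mono h)).trans' (sum_le_sum fun z _ => card_le_card (filter_subset_filter _ h))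

theorem Bl_mono (h : J ⊆ I) : Bl f J b j ⊆ Bl f I b j := filter_subset_filter _ (S_mono h)

/-- Faults outside a half of a subcube lie outside the corresponding half of the cube. -/
theorem E_submod (h : K ⊆ I) (hj : j ∈ K) :
    E f K b + E f (I.erase j) b ≤ E f I b + E f (K.erase j) b := by
  rw [E_split hj, E_split (h hj)]
  have h1 : E f (K.erase j) (flip j b) ≤ E f (I.erase j) (flip j b) := E_mono (erase_subset_erase _ h)
  have h2 := card_le_card (Bl_mono (f := f) (b := b) (j := j) (erase_subset_erase j h))
  omega

/-- All faults lie in a small subcube through `b` or outside one of the halves containing `b`. -/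
theorem E_le_out (h : J ⊆ I) :
    E f I b ≤ E f (I \ J) b + ∑ j ∈ J, (E f I b - E f (I.erase j) b) := by
  induction J using Finset.induction_on with
  | empty => simp
  | insert j s hj ih =>
    have ih := ih fun x hx => h (mem_insert_of_mem hx)
    have hjI : j ∈ I := h (mem_insert_self _ _)
    rw [sum_insert hj]
    have h1 := E_submod (f := f) (b := b) (K := I \ s) (I := I) (j := j) sdiff_subset (mem_sdiff.2 ⟨hjI, hj⟩)
    have h2 : (I \ s).erase j = I \ insert j s := by ext; simp; tauto
    rw [h2] at h1
    have h3 : E f (I.erase j) b ≤ E f I b := E_mono (erase_subset _ _)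
    omega

/-- Remove all faults at `v`. -/
def Flt.rm (f : Flt n) (v : V n) : Flt n where
  p z i := f z i ∧ z ≠ v ∧ flip i z ≠ v
  symm z i := by rw [f.flip_iff, flip_flip]; tauto

theorem rm_iff : f.rm v z i ↔ f z i ∧ z ≠ v ∧ flip i z ≠ v := Iff.rfl

theorem E_rm (hv : v ∈ S I b) : E f I b = E (f.rm v) I b + 2 * d f I v := by
  have h1 : ∀ z, d f I z = d (f.rm v) I z + (if z = v then d f I v else 0) +
      (I.filter fun i => f z i ∧ z = flip i v).card := by
    intro z
    by_cases hz : z = v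
    · subst hz; simp [d, rm_iff]
    · rw [if_neg hz, add_zero, d, d, ← card_filter_add_card_filter_not (s := I.filter (f z)) fun i => f.rm v z i]
      rw [filter_filter, filter_filter]
      congr 2 <;> ext i <;> simp only [mem_filter, rm_iff]
      · tauto
      · have : flip i z = v ↔ z = flip i v := flip_eq_iff
        tauto
  rw [E, sum_congr rfl fun z _ => h1 z, sum_add_distrib, sum_add_distrib, sum_ite_eq', if_pos hv]
  have h2 : ∑ z ∈ S I b, (I.filter fun i => f z i ∧ z = flip i v).card = d f I v := by
    simp only [card_filter, d]
    rw [sum_comm]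
    refine sum_congr rfl fun i hi => ?_
    have : ∀ z ∈ S I b, (if f z i ∧ z = flip i v then 1 else 0) = if z = flip i v then (if f v i then 1 else 0) else 0 := by
      intro z _
      by_cases h : z = flip i v
      · subst h; simp
      · simp [h]
    rw [sum_congr rfl this, sum_ite_eq', if_pos ((flip_mem hi).2 hv)]
  rw [h2]; unfold E; ring

theorem d_rm_le : d (f.rm v) I z ≤ d f I z :=
  card_le_card (monotone_filter_right I fun _ _ h => h.1)

theorem d_rm_of_adj (h : f v i) (hi : i ∈ I) : d f I (flip i v) = d (f.rm v) I (flip i v) + 1 := by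
  have : I.filter (f (flip i v)) = insert i (I.filter (f.rm v (flip i v))) := by
    ext k
    simp only [mem_filter, mem_insert, rm_iff]
    by_cases hk : k = i
    · subst hk; simp [hi, h]
    · have : flip k (flip i v) ≠ v := by rw [Ne, flip_eq_iff]; simpa using Ne.symm hk
      simp [hk, this]
  rw [d, this, card_insert_of_notMem (by simp [rm_iff]), d]

theorem d_rm_of_not_adj (hz : z ≠ v) (h : ∀ i ∈ I, z = flip i v → ¬ f v i) : d (f.rm v) I z = d f I z := by
  unfold d; congr 1; ext i
  simp only [mem_filter, rm_iff]
  refine and_congr_right fun hi => ⟨fun h => h.1, fun h' => ⟨h', hz, fun h2 => ?_⟩⟩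
  rw [flip_eq_iff] at h2
  exact h i hi h2 (by rw [h2] at h'; simpa using h')

theorem d_le_rm_succ (hz : z ≠ v) : d f I z ≤ d (f.rm v) I z + 1 := by
  by_cases h : ∀ i ∈ I, z = flip i v → ¬ f v i
  · rw [d_rm_of_not_adj hz h]; omega
  · push Not at h
    obtain ⟨i, hi, rfl, h⟩ := h
    rw [d_rm_of_adj h hi]

theorem two_d_le (hv : v ∈ S I b) : 2 * d f I v ≤ E f I b := by rw [E_rm hv]; omega

theorem d_pos (hi : i ∈ I) (h : f z i) : 0 < d f I z := card_pos.2 ⟨i, by simp [hi, h]⟩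

theorem E_pos (hz : z ∈ S I b) (hi : i ∈ I) (h : f z i) : 2 ≤ E f I b := by
  have := two_d_le (f := f) hz; have := d_pos hi h; omega

theorem un_rm_le_d : d (f.un a i) I z ≤ d f I z :=
  card_le_card (monotone_filter_right I fun _ _ h => h.1)

theorem d_un_of_ne (h1 : z ≠ a) (h2 : z ≠ flip i a) : d (f.un a i) I z = d f I z := by
  simp [d, un_iff, h1, h2]

theorem d_un_left (hi : i ∈ I) (h : f a i) : d f I a = d (f.un a i) I a + 1 := by
  have : I.filter (f a) = insert i (I.filter (f.un a i a)) := by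
    ext k
    simp only [mem_filter, mem_insert, un_iff]
    by_cases hk : k = i
    · subst hk; simp [hi, h]
    · simp [hk]
  rw [d, this, card_insert_of_notMem (by simp [un_iff]), d]

theorem d_un_right (hi : i ∈ I) (h : f a i) : d f I (flip i a) = d (f.un a i) I (flip i a) + 1 := by
  have e : f.un (flip i a) i = f.un a i := by
    unfold Flt.un; congr; ext z k; rw [flip_flip]; tauto
  have := d_un_left (f := f) (a := flip i a) hi (by simpa using h)
  rwa [e] at this

theorem E_un (ha : a ∈ S I b) (hi : i ∈ I) (h : f a i) : E f I b = E (f.un a i) I b + 2 := by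
  have hb : flip i a ∈ S I b := (flip_mem hi).2 ha
  unfold E
  rw [← add_sum_erase _ _ ha, ← add_sum_erase _ _ (mem_erase.2 ⟨flip_ne i a, hb⟩),
    ← add_sum_erase (S I b) (fun z => d (f.un a i) I z) ha,
    ← add_sum_erase _ (fun z => d (f.un a i) I z) (mem_erase.2 ⟨flip_ne i a, hb⟩),
    d_un_left hi h, d_un_right hi h]
  have : ∀ z ∈ ((S I b).erase a).erase (flip i a), d f I z = d (f.un a i) I z := fun z hz => by
    simp only [mem_erase] at hz; rw [d_un_of_ne hz.2.1 hz.1]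
  rw [sum_congr rfl this]; ring

/-- Total number of faults by direction. -/
theorem E_eq_sum : E f I b = ∑ j ∈ I, 2 * (Bl f (I.erase j) b j).card := by
  have h : ∀ j ∈ I, 2 * (Bl f (I.erase j) b j).card = ∑ z ∈ S I b, if f z j then 1 else 0 := by
    intro j hj
    rw [sum_halves hj, ← card_filter, ← card_filter, two_mul]
    change _ = (Bl f (I.erase j) b j).card + (Bl f (I.erase j) (flip j b) j).card
    rw [card_Bl_flip]
  rw [sum_congr rfl h, sum_comm]
  simp only [E, d, card_filter]

/-- Remove all faults at vertices of `X`. -/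
def Flt.rmS (f : Flt n) (X : Finset (V n)) : Flt n where
  p z i := f z i ∧ z ∉ X ∧ flip i z ∉ X
  symm z i := by rw [f.flip_iff, flip_flip]; tauto

theorem rmS_iff {X : Finset (V n)} : f.rmS X z i ↔ f z i ∧ z ∉ X ∧ flip i z ∉ X := Iff.rfl

theorem rmS_insert {X : Finset (V n)} : f.rmS (insert v X) = (f.rmS X).rm v := by
  unfold Flt.rm Flt.rmS; congr; ext z i; simp only [mem_insert]; tauto

theorem d_rmS_le {X : Finset (V n)} : d (f.rmS X) I z ≤ d f I z :=
  card_le_card (monotone_filter_right I fun _ _ h => h.1)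

theorem E_rmS_le {X : Finset (V n)} (hX : X ⊆ S I b) : E f I b ≤ E (f.rmS X) I b + 2 * ∑ z ∈ X, d f I z := by
  induction X using Finset.induction_on with
  | empty =>
    have : f.rmS ∅ = f := by cases f; unfold Flt.rmS; congr; ext; simp
    simp [this]
  | insert v X hv ih =>
    have h1 := ih fun x hx => hX (mem_insert_of_mem hx)
    have h2 := E_rm (f := f.rmS X) (hX (mem_insert_self v X))
    rw [← rmS_insert] at h2
    rw [sum_insert hv]
    have := d_rmS_le (f := f) (X := X) (I := I) (z := v)
    omega

/-- A fault avoiding a set of vertices. -/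
theorem exists_fault_avoid {X : Finset (V n)} (hX : X ⊆ S I b) (h : 2 * ∑ z ∈ X, d f I z < E f I b) :
    ∃ a ∈ S I b, ∃ i ∈ I, f a i ∧ a ∉ X ∧ flip i a ∉ X := by
  have := E_rmS_le (f := f) hX
  obtain ⟨a, ha, i, hi, h⟩ := exists_fault (f := f.rmS X) (I := I) (b := b) (by omega)
  exact ⟨a, ha, i, hi, h⟩

/-- Removing faults at a vertex outside a subcube does not change the subcube. -/
theorem E_rm_of_notMem (hv : v ∉ S I b) : E (f.rm v) I b = E f I b := by
  refine sum_congr rfl fun z hz => d_rm_of_not_adj (fun h => hv (h ▸ hz)) fun i hi h => ?_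
  rw [h, flip_mem hi] at hz; exact absurd hz hv

end HC

namespace HC

variable {n m : ℕ} {f : Flt n} {I J K : Finset (Fin n)} {b c u v z w x y a : V n} {i j k : Fin n}

/-- The number of tolerated faults in dimension `m`. -/
def cap (m : ℕ) : ℕ := 3 * m - 9 + (m - 8)

/-- Laceability in dimension `m` under the degree conditions. -/
def Tol (n m : ℕ) : Prop := ∀ (f : Flt n) (I : Finset (Fin n)) (b : V n), I.card = m →
  (∀ z ∈ S I b, d f I z + 2 ≤ m) →
  (m ≠ 4 → ∀ z ∈ S I b, ∀ w ∈ S I b, d f I z + 2 = m → d f I w + 2 = m → z = w) →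
  E f I b ≤ 2 * cap m → Lace f I b

/-- The number of faulty edges between two vertices. -/
noncomputable def adj (f : Flt n) (I : Finset (Fin n)) (v u : V n) : ℕ := if ∃ k ∈ I, u = flip k v ∧ f v k then 1 else 0

theorem adj_le_one : adj f I v u ≤ 1 := by unfold adj; split <;> simp

theorem adj_comm : adj f I v u = adj f I u v := by
  have : ∀ {v u : V n}, (∃ k ∈ I, u = flip k v ∧ f v k) → ∃ k ∈ I, v = flip k u ∧ f u k := by
    rintro v u ⟨k, hk, rfl, h⟩; exact ⟨k, hk, by simp, by simpa using h⟩
  unfold adj; congr 1; exact propext ⟨this, this⟩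

theorem adj_eq_zero_of_par (h : par v = par u) : adj f I v u = 0 := by
  unfold adj; rw [if_neg]; rintro ⟨k, -, rfl, -⟩; simp at h

theorem exists_of_adj (h : adj f I v u ≠ 0) : ∃ k ∈ I, u = flip k v ∧ f v k := by
  by_contra hc; exact h (if_neg hc)

theorem d_rm (hz : z ≠ v) : d f I z = d (f.rm v) I z + adj f I v z := by
  by_cases h : ∃ i ∈ I, z = flip i v ∧ f v i
  · rw [adj, if_pos h]
    obtain ⟨i, hi, rfl, h⟩ := h
    exact d_rm_of_adj h hi
  · rw [adj, if_neg h, d_rm_of_not_adj hz fun i hi h1 h2 => h ⟨i, hi, h1, h2⟩]; rfl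

theorem adj_rm (hu : u ≠ v) (hz : z ≠ v) : adj (f.rm v) I u z = adj f I u z := by
  unfold adj
  congr 1
  refine propext (exists_congr fun k => and_congr_right fun _ => and_congr_right ?_)
  rintro rfl
  simp [rm_iff, hu, hz]

theorem E_rm2 (hv : v ∈ S I b) (hu : u ∈ S I b) (h : u ≠ v) :
    E f I b + 2 * adj f I v u = E ((f.rm v).rm u) I b + 2 * d f I v + 2 * d f I u := by
  have := d_rm (f := f) (I := I) h
  rw [E_rm hv, E_rm (f := f.rm v) hu]; omega

theorem E_rm3 (hv : v ∈ S I b) (hu : u ∈ S I b) (hw : w ∈ S I b) (h : u ≠ v) (h1 : w ≠ v) (h2 : w ≠ u) :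
    E f I b + 2 * (adj f I v u + adj f I v w + adj f I u w) =
      E (((f.rm v).rm u).rm w) I b + 2 * d f I v + 2 * d f I u + 2 * d f I w := by
  have := E_rm2 (f := f.rm v) hu hw h2
  have e1 := d_rm (f := f) (I := I) h
  have e2 := d_rm (f := f) (I := I) h1
  rw [E_rm hv]
  rw [adj_rm h h1] at this
  omega

theorem E_rm4 (hv : v ∈ S I b) (hu : u ∈ S I b) (hw : w ∈ S I b) (hz : z ∈ S I b)
    (h : u ≠ v) (h1 : w ≠ v) (h2 : w ≠ u) (h3 : z ≠ v) (h4 : z ≠ u) (h5 : z ≠ w) :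
    E f I b + 2 * (adj f I v u + adj f I v w + adj f I v z + (adj f I u w + adj f I u z + adj f I w z)) =
      E ((((f.rm v).rm u).rm w).rm z) I b + 2 * d f I v + 2 * d f I u + 2 * d f I w + 2 * d f I z := by
  have := E_rm3 (f := f.rm v) hu hw hz h2 h4 h5
  have e1 := d_rm (f := f) (I := I) h
  have e2 := d_rm (f := f) (I := I) h1
  have e3 := d_rm (f := f) (I := I) h3
  rw [E_rm hv]
  rw [adj_rm h h1, adj_rm h h3, adj_rm h1 h3] at this
  omega

/-- The hypotheses of the inductive step from dimension `m` to dimension `m + 1`. -/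
structure Ctx (f : Flt n) (I : Finset (Fin n)) (c : V n) (m : ℕ) : Prop where
  hm : 5 ≤ m
  T : Tol n m
  card : I.card = m + 1
  deg : ∀ z ∈ S I c, d f I z + 1 ≤ m
  uniq : ∀ z ∈ S I c, ∀ w ∈ S I c, d f I z + 1 = m → d f I w + 1 = m → z = w
  faults : E f I c ≤ 2 * cap (m + 1)

theorem cap_lt_pow (h : 4 ≤ m) : cap (m + 1) + 1 < 2 ^ (m - 1) := by
  have h1 : 4 * m - 8 ≤ 2 ^ (m - 1) := by
    induction m, h using Nat.le_induction with
    | base => norm_num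
    | succ k hk ih =>
      have : 2 ^ (k + 1 - 1) = 2 * 2 ^ (k - 1) := by
        rw [← pow_succ']; congr 1; omega
      omega
  unfold cap
  rcases Nat.lt_or_ge m 9 with h2 | h2
  · interval_cases m <;> norm_num
  · omega

theorem card_Bl_le (hj : j ∈ I) : E f (I.erase j) c + E f (I.erase j) (flip j c) + 2 * (Bl f (I.erase j) c j).card ≤ E f I c :=
  (E_split hj).ge

namespace Ctx

variable (D : Ctx f I c m)
include D

theorem move (hz : z ∈ S I c) : Ctx f I z m where
  hm := D.hm
  T := D.T
  card := D.card
  deg := by rw [S_eq hz]; exact D.deg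
  uniq := by rw [S_eq hz]; exact D.uniq
  faults := by rw [E_congr hz]; exact D.faults

theorem card_erase (hj : j ∈ I) : (I.erase j).card = m := by
  rw [card_erase_of_mem hj, D.card]; rfl

theorem cap_add : cap (m + 1) ≤ cap m + 4 ∧ cap (m + 1) ≤ cap m + (m - 2) ∧ (m ≤ 7 → cap (m + 1) = cap m + 3) := by
  have := D.hm; unfold cap; omega

/-- The half opposite to a vertex with many faults has few faults. -/
theorem opp_le (hj : j ∈ I) (hv : v ∈ S I c) (hC : m ≤ d f I v + 2) : E f (I.erase j) (flip j v) ≤ 2 * cap m := by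
  have h1 : E f (I.erase j) (flip j v) = E (f.rm v) (I.erase j) (flip j v) :=
    (E_rm_of_notMem fun h => by rw [mem_S] at h; simpa using h j (by simp)).symm
  have h2 : E (f.rm v) (I.erase j) (flip j v) ≤ E (f.rm v) I (flip j v) := E_mono (erase_subset _ _)
  have h3 : E (f.rm v) I (flip j v) = E (f.rm v) I c := E_congr ((flip_mem hj).2 hv)
  have h4 := E_rm (f := f) hv
  have := D.cap_add; have := D.faults; have := D.hm
  omega

theorem lace_M (hj : j ∈ I) (h0 : E f (I.erase j) c ≤ 2 * cap m) (h1 : E f (I.erase j) (flip j c) ≤ 2 * cap m)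
    (hv : ∀ z ∈ S I c, d f I z + 1 = m → f z j)
    (hM : ∀ z ∈ S I c, ∀ w ∈ S I c, z ≠ w → z j = w j → m ≤ d f I z + 2 → m ≤ d f I w + 2 →
      (d f I z + 2 = m ∧ f z j) ∨ (d f I w + 2 = m ∧ f w j)) : Lace f I c := by
  have hm := D.hm
  have key : ∀ b ∈ S I c, E f (I.erase j) b ≤ 2 * cap m → Lace f (I.erase j) b := by
    intro b hb hE
    have hsub : ∀ z ∈ S (I.erase j) b, z ∈ S I c := fun z hz => by
      rw [← S_eq hb]; exact S_mono (erase_subset _ _) hz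
    have hde := fun z => d_erase (f := f) (z := z) hj
    refine D.T f _ b (D.card_erase hj) (fun z hz => ?_) (fun _ z hz w hw tz tw => ?_) hE
    · have := hde z
      have h1 := D.deg z (hsub z hz)
      have h2 := hv z (hsub z hz)
      split at this
      · omega
      · have : d f I z + 1 ≠ m := fun h => by simp_all
        omega
    · by_contra hne
      have hz2 := hde z
      have hw2 := hde w
      have hzw : z j = w j := by rw [(mem_erase_iff hj).1 hz |>.2, (mem_erase_iff hj).1 hw |>.2]
      rcases hM z (hsub z hz) w (hsub w hw) hne hzw (by omega) (by omega) with ⟨h3, h4⟩ | ⟨h3, h4⟩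
      · rw [if_pos h4] at hz2; omega
      · rw [if_pos h4] at hw2; omega
  refine lace_split hj (key c self_mem_S h0) (key _ ((flip_mem hj).2 self_mem_S) h1) ?_
  rw [D.card_erase hj]
  have h2 := card_Bl_le (f := f) (c := c) hj
  have h3 := cap_lt_pow (m := m) (by omega)
  have h4 : 2 ^ m = 2 * 2 ^ (m - 1) := by rw [← pow_succ']; congr 1; omega
  have := D.faults
  omega

theorem Bl_small (hj : j ∈ I) : (Bl f (I.erase j) c j).card + 1 < 2 ^ ((I.erase j).card - 1) := by
  have hm := D.hm
  rw [D.card_erase hj]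
  have h2 := card_Bl_le (f := f) (c := c) hj
  have h3 := cap_lt_pow (m := m) (by omega)
  have := D.faults
  omega

/-- A half becomes laceable by repairing an edge. -/
theorem lace_un (hj : j ∈ I) (hi : i ∈ I.erase j) (ha : a ∈ S (I.erase j) c) (fab : f a i)
    (h0 : E f (I.erase j) c ≤ 2 * cap m + 2)
    (hv : ∀ z ∈ S (I.erase j) c, d f I z + 1 = m → f z j ∨ z = a ∨ z = flip i a)
    (hM : ∀ z ∈ S (I.erase j) c, ∀ w ∈ S (I.erase j) c, z ≠ w → m ≤ d f I z + 2 → m ≤ d f I w + 2 →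
      (d f I z + 2 = m ∧ (f z j ∨ z = a ∨ z = flip i a)) ∨ (d f I w + 2 = m ∧ (f w j ∨ w = a ∨ w = flip i a))) :
    Lace (f.un a i) (I.erase j) c := by
  have hsub : ∀ z ∈ S (I.erase j) c, z ∈ S I c := fun z hz => S_mono (erase_subset _ _) hz
  have hde : ∀ z, d (f.un a i) (I.erase j) z + (if f z j ∨ z = a ∨ z = flip i a then 1 else 0) ≤ d f I z := by
    intro z
    rw [d_erase hj]
    by_cases hza : z = a
    · subst hza
      rw [if_pos (by simp), d_un_left hi fab]; omega
    by_cases hzb : z = flip i a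
    · subst hzb
      rw [if_pos (by simp), d_un_right hi fab]; omega
    have := un_rm_le_d (f := f) (a := a) (i := i) (I := I.erase j) (z := z)
    simp only [hza, hzb, or_false]; omega
  have hE := E_un ha hi fab
  refine D.T _ _ c (D.card_erase hj) (fun z hz => ?_) (fun _ z hz w hw tz tw => ?_) (by omega)
  · have := hde z
    have h1 := D.deg z (hsub z hz)
    have h2 := hv z hz
    split at this
    · omega
    · have : d f I z + 1 ≠ m := fun h => by simp_all
      omega
  · by_contra hne
    have hz2 := hde z
    have hw2 := hde w
    rcases hM z hz w hw hne (by omega) (by omega) with ⟨h3, h4⟩ | ⟨h3, h4⟩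
    · rw [if_pos h4] at hz2; omega
    · rw [if_pos h4] at hw2; omega

/-- Construction of a detour edge. -/
theorem det (hj : j ∈ I) (hi : i ∈ I.erase j) (ha : a ∈ S (I.erase j) c) (fab : f a i) (na : ¬ f a j)
    (nb : ¬ f (flip i a) j) (h0 : E f (I.erase j) c ≤ 2 * cap m + 2)
    (h1 : E f (I.erase j) (flip j c) + 6 ≤ 2 * m ∨ E f (I.erase j) (flip j c) = 0)
    (hv : ∀ z ∈ S (I.erase j) c, d f I z + 1 = m → f z j ∨ z = a ∨ z = flip i a)
    (hM : ∀ z ∈ S (I.erase j) c, ∀ w ∈ S (I.erase j) c, z ≠ w → m ≤ d f I z + 2 → m ≤ d f I w + 2 →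
      (d f I z + 2 = m ∧ (f z j ∨ z = a ∨ z = flip i a)) ∨ (d f I w + 2 = m ∧ (f w j ∨ w = a ∨ w = flip i a))) :
    Det f I c j i a (flip i a) := by
  have hm := D.hm
  have hc := D.card_erase hj
  refine .of_two hj hi ha fab na nb (D.lace_un hj hi ha fab h0 hv hM) ?_ ?_ ?_ (D.Bl_small hj)
  · exact lace_of_few (card_pos.1 (by omega)) (by rcases h1 with h1 | h1 <;> omega)
  · exact twoAll_of_few (by omega) (by rcases h1 with h1 | h1 <;> omega)
  · exact hyp_of_few (by omega) (by rcases h1 with h1 | h1 <;> omega)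

theorem gd_add (hj : j ∈ I) (na : ¬ f a j) : gd f (I.erase j) a + d f I a = m := by
  have := gd_add_d (f := f) (J := I.erase j) (a := a)
  rw [D.card_erase hj] at this
  rw [d_erase hj, if_neg na]; omega

/-- A clean detour step. -/
theorem lace_P (hj : j ∈ I) (hi : i ∈ I.erase j) (ha : a ∈ S (I.erase j) c) (fab : f a i) (na : ¬ f a j)
    (nb : ¬ f (flip i a) j) (h0 : E f (I.erase j) c ≤ 2 * cap m + 2)
    (h1 : E f (I.erase j) (flip j c) + 6 ≤ 2 * m ∨ E f (I.erase j) (flip j c) = 0)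
    (hv : ∀ z ∈ S (I.erase j) c, d f I z + 1 = m → f z j)
    (hM : ∀ z ∈ S (I.erase j) c, ∀ w ∈ S (I.erase j) c, z ≠ w → m ≤ d f I z + 2 → m ≤ d f I w + 2 →
      (d f I z + 2 = m ∧ (f z j ∨ z = a ∨ z = flip i a)) ∨ (d f I w + 2 = m ∧ (f w j ∨ w = a ∨ w = flip i a)))
    (hab : d f I a + d f I (flip i a) + (Bl f (I.erase j) c j).card + 3 ≤ 2 * m)
    (hBa : d f I a + (Bl f (I.erase j) c j).card ≤ m) (hBb : d f I (flip i a) + (Bl f (I.erase j) c j).card ≤ m) :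
    Lace f I c := by
  have hs : S (I.erase j) c ⊆ S I c := S_mono (erase_subset _ _)
  have hb : flip i a ∈ S (I.erase j) c := (flip_mem hi).2 ha
  have hda : d f I a + 2 ≤ m := by
    have := D.deg a (hs ha); by_contra; exact na (hv a ha (by omega))
  have hdb : d f I (flip i a) + 2 ≤ m := by
    have := D.deg _ (hs hb); by_contra; exact nb (hv _ hb (by omega))
  have g1 := D.gd_add hj na
  have g2 := D.gd_add hj nb
  refine (D.det hj hi ha fab na nb h0 h1 (fun z hz h => Or.inl (hv z hz h)) hM).lace_clean ?_ ?_ ?_ ?_ ?_ <;> omega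

end Ctx

end HC

namespace HC

variable {n m : ℕ} {f : Flt n} {I J K : Finset (Fin n)} {b c u v z w x y a : V n} {i j k : Fin n}

theorem S_erase_sub {I : Finset (Fin n)} {j : Fin n} {c : V n} : S (I.erase j) c ⊆ S I c := S_mono (erase_subset _ _)

theorem Bl_subset : Bl f J c j ⊆ S J c := filter_subset _ _

theorem E_singleton_le : E f {i} z ≤ 2 := by
  unfold E d
  rw [S_single, sum_pair (ne_flip i z)]
  have h : ∀ w : V n, (({i} : Finset (Fin n)).filter (f w)).card ≤ 1 := fun w => (card_filter_le _ _).trans (by simp)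
  have := h z; have := h (flip i z); omega

theorem E_singleton (h : ¬ f z i) : E f {i} z = 0 := by
  have : f (flip i z) i ↔ f z i := by simp
  unfold E d
  rw [S_single, sum_pair (ne_flip i z), filter_singleton, filter_singleton, if_neg h, if_neg (by simpa using h)]
  rfl

/-- In a square with two good edges at a vertex there are at most two faults. -/
theorem E_pair_le (h : i ≠ j) (hi : ¬ f v i) (hj : ¬ f v j) : E f {i, j} v ≤ 4 := by
  have he : ({i, j} : Finset (Fin n)).erase j = {i} := by
    rw [pair_comm]; exact erase_insert (by simpa using h.symm)
  rw [E_split (j := j) (by simp), he, E_singleton hi]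
  have h1 : Bl f {i} v j ⊆ {flip i v} := by
    intro z hz
    rw [mem_Bl, S_single] at hz
    simp only [mem_insert, mem_singleton] at hz ⊢
    rcases hz with ⟨rfl | rfl, hz⟩
    · exact absurd hz hj
    · rfl
  have h2 := card_le_card h1
  have h3 := E_singleton_le (f := f) (i := i) (z := flip j v)
  rw [card_singleton] at h2
  omega

theorem E_eq_le_four {G : Finset (Fin n)} (hG : G.card = 2) (h : ∀ i ∈ G, ¬ f v i) : E f G v ≤ 4 := by
  obtain ⟨i, j, hij, rfl⟩ := card_eq_two.1 hG
  exact E_pair_le hij (h i (by simp)) (h j (by simp))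

/-- If few faults lie outside each half, all faults lie in a small subcube. -/
theorem E_le_of_out {r : ℕ} (hJ : J ⊆ K) (hK : K ⊆ I) (h : ∀ j ∈ J, E f I b ≤ E f (I.erase j) b + r) :
    E f K b ≤ E f (K \ J) b + J.card * r := by
  refine (E_le_out hJ).trans (Nat.add_le_add_left ((sum_le_card_nsmul _ _ r fun j hj => ?_).trans (by simp)) _)
  have h1 := E_submod (f := f) (b := b) hK (hJ hj)
  have h2 := h j hj
  omega

theorem sum_Bl_le {B : Finset (V n)} (hj : j ∈ I) (hB : ∀ z ∈ B, z ∈ S I c ∧ f z j) {r : ℕ}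
    (hd : ∀ z ∈ B, d f I z ≤ r + 1) : ∑ z ∈ B, d f (I.erase j) z ≤ B.card * r := by
  refine (sum_le_card_nsmul _ _ r fun z hz => ?_).trans (by simp)
  have := d_erase (f := f) (z := z) hj
  rw [if_pos (hB z hz).2] at this
  have := hd z hz
  omega

namespace Ctx

variable (D : Ctx f I c m)
include D

theorem lace_no_big (hC : ∀ z ∈ S I c, d f I z + 3 ≤ m) : Lace f I c := by
  have hm := D.hm
  have hF := D.faults
  have hca := D.cap_add
  have hcap : cap m = 3 * m - 9 + (m - 8) := rfl
  obtain ⟨j, hj, hjE⟩ : ∃ j ∈ I, E f I c ≤ 2 * (Bl f (I.erase j) c j).card + 2 * cap m + 2 := by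
    by_contra! h
    obtain ⟨e, he⟩ := E_even (f := f) (I := I) (b := c)
    have h1 : E f I c ≤ I.card * (E f I c - (2 * cap m + 4)) := by
      conv_lhs => rw [E_eq_sum]
      refine (sum_le_card_nsmul _ _ _ fun j hj => ?_).trans (smul_eq_mul _ _).le
      have := h j hj
      omega
    obtain ⟨j, hj⟩ : I.Nonempty := card_pos.1 (by have := D.card; omega)
    have := h j hj
    obtain ⟨r, hr⟩ : ∃ r, E f I c = 2 * r + (2 * cap m + 4) := ⟨e - cap m - 2, by omega⟩
    have hr2 : r ≤ 2 := by omega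
    rw [D.card, hr, Nat.add_sub_cancel] at h1
    interval_cases r <;> omega
  have key : ∀ b ∈ S I c, E f (I.erase j) b = 2 * cap m + 2 → E f (I.erase j) (flip j b) = 0 →
      E f I b ≤ 2 * (Bl f (I.erase j) b j).card + 2 * cap m + 2 → Lace f I b := by
    intro b hb h0 h1 h2
    have D' := D.move hb
    have hC' : ∀ z ∈ S I b, d f I z + 3 ≤ m := by rw [S_eq hb]; exact hC
    have hBc : (Bl f (I.erase j) b j).card ≤ 3 := by
      have := card_Bl_le (f := f) (c := b) hj; have := D'.faults; omega
    have hB : ∀ z ∈ Bl f (I.erase j) b j, z ∈ S I b ∧ f z j := fun z hz => by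
      rw [mem_Bl] at hz; exact ⟨S_erase_sub hz.1, hz.2⟩
    have hs := sum_Bl_le hj hB (r := m - 4) fun z hz => by have := hC' z (hB z hz).1; omega
    have hs2 := Nat.mul_le_mul_right (m - 4) hBc
    obtain ⟨a, ha, i, hi, fab, aX, bX⟩ := exists_fault_avoid (f := f) (Bl_subset (f := f) (J := I.erase j) (c := b) (j := j))
      (by omega)
    have hb' := (flip_mem hi).2 ha
    have da := hC' a (S_erase_sub ha)
    have db := hC' _ (S_erase_sub hb')
    refine D'.lace_P hj hi ha fab (not_Bl_iff ha aX) (not_Bl_iff hb' bX) h0.le (Or.inr h1) ?_ ?_ ?_ ?_ ?_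
    · intro z hz h; have := hC' z (S_erase_sub hz); omega
    · intro z hz w _ _ h _; have := hC' z (S_erase_sub hz); omega
    all_goals omega
  have hs := E_split (f := f) (c := c) hj
  obtain ⟨e0, he0⟩ := E_even (f := f) (I := I.erase j) (b := c)
  obtain ⟨e1, he1⟩ := E_even (f := f) (I := I.erase j) (b := flip j c)
  by_cases h0 : E f (I.erase j) c ≤ 2 * cap m
  · by_cases h1 : E f (I.erase j) (flip j c) ≤ 2 * cap m
    · refine D.lace_M hj h0 h1 ?_ ?_
      · intro z hz h; have := hC z hz; omega
      · intro z hz w _ _ _ h _; have := hC z hz; omega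
    · have hb : flip j c ∈ S I c := (flip_mem hj).2 self_mem_S
      rw [← Lace_congr hb]
      refine key _ hb (by omega) (by rw [flip_flip]; omega) ?_
      rw [E_congr hb, card_Bl_flip]; omega
  · exact key c self_mem_S (by omega) (by omega) hjE

theorem lace_one_big (hC : m ≤ d f I c + 2) (hC' : ∀ z ∈ S I c, z ≠ c → d f I z + 3 ≤ m) : Lace f I c := by
  have hm := D.hm
  have hF := D.faults
  have hca := D.cap_add
  have hcap : cap m = 3 * m - 9 + (m - 8) := rfl
  have hc := D.deg c self_mem_S
  have hopp := fun j hj => D.opp_le (j := j) hj self_mem_S hC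
  have hT : ∀ j, f c j → ∀ z ∈ S I c, d f I z + 1 = m → f z j := by
    intro j hcj z hz h
    by_cases hzc : z = c
    · rwa [hzc]
    · have := hC' z hz hzc; omega
  by_cases hcase : ∃ j ∈ I, f c j ∧ E f (I.erase j) c ≤ 2 * cap m + 2
  · obtain ⟨j, hj, hcj, h0⟩ := hcase
    by_cases h0' : E f (I.erase j) c ≤ 2 * cap m
    · refine D.lace_M hj h0' (hopp j hj) (hT j hcj) ?_
      intro z hz w hw hzw _ h1 h2
      by_cases hzc : z = c
      · subst hzc; have := hC' w hw hzw.symm; omega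
      · have := hC' z hz hzc; omega
    · obtain ⟨e0, he0⟩ := E_even (f := f) (I := I.erase j) (b := c)
      have hs := card_Bl_le (f := f) (c := c) hj
      set B := Bl f (I.erase j) c j with hBdef
      have hcB : c ∈ B := mem_Bl.2 ⟨self_mem_S, hcj⟩
      have hBc : 0 < B.card := card_pos.2 ⟨c, hcB⟩
      have hB : ∀ z ∈ B.erase c, z ∈ S I c ∧ f z j := fun z hz => by
        rw [mem_erase, mem_Bl] at hz; exact ⟨S_erase_sub hz.2.1, hz.2.2⟩
      have hs1 := sum_Bl_le hj hB (r := m - 4) fun z hz => by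
        have := hC' z (hB z hz).1 (mem_erase.1 hz).1; omega
      rw [card_erase_of_mem hcB] at hs1
      have hs2 := Nat.mul_le_mul_right (m - 4) (by omega : B.card - 1 ≤ 2)
      have hs3 := add_sum_erase B (fun z => d f (I.erase j) z) hcB
      have hs4 := d_erase (f := f) (z := c) hj
      rw [if_pos hcj] at hs4
      obtain ⟨a, ha, i, hi, fab, aX, bX⟩ := exists_fault_avoid (f := f) (X := B) Bl_subset
        (show 2 * ∑ z ∈ B, d f (I.erase j) z < E f (I.erase j) c by omega)
      have hb' := (flip_mem hi).2 ha
      have da := hC' a (S_erase_sub ha) (by rintro rfl; exact aX hcB)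
      have db := hC' _ (S_erase_sub hb') (by intro h; exact bX (h ▸ hcB))
      refine D.lace_P hj hi ha fab (not_Bl_iff ha aX) (not_Bl_iff hb' bX) (by omega) (Or.inl (by omega)) ?_ ?_ ?_ ?_ ?_
      · exact fun z hz => hT j hcj z (S_erase_sub hz)
      · intro z hz w hw hzw h1 h2
        by_cases hzc : z = c
        · subst hzc; have := hC' w (S_erase_sub hw) hzw.symm; omega
        · have := hC' z (S_erase_sub hz) hzc; omega
      all_goals rw [← hBdef]; omega
  · push Not at hcase
    set A := I.filter (f c) with hA
    have hAI : A ⊆ I := filter_subset _ _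
    have hAc : A.card = d f I c := rfl
    have hGc : (I \ A).card = m + 1 - d f I c := by rw [card_sdiff_of_subset hAI, D.card, hAc]
    have hG : ∀ i ∈ I \ A, ¬ f c i := fun i hi => by
      simp only [hA, mem_sdiff, mem_filter, not_and] at hi; exact hi.2 hi.1
    obtain ⟨e, he⟩ := E_even (f := f) (I := I) (b := c)
    have hout : ∀ j ∈ A, E f I c ≤ E f (I.erase j) c + (E f I c - (2 * cap m + 4)) := fun j hj => by
      rw [hA, mem_filter] at hj
      have := hcase j hj.1 hj.2
      obtain ⟨e0, he0⟩ := E_even (f := f) (I := I.erase j) (b := c)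
      omega
    have hlow : 2 * cap m + 4 ≤ E f I c := by
      obtain ⟨j, hj⟩ : A.Nonempty := card_pos.1 (by omega)
      rw [hA, mem_filter] at hj
      have := hcase j hj.1 hj.2
      obtain ⟨e0, he0⟩ := E_even (f := f) (I := I.erase j) (b := c)
      have : E f (I.erase j) c ≤ E f I c := E_mono (erase_subset _ _)
      omega
    have hr : E f I c - (2 * cap m + 4) ≤ if m ≤ 7 then 2 else 4 := by split <;> omega
    by_cases hd : d f I c + 1 = m
    · have h1 := E_le_of_out hAI subset_rfl hout
      have h2 := E_eq_le_four (f := f) (by omega) hG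
      have h3 := Nat.mul_le_mul_left A.card hr
      split at h3 <;> omega
    · obtain ⟨j, hj⟩ : (I \ A).Nonempty := card_pos.1 (by omega)
      have hjI := (mem_sdiff.1 hj).1
      have hAj : A ⊆ I.erase j := fun k hk => mem_erase.2 ⟨fun h => (mem_sdiff.1 hj).2 (h ▸ hk), hAI hk⟩
      have h1 := E_le_of_out hAj (erase_subset _ _) hout
      have h2 := E_eq_le_four (f := f) (G := I.erase j \ A) (v := c)
        (by rw [card_sdiff_of_subset hAj, D.card_erase hjI]; omega)
        fun i hi => hG i (sdiff_subset_sdiff (erase_subset _ _) subset_rfl hi)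
      have h3 := Nat.mul_le_mul_left A.card hr
      refine D.lace_M hjI ?_ (hopp j hjI) ?_ ?_
      · split at h3 <;> omega
      · intro z hz h
        by_cases hzc : z = c
        · subst hzc; omega
        · have := hC' z hz hzc; omega
      · intro z hz w hw hzw _ h1 h2
        by_cases hzc : z = c
        · subst hzc; have := hC' w hw hzw.symm; omega
        · have := hC' z hz hzc; omega

end Ctx

end HC

namespace HC

variable {n m : ℕ} {f : Flt n} {I J K : Finset (Fin n)} {b c u v w x y z a p q r s t h : V n} {i j k : Fin n}

theorem Path.tail {α : Type*} {R : α → α → Prop} {M : Multiset α} {x y : α} (h : Path R M x y) (hxy : x ≠ y) :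
    ∃ N r, M = x ::ₘ N ∧ R x r ∧ Path R N r y := by
  cases h with
  | single => exact absurd rfl hxy
  | cons e h => exact ⟨_, _, rfl, e, h⟩

/-- A cube whose faults all lie in a laceable half, the halves being joined by good edges only. -/
structure Slab (f : Flt n) (J : Finset (Fin n)) (a : V n) (k : Fin n) : Prop where
  hk : k ∈ J
  L0 : Lace f (J.erase k) a
  L1 : Lace f (J.erase k) (flip k a)
  T1 : TwoAll f (J.erase k) (flip k a)
  H1 : Hyp f (J.erase k) (flip k a)
  good : ∀ z ∈ S J a, ¬ f z k
  big : 2 < (J.erase k).card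

namespace Slab

variable (D : Slab f J a k)
include D

theorem up (hz : z ∈ S (J.erase k) a) : R f z (flip k z) :=
  R_flip (D.good z (S_mono (erase_subset _ _) hz))

theorem ne : (J.erase k).Nonempty := card_pos.1 (by have := D.big; omega)

theorem exists_end (q : Bool) (X : Finset (V n)) (hX : X.card ≤ 3) : ∃ s ∈ S (J.erase k) a, par s = q ∧ s ∉ X :=
  exists_conn q D.ne a X (lt_of_le_of_lt hX (by
    have : 2 ^ 2 ≤ 2 ^ ((J.erase k).card - 1) := Nat.pow_le_pow_right (by norm_num) (by have := D.big; omega)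
    omega))

theorem lace : Lace f J a := by
  refine lace_split D.hk D.L0 D.L1 ?_
  have : Bl f (J.erase k) a k = ∅ := filter_false_of_mem fun z hz => D.good z (S_mono (erase_subset _ _) hz)
  rw [this, card_empty]
  have := Nat.pow_le_pow_right (n := 2) (by norm_num) D.big
  omega

theorem up_split (hp : p ∈ S (J.erase k) a) (hq : q ∈ S (J.erase k) (flip k a)) (ht : t ∈ S (J.erase k) a)
    (px : par x = par a) (pt : par t ≠ par a) (hx : x ∈ S (J.erase k) a) (pp : par p = par a)
    (pq : par q ≠ par a) (hpx : p ≠ x) (hqb : q ≠ flip k a) :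
    Two f J a x (flip k a) p q := by
  have hb := self_mem_S (I := J.erase k) (b := flip k a)
  obtain ⟨M1, M2, s, hM, h1, e, h2⟩ := (D.L0 x hx t ht (by rw [px]; exact pt.symm)).cut_before hp hpx
  have hs := mem_of_add hM h1.end_mem
  have ps : par s ≠ par a := by have := R_par e; rw [pp] at this; simp [this]
  have hn := Finset.nodup (S (J.erase k) a); rw [hM] at hn
  have hst : s ≠ t := fun h => Multiset.disjoint_left.1 (Multiset.nodup_add.1 hn).2.2 h1.end_mem (h ▸ h2.end_mem)
  obtain ⟨N1, N2, hN, q1, q2⟩ := D.T1 _ (flip_mem_flip.2 hs) _ hb _ (flip_mem_flip.2 ht) q hq (by simpa using ps)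
    (by rw [par_flip]; revert pt pq; cases par t <;> cases par q <;> cases par a <;> simp)
    (by simpa using hst) (by rintro rfl; rw [par_flip] at pq; revert ps pq; cases par s <;> cases par a <;> simp)
    (by rw [Ne, flip_inj]; rintro rfl; exact pt rfl) hqb.symm
  refine ⟨M1 + N1, M2 + N2, by rw [halves_val D.hk, hM, hN]; abel, h1.join (D.up hs) q1, h2.join (D.up ht) q2⟩

theorem two_ab (hp : p ∈ S J a) (hq : q ∈ S J a) (pp : par p = par a) (pq : par q ≠ par a) (hpa : p ≠ a)
    (hqb : q ≠ flip k a) : Two f J a a (flip k a) p q := by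
  have ha := self_mem_S (I := J.erase k) (b := a)
  have hb := self_mem_S (I := J.erase k) (b := flip k a)
  rw [halves D.hk, mem_union] at hp hq
  rcases hp with hp | hp <;> rcases hq with hq | hq
  · obtain ⟨M1, M2, s, hM, h1, e, h2⟩ := (D.L0 a ha q hq pq.symm).cut_before hp hpa
    have hs := mem_of_add hM h1.end_mem
    have ps : par s ≠ par a := by have := R_par e; rw [pp] at this; simp [this]
    exact ⟨M1 + (S (J.erase k) (flip k a)).val, M2, by rw [halves_val D.hk, hM]; abel,
      h1.join (D.up hs) (D.L1 _ (flip_mem_flip.2 hs) _ hb (by simpa using ps)), h2⟩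
  · obtain ⟨t, ht, pt, -⟩ := D.exists_end (!par a) ∅ (by simp)
    exact D.up_split hp hq ht rfl (by simp [pt]) ha pp pq hpa hqb
  · obtain ⟨r, hr, pr, rX⟩ := D.exists_end (par a) {a} (by simp)
    obtain ⟨r', hr', pr', rX'⟩ := D.exists_end (par a) {a, r} (card_le_two.trans (by norm_num))
    simp only [mem_insert, mem_singleton, not_or] at rX rX'
    obtain ⟨r, hrW, M1, M2, s, hM, h1, e, h2, hsX⟩ := (D.L0 a ha q hq pq.symm).exists_pred (Finset.nodup _) {r, r'} {flip k p}
      (by simp only [mem_insert, mem_singleton, forall_eq_or_imp, forall_eq]; exact ⟨⟨hr, rX⟩, hr', rX'.1⟩)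
      (by rw [card_singleton, card_pair (Ne.symm rX'.2)]; norm_num)
    have pr : par r = par a ∧ r ≠ a := by
      simp only [mem_insert, mem_singleton] at hrW
      rcases hrW with rfl | rfl
      · exact ⟨pr, rX⟩
      · exact ⟨pr', rX'.1⟩
    have hs := mem_of_add hM h1.end_mem
    have hr := mem_of_add' hM h2.start_mem
    have ps : par s ≠ par a := by have := R_par e; rw [pr.1] at this; simp [this]
    rw [mem_singleton] at hsX
    obtain ⟨N1, N2, hN, q1, q2⟩ := D.T1 _ (flip_mem_flip.2 hs) _ hb _ hp _ (flip_mem_flip.2 hr) (by simpa using ps)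
      (by simp [pp, pr.1]) (by rwa [Ne, flip_eq_iff]) (by rw [Ne, flip_inj]; rintro rfl; exact ps pr.1)
      (by rintro rfl; simp at pp) (by simpa using pr.2.symm)
    exact ⟨M1 + N1, N2 + M2, by rw [halves_val D.hk, hM, hN]; abel, h1.join (D.up hs) q1,
      q2.join (R_symm _ _ (D.up hr)) h2⟩
  · obtain ⟨t, ht, pt, htX⟩ := D.exists_end (!par a) {flip k p} (by simp)
    rw [mem_singleton] at htX
    obtain ⟨N1, N2, hN, q1, q2⟩ := D.T1 _ (flip_mem_flip.2 ht) _ hb _ hp _ hq (by simp [pt])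
      (by rw [pp]; exact pq.symm) (by rwa [Ne, flip_eq_iff])
      (by rintro rfl; simp [pt] at pq) (by rintro rfl; simp at pp) hqb.symm
    exact ⟨(S (J.erase k) a).val + N1, N2, by rw [halves_val D.hk, hN]; abel,
      (D.L0 a ha t ht (by simp [pt])).join (D.up ht) q1, q2⟩

theorem two_cross (hp : p ∈ S J a) (hq : q ∈ S J a) (pp : par p = par a) (pq : par q ≠ par a) (hpa : p ≠ a)
    (hqb : q ≠ flip k a) : Two f J a p (flip k a) a q := by
  have ha := self_mem_S (I := J.erase k) (b := a)
  have hb := self_mem_S (I := J.erase k) (b := flip k a)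
  rw [halves D.hk, mem_union] at hp hq
  rcases hp with hp | hp <;> rcases hq with hq | hq
  · obtain ⟨M1, M2, s, hM, h1, e, h2⟩ := (D.L0 p hp q hq (by rw [pp]; exact pq.symm)).cut_before ha hpa.symm
    have hs := mem_of_add hM h1.end_mem
    have ps : par s ≠ par a := by have := R_par e; simp [this]
    exact ⟨M1 + (S (J.erase k) (flip k a)).val, M2, by rw [halves_val D.hk, hM]; abel,
      h1.join (D.up hs) (D.L1 _ (flip_mem_flip.2 hs) _ hb (by simpa using ps)), h2⟩
  · obtain ⟨t, ht, pt, -⟩ := D.exists_end (!par a) ∅ (by simp)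
    exact D.up_split ha hq ht pp (by simp [pt]) hp rfl pq hpa.symm hqb
  · exact ⟨(S (J.erase k) (flip k a)).val, (S (J.erase k) a).val, by rw [halves_val D.hk]; abel,
      D.L1 p hp _ hb (by simp [pp]), D.L0 a ha q hq pq.symm⟩
  · obtain ⟨t, ht, pt, htX⟩ := D.exists_end (!par a) {flip k p} (by simp)
    rw [mem_singleton] at htX
    obtain ⟨N1, N2, hN, q1, q2⟩ := D.T1 _ hp _ hb _ (flip_mem_flip.2 ht) _ hq (by simp [pp])
      (by rw [par_flip, pt]; simpa using pq.symm) (by rw [Ne, eq_flip_iff]; exact htX)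
      (by rintro rfl; exact pq pp) (by rw [Ne, flip_inj]; rintro rfl; simp at pt) hqb.symm
    exact ⟨N1, (S (J.erase k) a).val + N2, by rw [halves_val D.hk, hN]; abel, q1,
      (D.L0 a ha t ht (by simp [pt])).join (D.up ht) q2⟩

theorem hyp_a (hh : h ∈ S J a) (ph : par h ≠ par a) (hb' : h ≠ flip k a) :
    Path (R f) ((S J a).val.erase a) (flip k a) h := by
  have ha := self_mem_S (I := J.erase k) (b := a)
  have hb := self_mem_S (I := J.erase k) (b := flip k a)
  have start : ∀ t ∈ S (J.erase k) a, par t ≠ par a → ∃ N r, (S (J.erase k) a).val.erase a = N ∧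
      r ∈ S (J.erase k) a ∧ par r ≠ par a ∧ r ≠ t ∧ Path (R f) N r t := by
    intro t ht pt
    obtain ⟨N, r, hN, e, q⟩ := (D.L0 a ha t ht pt.symm).tail (by rintro rfl; exact pt rfl)
    have hn := Finset.nodup (S (J.erase k) a)
    have hr : r ∈ (S (J.erase k) a).val := by rw [hN]; exact Multiset.mem_cons_of_mem q.start_mem
    refine ⟨N, r, by rw [hN, Multiset.erase_cons_head], hr, by simp [R_par e], ?_, q⟩
    intro e
    rw [hN, Multiset.nodup_cons] at hn
    have hc := card_val (J := J.erase k) (c := a)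
    have := Nat.pow_le_pow_right (n := 2) (by norm_num) D.big
    rw [hN, q.single_of_end hn.2 e] at hc
    simp at hc; omega
  have hval : (S J a).val.erase a = (S (J.erase k) a).val.erase a + (S (J.erase k) (flip k a)).val := by
    rw [halves_val D.hk, Multiset.erase_add_left_pos _ ha]
  rw [halves D.hk, mem_union] at hh
  rcases hh with hh | hh
  · obtain ⟨N, r, hN, hr, pr, -, q⟩ := start h hh ph
    exact ((D.L1 _ hb _ (flip_mem_flip.2 hr) (by simpa using pr.symm)).join (R_symm _ _ (D.up hr)) q).of_eq (by
      rw [hval, hN]; abel)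
  · obtain ⟨t, ht, pt, -⟩ := D.exists_end (!par a) ∅ (by simp)
    obtain ⟨N, r, hN, hr, pr, rt, q⟩ := start t ht (by simp [pt])
    obtain ⟨N1, N2, hN', q1, q2⟩ := D.T1 _ hb _ (flip_mem_flip.2 hr) _ (flip_mem_flip.2 ht) h hh (by simpa using pr.symm)
      (by rw [par_flip, pt]; simpa using ph.symm) (by rw [Ne, flip_inj]; rintro rfl; simp at pt) hb'.symm
      (by simpa using rt) (by rintro rfl; rw [par_flip] at ph; revert ph pr; cases par r <;> cases par a <;> simp)
    exact (((q1.join (R_symm _ _ (D.up hr)) q).join (D.up ht) q2)).of_eq (by rw [hval, hN, hN']; abel)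

theorem hyp_b (hh : h ∈ S J a) (ph : par h = par a) (hha : h ≠ a) :
    Path (R f) ((S J a).val.erase (flip k a)) a h := by
  have ha := self_mem_S (I := J.erase k) (b := a)
  have hb := self_mem_S (I := J.erase k) (b := flip k a)
  have hval : (S J a).val.erase (flip k a) =
      (S (J.erase k) a).val + (S (J.erase k) (flip k a)).val.erase (flip k a) := by
    rw [halves_val D.hk, Multiset.erase_add_right_pos _ hb]
  rw [halves D.hk, mem_union] at hh
  rcases hh with hh | hh
  · obtain ⟨t, ht, pt, -⟩ := D.exists_end (!par a) ∅ (by simp)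
    obtain ⟨M1, M2, s, hM, h1, e, h2⟩ := (D.L0 a ha t ht (by simp [pt])).cut_before hh hha
    have hs := mem_of_add hM h1.end_mem
    have ps : par s ≠ par a := by have := R_par e; rw [ph] at this; simp [this]
    have hn := Finset.nodup (S (J.erase k) a); rw [hM] at hn
    have hst : s ≠ t := fun h => Multiset.disjoint_left.1 (Multiset.nodup_add.1 hn).2.2 h1.end_mem (h ▸ h2.end_mem)
    have q := D.H1 _ hb _ (flip_mem_flip.2 hs) _ (flip_mem_flip.2 ht) (by simpa using ps) (by simp [pt])
      (by simpa using hst)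
    exact ((h1.join (D.up hs) q).join (R_symm _ _ (D.up ht)) (h2.rev R_symm)).of_eq (by rw [hval, hM]; abel)
  · obtain ⟨t, ht, pt, htX⟩ := D.exists_end (!par a) {flip k h} (by simp)
    rw [mem_singleton] at htX
    exact ((D.L0 a ha t ht (by simp [pt])).join (D.up ht) (D.H1 _ hb _ (flip_mem_flip.2 ht) h hh (by simp [pt])
      (by simp [ph]) (by rwa [Ne, flip_eq_iff]))).of_eq hval.symm

end Slab

/-- A detour edge whose opposite half is a slab. -/
theorem Det.of_slab (hj : j ∈ I) (hk : k ∈ I.erase j) (ha : a ∈ S (I.erase j) c) (fab : f a k) (na : ¬ f a j)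
    (nb : ¬ f (flip k a) j) (L : Lace (f.un a k) (I.erase j) c) (D : Slab f (I.erase j) (flip j a) k)
    (hB : (Bl f (I.erase j) c j).card + 1 < 2 ^ ((I.erase j).card - 1)) : Det f I c j k a (flip k a) := by
  have ha' : flip j a ∈ S (I.erase j) (flip j c) := flip_mem_flip.2 ha
  have e : flip j (flip k a) = flip k (flip j a) := flip_comm ..
  refine ⟨hj, hk, ha, rfl, fab, na, nb, L, (Lace_congr ha').1 D.lace, ?_, ?_, ?_, ?_, hB⟩ <;> rw [e, ← S_eq ha']
  · intro p hp q hq h h1 h2 h3 h4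
    rw [← Two_congr ha']
    by_cases pp : par p = par (flip j a)
    · exact D.two_ab hp hq pp (by rw [← pp]; exact h.symm) h1 h4
    · exact (D.two_ab hq hp (by revert h pp; cases par p <;> cases par q <;> cases par (flip j a) <;> simp) pp h3 h2).rev2
  · intro p hp q hq h h1 h2 h3
    rw [← Two_congr ha']
    exact D.two_cross hp hq (by simpa using h) (by simp [h1]) h2 h3
  · exact fun h hh ph hb => D.hyp_a hh (by simp [ph]) hb
  · exact fun h hh ph hb => D.hyp_b hh (by simpa using ph) hb

end HC

namespace HC

variable {n m : ℕ} {f : Flt n} {I J K : Finset (Fin n)} {b c u v w z x y a : V n} {i j k : Fin n}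

theorem not_fault_of_E (h : E f J b = 0) (hz : z ∈ S J b) (hi : i ∈ J) : ¬ f z i := fun hf => by
  have := E_pos hz hi hf; omega

theorem d_congr_of_sub (hKI : K ⊆ I) (h : ∀ i ∈ I, f z i → i ∈ K) : d f I z = d f K z := by
  unfold d; congr 1; ext i; simp only [mem_filter]; exact ⟨fun q => ⟨h i q.1 q.2, q.2⟩, fun q => ⟨hKI q.1, q.2⟩⟩

theorem d_le_card : d f I z ≤ I.card := card_filter_le _ _

theorem one_le_adj (hk : k ∈ I) (h : f v k) : adj f I v (flip k v) = 1 := if_pos ⟨k, hk, rfl, h⟩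

namespace Ctx

variable (D : Ctx f I c m)
include D

theorem lace_two_sep (hj : j ∈ I) (hu : u ∈ S I c) (huj : u j ≠ c j) (hdc : m ≤ d f I c + 2) (hdu : m ≤ d f I u + 2)
    (hC : ∀ z ∈ S I c, z ≠ c → z ≠ u → d f I z + 3 ≤ m) (hv : ∀ z ∈ S I c, d f I z + 1 = m → f z j) : Lace f I c := by
  have h0 := D.opp_le hj hu hdu
  rw [E_congr (show flip j u ∈ S (I.erase j) c from
    (mem_erase_iff hj).2 ⟨(flip_mem hj).2 hu, by rw [flip_same]; revert huj; cases u j <;> cases c j <;> simp⟩)] at h0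
  refine D.lace_M hj h0 (D.opp_le hj self_mem_S hdc) hv ?_
  intro z hz w hw hzw hj' h1 h2
  exfalso
  by_cases hzc : z = c
  · subst hzc
    by_cases hwu : w = u
    · subst hwu; exact huj hj'.symm
    · have := hC w hw hzw.symm hwu; omega
  · by_cases hzu : z = u
    · subst hzu
      by_cases hwc : w = c
      · subst hwc; exact huj hj'
      · have := hC w hw hwc hzw.symm; omega
    · have := hC z hz hzc hzu; omega

/-- Two vertices with many faults and a common faulty direction. -/
theorem lace_two_common (hj : j ∈ I) (hu : u ∈ S I c) (huc : u ≠ c) (hcj : f c j) (huj : f u j) (hucj : u j = c j)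
    (hdc : d f I c + 1 = m) (hdu : d f I u + 2 = m)
    (hC : ∀ z ∈ S I c, z ≠ c → z ≠ u → d f I z + 3 ≤ m) (h0 : E f (I.erase j) c ≤ 2 * cap m + 2) : Lace f I c := by
  have hm := D.hm
  have hF := D.faults
  have hca := D.cap_add
  have hcap : cap m = 3 * m - 9 + (m - 8) := rfl
  have hv : ∀ z ∈ S I c, d f I z + 1 = m → f z j := by
    intro z hz h
    by_cases hzc : z = c
    · rwa [hzc]
    by_cases hzu : z = u
    · rwa [hzu]
    have := hC z hz hzc hzu; omega
  have hM : ∀ z ∈ S I c, ∀ w ∈ S I c, z ≠ w → m ≤ d f I z + 2 → m ≤ d f I w + 2 →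
      (d f I z + 2 = m ∧ f z j) ∨ (d f I w + 2 = m ∧ f w j) := by
    intro z hz w hw hzw h1 h2
    by_cases hzu : z = u
    · subst hzu; exact Or.inl ⟨hdu, huj⟩
    by_cases hwu : w = u
    · subst hwu; exact Or.inr ⟨hdu, huj⟩
    by_cases hzc : z = c
    · have := hC w hw (by rw [← hzc]; exact hzw.symm) hwu; omega
    · have := hC z hz hzc hzu; omega
  by_cases h0' : E f (I.erase j) c ≤ 2 * cap m
  · exact D.lace_M hj h0' (D.opp_le hj self_mem_S (by omega)) hv fun z hz w hw hzw _ h1 h2 => hM z hz w hw hzw h1 h2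
  obtain ⟨e0, he0⟩ := E_even (f := f) (I := I.erase j) (b := c)
  have hs := card_Bl_le (f := f) (c := c) hj
  set B := Bl f (I.erase j) c j with hBdef
  have hcB : c ∈ B := mem_Bl.2 ⟨self_mem_S, hcj⟩
  have huB : u ∈ B := mem_Bl.2 ⟨(mem_erase_iff hj).2 ⟨hu, hucj⟩, huj⟩
  have huB' : u ∈ B.erase c := mem_erase.2 ⟨huc, huB⟩
  have hB : ∀ z ∈ (B.erase c).erase u, z ∈ S I c ∧ f z j := fun z hz => by
    rw [mem_erase, mem_erase, mem_Bl] at hz; exact ⟨S_erase_sub hz.2.2.1, hz.2.2.2⟩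
  have hs1 := sum_Bl_le hj hB (r := m - 4) fun z hz => by
    have := hC z (hB z hz).1 (mem_erase.1 (mem_erase.1 hz).2).1 (mem_erase.1 hz).1; omega
  have hc2 := card_erase_add_one hcB
  have hc3 := card_erase_add_one huB'
  have hs2 := Nat.mul_le_mul_right (m - 4) (by split_ifs at * <;> omega : ((B.erase c).erase u).card ≤ if m ≤ 7 then 0 else 1)
  have hs3 := add_sum_erase B (fun z => d f (I.erase j) z) hcB
  have hs3' := add_sum_erase _ (fun z => d f (I.erase j) z) huB'
  have hs4 := d_erase (f := f) (z := c) hj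
  have hs4' := d_erase (f := f) (z := u) hj
  rw [if_pos hcj] at hs4
  rw [if_pos huj] at hs4'
  obtain ⟨a, ha, i, hi, fab, aX, bX⟩ := exists_fault_avoid (f := f) (X := B) Bl_subset
    (show 2 * ∑ z ∈ B, d f (I.erase j) z < E f (I.erase j) c by split_ifs at hs2 <;> omega)
  have hb' := (flip_mem hi).2 ha
  have da := hC a (S_erase_sub ha) (by rintro rfl; exact aX hcB) (by rintro rfl; exact aX huB)
  have db := hC _ (S_erase_sub hb') (by intro h; exact bX (h ▸ hcB)) (by intro h; exact bX (h ▸ huB))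
  refine D.lace_P hj hi ha fab (not_Bl_iff ha aX) (not_Bl_iff hb' bX) (by omega) (Or.inl (by omega))
    (fun z hz => hv z (S_erase_sub hz)) ?_ ?_ ?_ ?_
  · intro z hz w hw hzw h1 h2
    rcases hM z (S_erase_sub hz) w (S_erase_sub hw) hzw h1 h2 with h | h
    · exact Or.inl ⟨h.1, Or.inl h.2⟩
    · exact Or.inr ⟨h.1, Or.inl h.2⟩
  all_goals rw [← hBdef]; omega

/-- Two vertices with many faults, the common directions carrying no other faults. -/
theorem lace_two_slab (T' : Tol n (m - 1)) (hm : 8 ≤ m) (hj : j ∈ I) (hu : u ∈ S I c) (hcj : f c j)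
    (hnuj : ¬ f u j) (hucj : u j = c j) (hdc : d f I c + 1 = m) (hdu : d f I u + 2 = m) (hadj : adj f I c u = 0) (huc : u ≠ c)
    (hC : ∀ z ∈ S I c, z ≠ c → z ≠ u → d f I z + 3 ≤ m) (h0 : E f (I.erase j) c ≤ 2 * cap m + 2)
    (hE : E f I c = 2 * cap m + 8) {J : Finset (Fin n)} (hJI : J ⊆ I) (hjJ : j ∉ J) (hJc : m ≤ J.card + 4)
    (hJ : ∀ k ∈ J, f c k ∧ f u k ∧ u k = c k ∧ E f (I.erase k) (flip k c) = 0)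
    (hJz : ∀ k ∈ J, ∀ z ∈ S I c, z j ≠ c j → ¬ f z k)
    (hβ : ∀ q, ((Bl f (I.erase j) c j).filter fun z => par z = q).card + 3 ≤ m) : Lace f I c := by
  have hcap : cap m = 3 * m - 9 + (m - 8) := rfl
  obtain ⟨k, hk, l, hl, hkl⟩ := one_lt_card.1 (by omega : 1 < J.card)
  have hkI := hJI hk
  have hkj : k ≠ j := by rintro rfl; exact hjJ hk
  have hlj : l ≠ j := by rintro rfl; exact hjJ hl
  have hkIj : k ∈ I.erase j := mem_erase.2 ⟨hkj, hkI⟩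
  have hlIj : l ∈ I.erase j := mem_erase.2 ⟨hlj, hJI hl⟩
  have huS : u ∈ S (I.erase j) c := (mem_erase_iff hj).2 ⟨hu, hucj⟩
  have hS : ∀ z ∈ S I c, z k ≠ c k → ∀ i ∈ I, i ≠ k → ¬ f z i := fun z hz h i hi hik =>
    not_fault_of_E (hJ k hk).2.2.2 ((mem_erase_flip_iff hkI).2 ⟨hz, h⟩) (mem_erase.2 ⟨hik, hi⟩)
  have hbu : flip k u ∈ S I c := (flip_mem hkI).2 hu
  have hbk : flip k u k ≠ c k := by simp [(hJ k hk).2.2.1]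
  have hnb : ¬ f (flip k u) j := hS _ hbu hbk j hj hkj.symm
  have hdb : d f I (flip k u) ≤ 1 := by
    have := d_congr_of_sub (f := f) (I := I) (K := {k}) (z := flip k u) (by simpa using hkI) fun i hi h => by
      by_contra hik; exact hS _ hbu hbk i hi (by simpa using hik) h
    rw [this]; exact d_le_card.trans (by simp)
  have L : Lace (f.un u k) (I.erase j) c := by
    have hmem : ∀ z ∈ S (I.erase j) c, m ≤ d f I z + 2 → z = c ∨ z = u := fun z hz h => by
      by_contra hn; rw [not_or] at hn; have := hC z (S_erase_sub hz) hn.1 hn.2; omega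
    refine D.lace_un hj hkIj huS (hJ k hk).2.1 h0 ?_ ?_
    · intro z hz h
      rcases hmem z hz (by omega) with rfl | rfl
      · exact Or.inl hcj
      · omega
    · intro z hz w hw hzw h1 h2
      rcases hmem z hz h1 with rfl | rfl
      · rcases hmem w hw h2 with rfl | rfl
        · exact absurd rfl hzw
        · exact Or.inr ⟨hdu, Or.inr (Or.inl rfl)⟩
      · exact Or.inl ⟨hdu, Or.inr (Or.inl rfl)⟩
  have hcm := D.card_erase hj
  have hck : ((I.erase j).erase k).card = m - 1 := by rw [card_erase_of_mem hkIj, hcm]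
  have huj' : flip j u ∈ S (I.erase j) (flip j c) := flip_mem_flip.2 huS
  have hsub : ∀ z ∈ S (I.erase j) (flip j u), z ∈ S I c ∧ z j ≠ c j := fun z hz => by
    rw [S_eq huj'] at hz; exact (mem_erase_flip_iff hj).1 hz
  have hk1 : E f ((I.erase j).erase k) (flip k (flip j u)) = 0 := by
    have h1 : flip k (flip j u) ∈ S (I.erase k) (flip k c) :=
      (mem_erase_flip_iff hkI).2 ⟨(flip_mem hkI).2 ((flip_mem hj).2 hu), by simp [flip_other hkj, (hJ k hk).2.2.1]⟩
    have h2 := E_mono (f := f) (b := flip k (flip j u)) (erase_subset_erase k (erase_subset j I))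
    rw [E_congr h1, (hJ k hk).2.2.2] at h2
    omega
  have hE1 : E f ((I.erase j).erase k) (flip j u) ≤ 2 * cap (m - 1) := by
    have h1 := E_mono (f := f) (b := flip j u) (erase_subset k (I.erase j))
    have h2 : E f (I.erase j) (flip j u) = E ((f.rm c).rm u) (I.erase j) (flip j u) := by
      rw [E_rm_of_notMem (f := f.rm c), E_rm_of_notMem]
      · exact fun h => (hsub c h).2 rfl
      · exact fun h => (hsub u h).2 hucj
    have h3 := E_mono (f := (f.rm c).rm u) (b := flip j u) (erase_subset j I)
    rw [E_congr (show flip j u ∈ S I c from (flip_mem hj).2 hu)] at h3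
    have h4 := E_rm2 (f := f) self_mem_S hu huc
    have hcap' : cap (m - 1) = 3 * (m - 1) - 9 + (m - 1 - 8) := rfl
    omega
  have hd : ∀ z ∈ S ((I.erase j).erase k) (flip j u), d f ((I.erase j).erase k) z + 3 ≤ m - 1 := by
    intro z hz
    have hz' := hsub z (S_erase_sub hz)
    have h1 := d_congr_of_sub (f := f) (I := (I.erase j).erase k) (K := (I.erase j).erase k \ J) (z := z) sdiff_subset
      fun i hi h => mem_sdiff.2 ⟨hi, fun hiJ => hJz i hiJ z hz'.1 hz'.2 h⟩
    have h2 : ((I.erase j).erase k \ J).card + J.card + 1 ≤ I.card := by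
      have h3 : (I.erase j).erase k \ J ⊆ (I.erase j) \ J := sdiff_subset_sdiff (erase_subset _ _) subset_rfl
      have h4 : J ⊆ I.erase j := fun x hx => mem_erase.2 ⟨by rintro rfl; exact hjJ hx, hJI hx⟩
      have h5 := card_le_card h3
      have h6 := card_le_card h4
      rw [card_sdiff_of_subset h4] at h5
      have := D.card
      omega
    have h3 := d_le_card (f := f) (I := (I.erase j).erase k \ J) (z := z)
    have := D.card
    omega
  have hDet : Det f I c j k u (flip k u) := by
    refine .of_slab hj hkIj huS (hJ k hk).2.1 hnuj hnb L
      ⟨hkIj, ?_, ?_, ?_, ?_, fun z hz => hJz k hk z (hsub z hz).1 (hsub z hz).2, by omega⟩ (D.Bl_small hj)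
    · refine T' f _ _ hck (fun z hz => ?_) (fun _ z hz w _ h => ?_) hE1
      · have := hd z hz; omega
      · have := hd z hz; omega
    · exact lace_of_few (card_pos.1 (by omega)) (Or.inr hk1)
    · exact twoAll_of_few (by omega) (Or.inr hk1)
    · exact hyp_of_few (by omega) (Or.inr hk1)
  refine hDet.lace_one_end (Or.inl ⟨l, hlIj, hS _ hbu hbk l (hJI hl) hkl.symm, hS _ ((flip_mem (hJI hl)).2 hbu) ?_ j hj hkj.symm⟩) ?_
  · rw [flip_other hkl]; exact hbk
  · have := D.gd_add hj hnb
    have := hβ (par (flip k u))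
    omega

theorem lace_two_big (T' : 8 ≤ m → Tol n (m - 1)) (hu : u ∈ S I c) (huc : u ≠ c) (hdc : m ≤ d f I c + 2)
    (hdu : d f I u + 2 = m) (hC : ∀ z ∈ S I c, z ≠ c → z ≠ u → d f I z + 3 ≤ m) : Lace f I c := by
  have hm := D.hm
  have hF := D.faults
  have hca := D.cap_add
  have hcap : cap m = 3 * m - 9 + (m - 8) := rfl
  have hc := D.deg c self_mem_S
  by_cases hdc' : d f I c + 2 = m
  · obtain ⟨j, hj⟩ : ∃ j, u j ≠ c j := Function.ne_iff.1 huc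
    have hjI : j ∈ I := by by_contra h; exact hj (mem_S.1 hu j h)
    refine D.lace_two_sep hjI hu hj hdc hdu.ge hC fun z hz h => ?_
    by_cases hzc : z = c
    · subst hzc; omega
    by_cases hzu : z = u
    · subst hzu; omega
    have := hC z hz hzc hzu; omega
  replace hdc' : d f I c + 1 = m := by omega
  by_cases hsep : ∃ j ∈ I, u j ≠ c j ∧ f c j
  · obtain ⟨j, hj, huj, hcj⟩ := hsep
    refine D.lace_two_sep hj hu huj hdc hdu.ge hC fun z hz h => ?_
    by_cases hzc : z = c
    · rwa [hzc]
    by_cases hzu : z = u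
    · subst hzu; omega
    have := hC z hz hzc hzu; omega
  have hns : ∀ j ∈ I, f c j → u j = c j := fun j hj h => by by_contra hne; exact hsep ⟨j, hj, hne, h⟩
  have hadj : adj f I c u = 0 := by
    by_contra h
    obtain ⟨k, hk, rfl, h2⟩ := exists_of_adj h
    have := hns k hk h2; simp at this
  set A := I.filter (f c) with hA
  set J := A.filter (f u) with hJdef
  set P := A.filter (fun j => ¬ f u j) with hP
  have hAI : A ⊆ I := filter_subset _ _
  have hJA : J ⊆ A := filter_subset _ _
  have hPA : P ⊆ A := filter_subset _ _
  have hAc : A.card + 1 = m := hdc'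
  have hPJ : J.card + P.card = A.card := card_filter_add_card_filter_not _
  have hAm : ∀ {j}, j ∈ A → j ∈ I ∧ f c j := fun h => mem_filter.1 h
  have hcI := D.card
  have hGc : (I \ A).card = 2 := by rw [card_sdiff_of_subset hAI]; omega
  have hG : ∀ i ∈ I \ A, ¬ f c i := fun i hi h => (mem_sdiff.1 hi).2 (mem_filter.2 ⟨(mem_sdiff.1 hi).1, h⟩)
  have hJc : m ≤ J.card + 4 := by
    have h1 : (I.filter (f u)) ⊆ J ∪ (I \ A) := fun i hi => by
      rw [mem_filter] at hi
      by_cases h : i ∈ A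
      · exact mem_union_left _ (mem_filter.2 ⟨h, hi.2⟩)
      · exact mem_union_right _ (mem_sdiff.2 ⟨hi.1, h⟩)
    have h2 := (card_le_card h1).trans (card_union_le _ _)
    change d f I u ≤ _ at h2
    omega
  have hJc2 : J.card + 2 ≤ m := by
    have h1 : J ⊆ I.filter (f u) := fun i hi => mem_filter.2 ⟨(hAm (hJA hi)).1, (mem_filter.1 hi).2⟩
    have h2 := card_le_card h1
    change _ ≤ d f I u at h2
    omega
  by_cases hcom : ∃ j ∈ J, E f (I.erase j) c ≤ 2 * cap m + 2
  · obtain ⟨j, hj, h0⟩ := hcom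
    obtain ⟨hjI, hcj⟩ := hAm (hJA hj)
    exact D.lace_two_common hjI hu huc hcj (mem_filter.1 hj).2 (hns j hjI hcj) hdc' hdu hC h0
  push Not at hcom
  have hEe := E_even (f := f) (I := I) (b := c)
  have hJall : ∀ k ∈ J, 2 * cap m + 8 ≤ E f I c ∧ E f (I.erase k) (flip k c) = 0 ∧ Bl f (I.erase k) c k = {c, u} ∧
      E f I c ≤ E f (I.erase k) c + 4 := by
    intro k hk
    obtain ⟨hkI, hck⟩ := hAm (hJA hk)
    have h1 := hcom k hk
    obtain ⟨e, he⟩ := E_even (f := f) (I := I.erase k) (b := c)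
    have hs := E_split (f := f) (c := c) hkI
    have hsub : {c, u} ⊆ Bl f (I.erase k) c k := by
      intro z hz
      simp only [mem_insert, mem_singleton] at hz
      rcases hz with rfl | rfl
      · exact mem_Bl.2 ⟨self_mem_S, hck⟩
      · exact mem_Bl.2 ⟨(mem_erase_iff hkI).2 ⟨hu, hns k hkI hck⟩, (mem_filter.1 hk).2⟩
    have h2 := card_le_card hsub
    rw [card_pair huc.symm] at h2
    refine ⟨by omega, by omega, (eq_of_subset_of_card_le hsub ?_).symm, by omega⟩
    rw [card_pair huc.symm]; omega
  obtain ⟨k0, hk0⟩ : J.Nonempty := card_pos.1 (by omega)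
  have hE : E f I c = 2 * cap m + 8 := by have := hJall k0 hk0; omega
  have hm8 : 8 ≤ m := by omega
  have hJz' : ∀ k ∈ J, ∀ z ∈ S I c, f z k → z = c ∨ z = u ∨ z = flip k c ∨ z = flip k u := by
    intro k hk z hz hzk
    have hB := (hJall k hk).2.2.1
    by_cases h : z k = c k
    · have : z ∈ Bl f (I.erase k) c k := mem_Bl.2 ⟨(mem_erase_iff (hAI (hJA hk))).2 ⟨hz, h⟩, hzk⟩
      rw [hB] at this; simp at this; tauto
    · have : flip k z ∈ Bl f (I.erase k) c k := mem_Bl.2 ⟨by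
        rw [flip_mem_swap]; exact (mem_erase_flip_iff (hAI (hJA hk))).2 ⟨hz, h⟩, by simpa using hzk⟩
      rw [hB] at this; simp [flip_eq_iff] at this; tauto
  have hPns : ∀ j ∈ P, u j = c j := fun j hj => hns j (hAI (hPA hj)) (hAm (hPA hj)).2
  have hJP : ∀ k ∈ J, ∀ j ∈ P, k ≠ j := by
    rintro k hk j hj rfl; exact (mem_filter.1 hj).2 (mem_filter.1 hk).2
  have hJz : ∀ j ∈ P, ∀ k ∈ J, ∀ z ∈ S I c, z j ≠ c j → ¬ f z k := by
    intro j hj k hk z hz hzj hzk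
    have h1 := hPns j hj
    have h2 : j ≠ k := (hJP k hk j hj).symm
    rcases hJz' k hk z hz hzk with rfl | rfl | rfl | rfl
    · exact hzj rfl
    · exact hzj h1
    · rw [flip_other h2] at hzj; exact hzj rfl
    · rw [flip_other h2] at hzj; exact hzj h1
  have key : ∀ j ∈ P, E f (I.erase j) c ≤ 2 * cap m + 2 → (Bl f (I.erase j) c j).card + 3 ≤ m ∨
      (∀ q, ((Bl f (I.erase j) c j).filter fun z => par z = q).card + 3 ≤ m) → Lace f I c := by
    intro j hj h0 hβ
    obtain ⟨hjI, hcj⟩ := hAm (hPA hj)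
    refine D.lace_two_slab (T' hm8) hm8 hjI hu hcj (mem_filter.1 hj).2 (hPns j hj) hdc' hdu hadj huc hC h0 hE
      (hJA.trans hAI) (fun h => hJP j h j hj rfl) hJc (fun k hk => ?_) (hJz j hj) fun q => ?_
    · exact ⟨(hAm (hJA hk)).2, (mem_filter.1 hk).2, hns k (hAI (hJA hk)) (hAm (hJA hk)).2, (hJall k hk).2.1⟩
    · rcases hβ with h | h
      · have := card_filter_le (Bl f (I.erase j) c j) fun z => par z = q; omega
      · exact h q
  have hsum : ∀ j ∈ P, ∀ l ∈ P, j ≠ l → (Bl f (I.erase j) c j).card + (Bl f (I.erase l) c l).card + 2 * J.card + 13 ≤ 4 * m := by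
    intro j hj l hl hjl
    have h1 := E_eq_sum (f := f) (I := I) (b := c)
    have h2 : insert j (insert l J) ⊆ I := by
      intro x hx
      simp only [mem_insert] at hx
      rcases hx with rfl | rfl | hx
      · exact hAI (hPA hj)
      · exact hAI (hPA hl)
      · exact hAI (hJA hx)
    have h3 := sum_le_sum_of_subset (f := fun j => 2 * (Bl f (I.erase j) c j).card) h2
    rw [sum_insert, sum_insert (fun h => hJP l h l hl rfl), ← h1, hE] at h3
    · have h4 : ∑ x ∈ J, 2 * (Bl f (I.erase x) c x).card = J.card * 4 := by
        rw [sum_const_nat]; intro x hx; rw [(hJall x hx).2.2.1, card_pair huc.symm]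
      omega
    · rw [mem_insert, not_or]; exact ⟨hjl, fun h => hJP j h j hj rfl⟩
  obtain ⟨j, hj, hjE⟩ : ∃ j ∈ P, E f (I.erase j) c + 5 ≤ E f I c := by
    by_contra! h
    have h1 := E_le_of_out (f := f) (b := c) (K := I \ J) (J := P) (I := I) (r := 4)
      (fun x hx => mem_sdiff.2 ⟨hAI (hPA hx), fun h => hJP x h x hx rfl⟩) sdiff_subset fun j hj => by have := h j hj; omega
    have h2 := E_le_of_out (f := f) (b := c) (K := I) (J := J) (I := I) (r := 4) (hJA.trans hAI) subset_rfl fun k hk => (hJall k hk).2.2.2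
    have h3 : (I \ J) \ P = I \ A := by
      ext i; simp only [mem_sdiff, hJdef, hP, mem_filter]; tauto
    rw [h3] at h1
    have h4 := E_eq_le_four hGc hG
    omega
  obtain ⟨e0, he0⟩ := E_even (f := f) (I := I.erase j) (b := c)
  by_cases hβ : ∀ q, ((Bl f (I.erase j) c j).filter fun z => par z = q).card + 3 ≤ m
  · exact key j hj (by omega) (Or.inr hβ)
  push Not at hβ
  obtain ⟨q, hq⟩ := hβ
  by_cases hl : ∃ l ∈ P, l ≠ j ∧ E f (I.erase l) c + 5 ≤ E f I c
  · obtain ⟨l, hl, hlj, hlE⟩ := hl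
    obtain ⟨e1, he1⟩ := E_even (f := f) (I := I.erase l) (b := c)
    have h1 := hsum j hj l hl hlj.symm
    have h2 := card_filter_le (Bl f (I.erase j) c j) fun z => par z = q
    exact key l hl (by omega) (Or.inl (by omega))
  push Not at hl
  exfalso
  have hjI := hAI (hPA hj)
  have h1 : ∀ l ∈ P.erase j, ((Bl f (I.erase j) c j).filter fun z => z l ≠ c l).card ≤ 1 := by
    intro l hl'
    obtain ⟨hlj, hlP⟩ := mem_erase.1 hl'
    have hlI := hAI (hPA hlP)
    have h1 := hl l hlP hlj
    have h2 := E_split (f := f) (c := c) hlI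
    have h3 : 0 < (Bl f (I.erase l) c l).card := card_pos.2 ⟨c, mem_Bl.2 ⟨self_mem_S, (hAm (hPA hlP)).2⟩⟩
    have h4 := card_Bl_le (f := f) (c := flip l c) (mem_erase.2 ⟨hlj.symm, hjI⟩ : j ∈ I.erase l)
    have h5 : (Bl f (I.erase j) c j).filter (fun z => z l ≠ c l) ⊆ Bl f ((I.erase l).erase j) (flip l c) j := by
      intro z hz
      rw [mem_filter, mem_Bl] at hz
      rw [mem_Bl, erase_right_comm]
      exact ⟨(mem_erase_flip_iff (mem_erase.2 ⟨hlj, hlI⟩)).2 ⟨hz.1.1, hz.2⟩, hz.1.2⟩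
    have h6 := card_le_card h5
    omega
  have h2 : (Bl f (I.erase j) c j).filter (fun z => par z = q) ⊆ ((S (I \ A) c).filter fun z => par z = q) ∪
      (P.erase j).biUnion fun l => (Bl f (I.erase j) c j).filter fun z => z l ≠ c l := by
    intro z hz
    obtain ⟨hz1, hz2⟩ := mem_filter.1 hz
    obtain ⟨hz3, hz4⟩ := mem_Bl.1 hz1
    obtain ⟨hz5, hz6⟩ := (mem_erase_iff hjI).1 hz3
    rw [mem_union, mem_filter, mem_biUnion]
    by_cases h : ∃ l ∈ P.erase j, z l ≠ c l
    · obtain ⟨l, hl, hzl⟩ := h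
      exact Or.inr ⟨l, hl, mem_filter.2 ⟨hz1, hzl⟩⟩
    push Not at h
    refine Or.inl ⟨mem_S.2 fun i hi => ?_, hz2⟩
    by_cases hiI : i ∈ I
    · have hiA : i ∈ A := by by_contra h; exact hi (mem_sdiff.2 ⟨hiI, h⟩)
      by_cases hij : i = j
      · rw [hij, hz6]
      by_cases hiu : f u i
      · have hiJ : i ∈ J := mem_filter.2 ⟨hiA, hiu⟩
        by_contra hne
        exact not_fault_of_E (hJall i hiJ).2.1 ((mem_erase_flip_iff hiI).2 ⟨hz5, hne⟩)
          (mem_erase.2 ⟨Ne.symm hij, hjI⟩) hz4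
      · exact h i (mem_erase.2 ⟨hij, mem_filter.2 ⟨hiA, hiu⟩⟩)
    · exact mem_S.1 hz5 i hiI
  have h3 := (card_le_card h2).trans (card_union_le _ _)
  have h4 := card_biUnion_le_card_mul _ _ _ h1
  rw [card_par q (card_pos.1 (by omega)), hGc, card_erase_of_mem hj] at *
  omega

end Ctx

end HC

namespace HC

variable {n m : ℕ} {f : Flt n} {I J K : Finset (Fin n)} {b c u v w z x y a : V n} {i j k : Fin n}

/-- Three vertices with many faults. -/
structure Three (f : Flt n) (I : Finset (Fin n)) (c : V n) (m : ℕ) (u w : V n) : Prop extends Ctx f I c m where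
  hu : u ∈ S I c
  hw : w ∈ S I c
  huc : u ≠ c
  hwc : w ≠ c
  hwu : w ≠ u
  dc : m ≤ d f I c + 2
  du : d f I u + 2 = m
  dw : d f I w + 2 = m
  C : ∀ z ∈ S I c, m ≤ d f I z + 2 → z = c ∨ z = u ∨ z = w

namespace Three

variable (D : Three f I c m u w)
include D

theorem swap : Three f I c m w u where
  toCtx := D.toCtx
  hu := D.hw
  hw := D.hu
  huc := D.hwc
  hwc := D.huc
  hwu := D.hwu.symm
  dc := D.dc
  du := D.dw
  dw := D.du
  C z hz h := by have := D.C z hz h; tauto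

theorem small (hz : z ∈ S I c) (h1 : z ≠ c) (h2 : z ≠ u) (h3 : z ≠ w) : d f I z + 3 ≤ m := by
  by_contra h
  rcases D.C z hz (by omega) with h | h | h <;> contradiction

theorem tight (hz : z ∈ S I c) (h : d f I z + 1 = m) : z = c := by
  have := D.du; have := D.dw
  rcases D.C z hz (by omega) with h | rfl | rfl
  · exact h
  all_goals omega

theorem pairs {P : V n → V n → Prop} (hP : ∀ z w, P z w → P w z) (h1 : P c u) (h2 : P c w) (h3 : P u w) {z y : V n}
    (hz : z ∈ S I c) (hy : y ∈ S I c) (hzy : z ≠ y) (hzm : m ≤ d f I z + 2) (hym : m ≤ d f I y + 2) : P z y := by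
  rcases D.C z hz hzm with rfl | rfl | rfl <;> rcases D.C y hy hym with rfl | rfl | rfl <;>
    first | exact absurd rfl hzy | assumption | (apply hP; assumption)

theorem lace_M' (hj : j ∈ I) (h0 : E f (I.erase j) c ≤ 2 * cap m ∨ u j ≠ c j ∨ w j ≠ c j) (hc : d f I c + 1 = m → f c j)
    (hcu : u j = c j → (d f I c + 2 = m ∧ f c j) ∨ f u j) (hcw : w j = c j → (d f I c + 2 = m ∧ f c j) ∨ f w j)
    (huw : u j = w j → f u j ∨ f w j) : Lace f I c := by
  have key : ∀ z, z ∈ S I c → m ≤ d f I z + 2 → z j ≠ c j → E f (I.erase j) c ≤ 2 * cap m := fun z hz hz' h => by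
    have h0 := D.opp_le hj hz hz'
    rwa [E_congr (show flip j z ∈ S (I.erase j) c from
      (mem_erase_iff hj).2 ⟨(flip_mem hj).2 hz, by rw [flip_same]; revert h; cases z j <;> cases c j <;> simp⟩)] at h0
  refine D.lace_M hj ?_ (D.opp_le hj self_mem_S D.dc) (fun z hz h => ?_) ?_
  · rcases h0 with h0 | h0 | h0
    · exact h0
    · exact key u D.hu D.du.ge h0
    · exact key w D.hw D.dw.ge h0
  · have := D.tight hz h; subst this; exact hc h
  · intro z hz y hy hzy e h1 h2
    refine D.pairs (P := fun z y => z j = y j → (d f I z + 2 = m ∧ f z j) ∨ (d f I y + 2 = m ∧ f y j))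
      (fun _ _ h e => (h e.symm).symm) ?_ ?_ ?_ hz hy hzy h1 h2 e
    · exact fun e => (hcu e.symm).imp_right fun h => ⟨D.du, h⟩
    · exact fun e => (hcw e.symm).imp_right fun h => ⟨D.dw, h⟩
    · exact fun e => (huw e).imp (fun h => ⟨D.du, h⟩) fun h => ⟨D.dw, h⟩

theorem sub_B (hj : j ∈ I) (hcj : f c j) (huj : f u j) (h : u j = c j) : {c, u} ⊆ Bl f (I.erase j) c j := by
  intro z hz
  simp only [mem_insert, mem_singleton] at hz
  rcases hz with rfl | rfl
  · exact mem_Bl.2 ⟨self_mem_S, hcj⟩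
  · exact mem_Bl.2 ⟨(mem_erase_iff hj).2 ⟨D.hu, h⟩, huj⟩

/-- Three vertices with a common faulty direction. -/
theorem lace_common (hj : j ∈ I) (hcj : f c j) (huj : f u j) (hwj : f w j)
    (hstar : m = 8 → d f I c = 7 → E f I c = 38 → adj f I c u = 0 → adj f I c w = 0 → adj f I u w = 0 → Lace f I c) :
    Lace f I c := by
  by_cases h0 : E f (I.erase j) c ≤ 2 * cap m ∨ u j ≠ c j ∨ w j ≠ c j
  · exact D.lace_M' hj h0 (fun _ => hcj) (fun _ => Or.inr huj) (fun _ => Or.inr hwj) fun _ => Or.inl huj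
  push Not at h0
  obtain ⟨h0, hu, hw⟩ := h0
  have hm := D.hm
  have hF := D.faults
  have hca := D.cap_add
  have hdc := D.deg c self_mem_S
  have hdu := D.du
  have hdw := D.dw
  have hdc2 := D.dc
  have hcap : cap m = 3 * m - 9 + (m - 8) := rfl
  have huS := (mem_erase_iff hj).2 ⟨D.hu, hu⟩
  have hwS := (mem_erase_iff hj).2 ⟨D.hw, hw⟩
  have hs := E_split (f := f) (c := c) hj
  obtain ⟨e, he⟩ := E_even (f := f) (I := I) (b := c)
  obtain ⟨e0, he0⟩ := E_even (f := f) (I := I.erase j) (b := c)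
  set B := Bl f (I.erase j) c j with hBdef
  have hsub : {c, u, w} ⊆ B := by
    intro z hz
    simp only [mem_insert, mem_singleton] at hz
    rcases hz with rfl | rfl | rfl
    · exact mem_Bl.2 ⟨self_mem_S, hcj⟩
    · exact mem_Bl.2 ⟨huS, huj⟩
    · exact mem_Bl.2 ⟨hwS, hwj⟩
  have hc3 : ({c, u, w} : Finset (V n)).card = 3 := card_eq_three.2 ⟨_, _, _, D.huc.symm, D.hwc.symm, D.hwu.symm, rfl⟩
  have hBc := card_le_card hsub
  have hB : {c, u, w} = B := eq_of_subset_of_card_le hsub (by omega)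
  rw [← hB, hc3] at hs
  rw [hc3] at hBc
  have h3 := E_rm3 (f := f) (self_mem_S (I := I.erase j)) huS hwS D.huc D.hwc D.hwu
  have e1 := d_erase (f := f) (z := c) hj
  have e2 := d_erase (f := f) (z := u) hj
  have e3 := d_erase (f := f) (z := w) hj
  rw [if_pos hcj] at e1
  rw [if_pos huj] at e2
  rw [if_pos hwj] at e3
  by_cases hg : E (((f.rm c).rm u).rm w) (I.erase j) c = 0
  · have key : m = 8 ∧ d f I c = 7 ∧ E f I c = 38 ∧ adj f (I.erase j) c u = 0 ∧ adj f (I.erase j) c w = 0 ∧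
      adj f (I.erase j) u w = 0 := by omega
    have hadj : ∀ x y : V n, x j = y j → adj f (I.erase j) x y = 0 → adj f I x y = 0 := by
      intro x y hxy h
      by_contra hne
      obtain ⟨k, hk, rfl, hf⟩ := exists_of_adj hne
      rw [one_le_adj (mem_erase.2 ⟨by rintro rfl; simp at hxy, hk⟩) hf] at h
      cases h
    obtain ⟨k1, k2, k3, k4, k5, k6⟩ := key
    exact hstar k1 k2 k3 (hadj _ _ hu.symm k4) (hadj _ _ hw.symm k5) (hadj _ _ (hu.trans hw.symm) k6)
  obtain ⟨a, ha, i, hi, ⟨⟨⟨fab, ac, bc⟩, au, bu⟩, aw, bw⟩⟩ := exists_fault hg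
  have hb := (flip_mem hi).2 ha
  have da := D.small (S_erase_sub ha) ac au aw
  have db := D.small (S_erase_sub hb) bc bu bw
  have nB : ∀ z ∈ S (I.erase j) c, z ≠ c → z ≠ u → z ≠ w → ¬ f z j := fun z hz h1 h2 h3 =>
    not_Bl_iff hz (by rw [← hBdef, ← hB]; simp [h1, h2, h3])
  have hBc' : (Bl f (I.erase j) c j).card = 3 := by rw [← hBdef, ← hB, hc3]
  refine D.lace_P hj hi ha fab (nB a ha ac au aw) (nB _ hb bc bu bw) (by omega) (Or.inl (by omega)) ?_ ?_ ?_ ?_ ?_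
  · intro z hz h
    have := D.tight (S_erase_sub hz) h; rwa [this]
  · intro z hz y hy hzy h1 h2
    refine D.pairs (P := fun z y => (d f I z + 2 = m ∧ (f z j ∨ z = a ∨ z = flip i a)) ∨
      (d f I y + 2 = m ∧ (f y j ∨ y = a ∨ y = flip i a))) (fun _ _ h => h.symm) ?_ ?_ ?_ (S_erase_sub hz)
      (S_erase_sub hy) hzy h1 h2
    · exact Or.inr ⟨hdu, Or.inl huj⟩
    · exact Or.inr ⟨hdw, Or.inl hwj⟩
    · exact Or.inl ⟨hdu, Or.inl huj⟩
  all_goals omega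

/-- A detour at the third vertex when two vertices share a faulty direction. -/
theorem lace_third (hj : j ∈ I) (hcj : f c j) (huj : f u j) (hwj : ¬ f w j) (hwc : w j = c j)
    (hB : (Bl f (I.erase j) c j).card ≤ 2) (h1 : E f (I.erase j) (flip j c) + 6 ≤ 2 * m)
    (hm7 : m ≤ 7 ∨ u j ≠ c j) : Lace f I c := by
  have hm := D.hm
  have hF := D.faults
  have hca := D.cap_add
  have hdu := D.du
  have hdw := D.dw
  have hs := E_split (f := f) (c := c) hj
  have h0 : E f (I.erase j) c ≤ 2 * cap m + 2 := by
    by_cases huc : u j = c j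
    · have h2 := card_le_card (D.sub_B hj hcj huj huc)
      rw [card_pair D.huc.symm] at h2
      have := hm7.resolve_right (not_not.2 huc)
      omega
    · have h2 := two_d_le (f := f) ((mem_erase_flip_iff hj).2 ⟨D.hu, huc⟩)
      have h3 := d_erase (f := f) (z := u) hj
      rw [if_pos huj] at h3
      omega
  have hwS := (mem_erase_iff hj).2 ⟨D.hw, hwc⟩
  obtain ⟨i, hi, hiB⟩ : ∃ i ∈ I.filter (f w), flip i w ∉ Bl f (I.erase j) c j := by
    by_contra! h
    have := card_le_card_of_injOn (s := I.filter (f w)) (t := Bl f (I.erase j) c j) (fun i => flip i w) h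
      fun i _ k _ h => (flip_dir_inj _ _ _).1 h
    change d f I w ≤ _ at this
    omega
  obtain ⟨hiI, hwi⟩ := mem_filter.1 hi
  have hij : i ≠ j := by rintro rfl; exact hwj hwi
  have hiIj := mem_erase.2 ⟨hij, hiI⟩
  have hb := (flip_mem hiIj).2 hwS
  have nb := not_Bl_iff hb hiB
  have db := D.small (S_erase_sub hb) (by intro h; exact nb (h ▸ hcj)) (by intro h; exact nb (h ▸ huj)) (flip_ne i w)
  refine D.lace_P hj hiIj hwS hwi hwj nb h0 (Or.inl h1) ?_ ?_ ?_ ?_ ?_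
  · intro z hz h
    have := D.tight (S_erase_sub hz) h; rwa [this]
  · intro z hz y hy hzy h1 h2
    refine D.pairs (P := fun z y => (d f I z + 2 = m ∧ (f z j ∨ z = w ∨ z = flip i w)) ∨
      (d f I y + 2 = m ∧ (f y j ∨ y = w ∨ y = flip i w))) (fun _ _ h => h.symm) ?_ ?_ ?_ (S_erase_sub hz)
      (S_erase_sub hy) hzy h1 h2
    · exact Or.inr ⟨hdu, Or.inl huj⟩
    · exact Or.inr ⟨hdw, Or.inr (Or.inl rfl)⟩
    · exact Or.inl ⟨hdu, Or.inl huj⟩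
  all_goals omega

end Three

end HC

namespace HC

variable {n m : ℕ} {f : Flt n} {I J K : Finset (Fin n)} {b c u v w z x y a : V n} {i j k : Fin n}

namespace Three

variable (D : Three f I c m u w)
include D

theorem move (h : d f I c + 2 = m) : Three f I u m c w where
  toCtx := D.toCtx.move D.hu
  hu := by rw [mem_S_comm]; exact D.hu
  hw := by rw [S_eq D.hu]; exact D.hw
  huc := D.huc.symm
  hwc := D.hwu
  hwu := D.hwc
  dc := D.du.ge
  du := h
  dw := D.dw
  C z hz h := by
    rw [S_eq D.hu] at hz
    have := D.C z hz h; tauto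

theorem filter_good (z : V n) : (I.filter fun i => ¬ f z i).card + d f I z = m + 1 := by
  have := card_filter_add_card_filter_not (s := I) (f z)
  rw [D.card] at this
  unfold d; omega

/-- Three vertices with equally many faults, exactly one of them without fault in direction `j`. -/
theorem lace_equal_of (hdc : d f I c + 2 = m) (hj : j ∈ I) (hcj : f c j) (huj : f u j) (hwj : ¬ f w j)
    (h : m ≤ 7 ∨ w j ≠ c j ∨ u j ≠ c j) : Lace f I c := by
  have hM := D.lace_M' hj (j := j)
  by_cases h0 : E f (I.erase j) c ≤ 2 * cap m ∨ u j ≠ c j ∨ w j ≠ c j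
  · exact hM h0 (fun _ => hcj) (fun _ => Or.inr huj) (fun _ => Or.inl ⟨hdc, hcj⟩) fun _ => Or.inl huj
  push Not at h0
  obtain ⟨h0, huc, hwc⟩ := h0
  have hm7 : m ≤ 7 := by tauto
  have hB := card_le_card (D.sub_B hj hcj huj huc)
  rw [card_pair D.huc.symm] at hB
  have hs := E_split (f := f) (c := c) hj
  have := D.faults
  have := D.cap_add
  obtain ⟨e, he⟩ := E_even (f := f) (I := I.erase j) (b := c)
  have := D.hm
  exact D.lace_third hj hcj huj hwj hwc (by omega) (by omega) (Or.inl hm7)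

theorem lace_equal (hdc : d f I c + 2 = m) (hm8 : m ≤ 8) (hno : ∀ j ∈ I, ¬ (f c j ∧ f u j ∧ f w j)) : Lace f I c := by
  set N : Fin n → ℕ := fun j => (if f c j then 1 else 0) + ((if f u j then 1 else 0) + if f w j then 1 else 0)
  have hN : ∑ j ∈ I, N j = 3 * m - 6 := by
    simp only [N, sum_add_distrib, ← card_filter]
    change d f I c + (d f I u + d f I w) = _
    have := D.du; have := D.dw
    omega
  have hle : ∀ j ∈ I, N j ≤ 2 := fun j hj => by
    have := hno j hj
    simp only [N]; split_ifs <;> first | omega | tauto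
  have hcard := D.card
  obtain ⟨j, hj, hNj, hsep⟩ : ∃ j ∈ I, N j = 2 ∧ (m ≤ 7 ∨ u j ≠ c j) := by
    by_contra! h
    rcases Nat.lt_or_ge 7 m with h7 | h7
    · obtain ⟨j, hj, huj⟩ : ∃ j ∈ I, u j ≠ c j := by
        by_contra! h'
        exact D.huc (funext fun i => by
          by_cases hi : i ∈ I
          · exact h' i hi
          · exact mem_S.1 D.hu i hi)
      have h1 := sum_le_sum (s := I.erase j) (f := N) (g := fun _ => 2) fun i hi => hle i (mem_of_mem_erase hi)
      have h2 := add_sum_erase I N hj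
      have h3 : N j ≤ 1 := by
        have := hle j hj
        by_contra h'
        exact huj (h j hj (by omega)).2
      rw [sum_const, D.card_erase hj, smul_eq_mul] at h1
      omega
    · have h1 := sum_le_sum (s := I) (f := N) (g := fun _ => 1) fun i hi => by
        have := hle i hi
        by_contra h'
        have := (h i hi (by omega)).1; omega
      rw [sum_const, smul_eq_mul] at h1
      have := D.hm
      omega
  simp only [N] at hNj
  by_cases hcj : f c j
  · by_cases huj : f u j
    · exact D.lace_equal_of hdc hj hcj huj (fun h => hno j hj ⟨hcj, huj, h⟩) (hsep.imp_right Or.inr)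
    · have hwj : f w j := by by_contra hwj; simp [hcj, huj, hwj] at hNj
      exact D.swap.lace_equal_of hdc hj hcj hwj huj (hsep.imp_right Or.inl)
  · have huj : f u j := by by_contra huj; split_ifs at hNj <;> simp at hNj
    have hwj : f w j := by by_contra hwj; simp [hcj, huj, hwj] at hNj
    refine (Lace_congr D.hu).1 ((D.move hdc).swap.lace_equal_of D.du hj huj hwj hcj (hsep.imp_right fun h => Or.inl h.symm))

theorem sub_B_rm (hj : j ∈ I) (hwj : ¬ f w j) :
    Bl f (I.erase j) c j ⊆ insert c (insert (if u j = c j then u else flip j u)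
      (Bl (((f.rm c).rm u).rm w) (I.erase j) c j)) := by
  intro z hz
  rw [mem_Bl] at hz
  obtain ⟨hz, hzj⟩ := hz
  have hzc := ((mem_erase_iff hj).1 hz).2
  simp only [mem_insert, mem_Bl, rm_iff]
  by_cases h1 : z = c
  · exact Or.inl h1
  have h2 : flip j z ≠ c := by rintro rfl; simp at hzc
  have h3 : z ≠ w := by rintro rfl; exact hwj hzj
  have h4 : flip j z ≠ w := by rintro rfl; simp [hzj] at hwj
  by_cases h5 : z = u
  · subst h5; simp [hzc]
  by_cases h6 : flip j z = u
  · subst h6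
    have : flip j z j ≠ c j := by simp [hzc]
    simp [hzc]
  exact Or.inr (Or.inr ⟨hz, ⟨⟨⟨hzj, h1, h2⟩, h5, h6⟩, h3, h4⟩⟩)

/-- A direction with a fault at the base vertex and at exactly one of the two others. -/
theorem lace_pair (hj : j ∈ I) (hcj : f c j) (huj : f u j) (hwj : ¬ f w j) (hm7 : m ≤ 7)
    (h : w j = c j →
      E (((f.rm c).rm u).rm w) (I.erase j) (flip j c) = 0 ∧ (Bl (((f.rm c).rm u).rm w) (I.erase j) c j).card = 0 ∨
      u j = c j ∧ E (((f.rm c).rm u).rm w) (I.erase j) (flip j c) ≤ 2 ∧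
        (Bl (((f.rm c).rm u).rm w) (I.erase j) c j).card = 0 ∨
      u = flip j c ∧ E (((f.rm c).rm u).rm w) (I.erase j) (flip j c) = 0 ∧
        (Bl (((f.rm c).rm u).rm w) (I.erase j) c j).card ≤ 1) : Lace f I c := by
  by_cases hwc : w j ≠ c j
  · exact D.lace_M' hj (Or.inr (Or.inr hwc)) (fun _ => hcj) (fun _ => Or.inr huj) (fun h => absurd h hwc) fun _ => Or.inl huj
  push Not at hwc
  specialize h hwc
  have hm := D.hm
  have hB := card_le_card (D.sub_B_rm hj hwj)
  have i1 := card_insert_le c (insert (if u j = c j then u else flip j u) (Bl (((f.rm c).rm u).rm w) (I.erase j) c j))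
  have i2 := card_insert_le (if u j = c j then u else flip j u) (Bl (((f.rm c).rm u).rm w) (I.erase j) c j)
  have hB2 : (Bl f (I.erase j) c j).card ≤ 2 := by
    rcases h with h | h | h
    · omega
    · omega
    · have h3 : u j ≠ c j := by simp [h.1]
      rw [if_neg h3, h.1, flip_flip, insert_eq_of_mem (mem_insert_self _ _)] at hB
      have := card_insert_le c (Bl (((f.rm c).rm (flip j c)).rm w) (I.erase j) c j)
      rw [h.1] at h
      omega
  refine D.lace_third hj hcj huj hwj hwc hB2 ?_ (Or.inl hm7)
  have e1 : E (((f.rm c).rm u).rm w) (I.erase j) (flip j c) = E ((f.rm c).rm u) (I.erase j) (flip j c) :=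
    E_rm_of_notMem fun h => ((mem_erase_flip_iff hj).1 h).2 hwc
  have e2 : E (f.rm c) (I.erase j) (flip j c) = E f (I.erase j) (flip j c) :=
    E_rm_of_notMem fun h => ((mem_erase_flip_iff hj).1 h).2 rfl
  by_cases huc : u j = c j
  · have e3 : E ((f.rm c).rm u) (I.erase j) (flip j c) = E (f.rm c) (I.erase j) (flip j c) :=
      E_rm_of_notMem fun h => ((mem_erase_flip_iff hj).1 h).2 huc
    rcases h with h | h | h <;> omega
  · have e3 := E_rm (f := f.rm c) ((mem_erase_flip_iff hj).2 ⟨D.hu, huc⟩)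
    have e4 := d_rm_le (f := f) (v := c) (I := I.erase j) (z := u)
    have e5 := d_erase (f := f) (z := u) hj
    rw [if_pos huj] at e5
    have := D.du
    rcases h with h | h | h
    · omega
    · exact absurd h.1 huc
    · omega

theorem exists_pair (hdc : d f I c + 1 = m) :
    m ≤ (I.filter fun j => f c j ∧ f u j).card + 4 := by
  have h1 := card_union_add_card_inter (I.filter (f c)) (I.filter (f u))
  rw [← filter_and] at h1
  have h2 := card_le_card (union_subset (filter_subset (f c) I) (filter_subset (f u) I))
  have h3 : (I.filter (f c)).card = d f I c := rfl
  have h4 : (I.filter (f u)).card = d f I u := rfl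
  have := D.du; have := D.card
  omega

end Three
end HC

namespace HC

variable {n m : ℕ} {f : Flt n} {I J K : Finset (Fin n)} {b c u v w z x y a : V n} {i j k : Fin n}

theorem rm_comm : (f.rm u).rm w = (f.rm w).rm u := by
  simp only [Flt.rm, Flt.mk.injEq]
  funext z i
  exact propext ⟨fun h => ⟨⟨h.1.1, h.2⟩, h.1.2⟩, fun h => ⟨⟨h.1.1, h.2⟩, h.1.2⟩⟩

theorem Bl_eq_zero_of_E (hE : E f I c ≤ 2) (hz : z ∈ S I c) (hi : i ∈ I) (hf : f z i) (hj : j ∈ I) (hji : j ≠ i) :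
    (Bl f (I.erase j) c j).card = 0 := by
  have hs := E_split (f := f) (c := c) hj
  have hi' := mem_erase.2 ⟨hji.symm, hi⟩
  by_cases h : z j = c j
  · have := E_pos ((mem_erase_iff hj).2 ⟨hz, h⟩) hi' hf
    omega
  · have := E_pos ((mem_erase_flip_iff hj).2 ⟨hz, h⟩) hi' hf
    omega

theorem adj_sum_le_two : adj f I c u + adj f I c w + adj f I u w ≤ 2 := by
  have h1 := adj_le_one (f := f) (I := I) (v := c) (u := u)
  have h2 := adj_le_one (f := f) (I := I) (v := c) (u := w)
  have h3 := adj_le_one (f := f) (I := I) (v := u) (u := w)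
  by_contra h
  have g1 : par c ≠ par u := fun e => by have := adj_eq_zero_of_par (f := f) (I := I) e; omega
  have g2 : par c ≠ par w := fun e => by have := adj_eq_zero_of_par (f := f) (I := I) e; omega
  have g3 : par u ≠ par w := fun e => by have := adj_eq_zero_of_par (f := f) (I := I) e; omega
  revert g1 g2 g3
  cases par c <;> cases par u <;> cases par w <;> simp

theorem card_le_one_of_sub_pair {A : Finset (Fin n)} (h : A ⊆ {i, j}) (hj : j ∉ A) : A.card ≤ 1 := by
  rw [← card_singleton i]
  refine card_le_card fun k hk => ?_
  have := h hk
  simp only [mem_insert, mem_singleton] at this ⊢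
  rcases this with h1 | rfl
  · exact h1
  · exact absurd hk hj

namespace Three

variable (D : Three f I c m u w)
include D

theorem lace_star_far {i₁ i₂ : Fin n} (hdc : d f I c + 1 = m) (hm5 : m = 5) (hu : u = flip i₁ c) (hw : w = flip i₂ c)
    (h₁ : i₁ ∈ I) (hj : j ∈ I) (hcj : ¬ f c j) (huj : f u j) (hwj : f w j) (hc₁ : f c i₁) (hc₂ : f c i₂)
    (hE : E (((f.rm c).rm u).rm w) I c ≤ 2) (hB : (Bl (((f.rm c).rm u).rm w) (I.erase j) c j).card = 0)
    (h0 : E (((f.rm c).rm u).rm w) (I.erase i₁) c = 0) (hB1 : (Bl (((f.rm c).rm u).rm w) (I.erase i₁) c i₁).card = 0) :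
    Lace f I c := by
  have hj1 : i₁ ≠ j := by rintro rfl; exact hcj hc₁
  have hj2 : i₂ ≠ j := by rintro rfl; exact hcj hc₂
  have huc : u j = c j := by rw [hu, flip_other hj1.symm]
  have hwc : w j = c j := by rw [hw, flip_other hj2.symm]
  have hsub : Bl f (I.erase j) c j ⊆ {u, w} := by
    intro z hz
    by_contra hn
    simp only [mem_insert, mem_singleton, not_or] at hn
    rw [mem_Bl] at hz
    have hzc := ((mem_erase_iff hj).1 hz.1).2
    have hne : ∀ y : V n, y j = c j → flip j z ≠ y := by rintro y hy rfl; simp [hzc] at hy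
    have hzc' : z ≠ c := by rintro rfl; exact hcj hz.2
    exact not_Bl_iff (f := ((f.rm c).rm u).rm w) hz.1 (by rw [card_eq_zero.1 hB]; simp)
      ⟨⟨⟨hz.2, hzc', hne c rfl⟩, hn.1, hne u huc⟩, hn.2, hne w hwc⟩
  have hBl : (Bl f (I.erase j) c j).card ≤ 2 := (card_le_card hsub).trans card_le_two
  have hBl2 : 2 ≤ (Bl f (I.erase j) c j).card := by
    rw [← card_pair D.hwu.symm]
    refine card_le_card fun z hz => ?_
    simp only [mem_insert, mem_singleton] at hz
    rcases hz with rfl | rfl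
    · exact mem_Bl.2 ⟨(mem_erase_iff hj).2 ⟨D.hu, huc⟩, huj⟩
    · exact mem_Bl.2 ⟨(mem_erase_iff hj).2 ⟨D.hw, hwc⟩, hwj⟩
  obtain ⟨k, hk⟩ : (((I.filter (f c)).erase i₁).erase i₂).Nonempty := by
    have e1 := pred_card_le_card_erase (s := I.filter (f c)) (a := i₁)
    have e2 := pred_card_le_card_erase (s := (I.filter (f c)).erase i₁) (a := i₂)
    have : (I.filter (f c)).card = d f I c := rfl
    exact card_pos.1 (by omega)
  simp only [mem_erase, mem_filter] at hk
  obtain ⟨hk2, hk1, hkI, hck⟩ := hk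
  have hkj : k ≠ j := by rintro rfl; exact hcj hck
  have hkIj := mem_erase.2 ⟨hkj, hkI⟩
  have hbu : flip k c ≠ u := by rw [hu]; exact fun h => hk1 ((flip_dir_inj _ _ _).1 h)
  have hbw : flip k c ≠ w := by rw [hw]; exact fun h => hk2 ((flip_dir_inj _ _ _).1 h)
  have hb : flip k c ∈ S (I.erase j) c := (flip_mem hkIj).2 self_mem_S
  have nb : ¬ f (flip k c) j := not_Bl_iff hb fun h => by
    have := hsub h
    simp only [mem_insert, mem_singleton] at this
    exact this.elim hbu hbw
  have hbS : flip k c ∈ S (I.erase i₁) c := (flip_mem (mem_erase.2 ⟨hk1, hkI⟩)).2 self_mem_S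
  have hdb : d f I (flip k c) ≤ 1 := by
    have e1 := d_rm (f := f) (I := I) (flip_ne k c)
    have e2 := d_rm (f := f.rm c) (I := I) hbu
    have e3 := d_rm (f := (f.rm c).rm u) (I := I) hbw
    rw [adj_eq_zero_of_par (by simp [hu])] at e2
    rw [adj_eq_zero_of_par (by simp [hw])] at e3
    have e4 := adj_le_one (f := f) (I := I) (v := c) (u := flip k c)
    have e5 := d_erase (f := ((f.rm c).rm u).rm w) (z := flip k c) h₁
    rw [if_neg (not_Bl_iff hbS (by rw [card_eq_zero.1 hB1]; simp))] at e5
    have e6 := two_d_le (f := ((f.rm c).rm u).rm w) hbS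
    omega
  have hgd := D.gd_add hj nb
  have hs := E_split (f := f) (c := c) hj
  have hF := D.faults
  have hca := D.cap_add
  have hE1 : E f (I.erase j) (flip j c) ≤ 2 := by
    have hn : ∀ y : V n, y j = c j → y ∉ S (I.erase j) (flip j c) := fun y hy h => ((mem_erase_flip_iff hj).1 h).2 hy
    rw [← E_rm_of_notMem (hn c rfl), ← E_rm_of_notMem (hn u huc), ← E_rm_of_notMem (hn w hwc)]
    refine le_trans ?_ hE
    rw [← E_congr (f := ((f.rm c).rm u).rm w) ((flip_mem hj).2 self_mem_S)]
    exact E_mono (erase_subset _ _)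
  have hdet := D.det hj hkIj self_mem_S hck hcj nb (by omega) (Or.inl (by omega))
    (fun z hz h => Or.inr (Or.inl (D.tight (S_erase_sub hz) h))) fun z hz y hy hzy h1 h2 =>
      D.pairs (P := fun z y => (d f I z + 2 = m ∧ (f z j ∨ z = c ∨ z = flip k c)) ∨
        (d f I y + 2 = m ∧ (f y j ∨ y = c ∨ y = flip k c))) (fun _ _ h => h.symm) (Or.inr ⟨D.du, Or.inl huj⟩)
        (Or.inr ⟨D.dw, Or.inl hwj⟩) (Or.inl ⟨D.du, Or.inl huj⟩) (S_erase_sub hz) (S_erase_sub hy) hzy h1 h2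
  have hle := card_filter_le (Bl f (I.erase j) c j) fun z => par z = par (flip k c)
  exact hdet.lace_one_end (cond_of_few hb (by omega) (by omega)) (by omega)

theorem lace_star (hdc : d f I c + 1 = m) (hm7 : m ≤ 7) (hno : ∀ j ∈ I, ¬ (f c j ∧ f u j ∧ f w j)) {i₁ i₂ : Fin n}
    (hu : u = flip i₁ c) (hw : w = flip i₂ c) (h₁ : i₁ ∈ I) (h₂ : i₂ ∈ I) (hc₁ : f c i₁) (hc₂ : f c i₂)
    (hE : E (((f.rm c).rm u).rm w) I c = 2) : Lace f I c := by
  by_contra hL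
  have hE' : E (((f.rm c).rm w).rm u) I c = 2 := by rw [rm_comm, hE]
  have hu1 : f u i₁ := by rw [hu]; simpa using hc₁
  have hw2 : f w i₂ := by rw [hw]; simpa using hc₂
  have hw1 : ¬ f w i₁ := fun h => hno _ h₁ ⟨hc₁, hu1, h⟩
  have hu2 : ¬ f u i₂ := fun h => hno _ h₂ ⟨hc₂, h, hw2⟩
  obtain ⟨z, hz, i, hi, hg⟩ := exists_fault (f := ((f.rm c).rm u).rm w) (I := I) (b := c) (by omega)
  have hg' : (((f.rm c).rm w).rm u) z i := by rw [rm_comm]; exact hg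
  have hE1 : ∀ j ∈ I, ∀ g : Flt n, E g I c = 2 → E g (I.erase j) (flip j c) ≤ 2 := fun j hj g hg => by
    have := card_Bl_le (f := g) (c := c) hj; omega
  have hJu : ∀ j ∈ I, f c j → f u j → j = i₁ ∨ j = i := by
    intro j hj h1 h2
    by_contra! h
    exact hL (D.lace_pair hj h1 h2 (fun h3 => hno j hj ⟨h1, h2, h3⟩) hm7 fun _ =>
      Or.inr (Or.inl ⟨by rw [hu, flip_other h.1], hE1 j hj _ hE, Bl_eq_zero_of_E hE.le hz hi hg hj h.2⟩))
  have hJw : ∀ j ∈ I, f c j → f w j → j = i₂ ∨ j = i := by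
    intro j hj h1 h2
    by_contra! h
    exact hL (D.swap.lace_pair hj h1 h2 (fun h3 => hno j hj ⟨h1, h3, h2⟩) hm7 fun _ =>
      Or.inr (Or.inl ⟨by rw [hw, flip_other h.1], hE1 j hj _ hE', Bl_eq_zero_of_E hE'.le hz hi hg' hj h.2⟩))
  have hs1 := E_split (f := ((f.rm c).rm u).rm w) (c := c) h₁
  have hh1 : E (((f.rm c).rm u).rm w) (I.erase i₁) (flip i₁ c) ≠ 0 := fun h =>
    hL (D.lace_pair h₁ hc₁ hu1 hw1 hm7 fun _ => Or.inr (Or.inr ⟨hu, h, by omega⟩))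
  obtain ⟨e, he⟩ := E_even (f := ((f.rm c).rm u).rm w) (I := I.erase i₁) (b := flip i₁ c)
  have pu := D.exists_pair hdc
  have pw := D.swap.exists_pair hdc
  have hcu := card_filter_add_card_filter_not (s := I.filter (f u)) (f c)
  have hcw := card_filter_add_card_filter_not (s := I.filter (f w)) (f c)
  have hgc := D.filter_good c
  simp only [filter_filter] at hcu hcw
  simp only [and_comm (a := f.p c _)] at pu pw
  change _ = d f I u at hcu
  change _ = d f I w at hcw
  have hdu := D.du
  have hdw := D.dw
  have hm := D.hm
  have hun : (I.filter fun j => f u j ∧ ¬ f c j) ∪ (I.filter fun j => f w j ∧ ¬ f c j) ⊆ I.filter fun j => ¬ f c j := by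
    intro j; simp only [mem_union, mem_filter]; tauto
  have hun' := card_le_card hun
  have hui := card_union_add_card_inter (I.filter fun j => f u j ∧ ¬ f c j) (I.filter fun j => f w j ∧ ¬ f c j)
  have hsu : (I.filter fun j => f u j ∧ f c j) ⊆ {i₁, i} := fun j hj => by
    simp only [mem_filter] at hj; simpa using hJu j hj.1 hj.2.2 hj.2.1
  have hsw : (I.filter fun j => f w j ∧ f c j) ⊆ {i₂, i} := fun j hj => by
    simp only [mem_filter] at hj; simpa using hJw j hj.1 hj.2.2 hj.2.1
  have lu := (card_le_card hsu).trans card_le_two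
  have lw := (card_le_card hsw).trans card_le_two
  have lu' : (¬ f c i ∨ ¬ f u i) → (I.filter fun j => f u j ∧ f c j).card ≤ 1 := fun h =>
    card_le_one_of_sub_pair hsu (by simp only [mem_filter]; tauto)
  have lw' : (¬ f c i ∨ ¬ f w i) → (I.filter fun j => f w j ∧ f c j).card ≤ 1 := fun h =>
    card_le_one_of_sub_pair hsw (by simp only [mem_filter]; tauto)
  obtain ⟨j, hj, hji⟩ : ∃ j ∈ (I.filter fun j => f u j ∧ ¬ f c j) ∩ (I.filter fun j => f w j ∧ ¬ f c j), j ≠ i := by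
    by_cases hci : f c i
    · obtain ⟨j, hj⟩ : ((I.filter fun j => f u j ∧ ¬ f c j) ∩ (I.filter fun j => f w j ∧ ¬ f c j)).Nonempty := by
        refine card_pos.1 ?_
        by_cases hui : f u i
        · have := lw' (Or.inr fun h => hno i hi ⟨hci, hui, h⟩); omega
        · have := lu' (Or.inr hui); omega
      refine ⟨j, hj, ?_⟩
      rintro rfl
      simp only [mem_inter, mem_filter] at hj
      exact hj.1.2.2 hci
    · have := lu' (Or.inl hci)
      have := lw' (Or.inl hci)
      by_contra! h
      have := card_le_card (show _ ⊆ ({i} : Finset _) from fun j hj => mem_singleton.2 (h j hj))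
      rw [card_singleton] at this
      omega
  simp only [mem_inter, mem_filter] at hj
  have hm5 : m = 5 := by
    by_cases h : f c i ∧ f u i
    · have := lw' (Or.inr fun h' => hno i hi ⟨h.1, h.2, h'⟩); omega
    · have := lu' (by tauto); omega
  exact hL (D.lace_star_far hdc hm5 hu hw h₁ hj.1.1 hj.1.2.2 hj.1.2.1 hj.2.2.1 hc₁ hc₂ hE.le
    (Bl_eq_zero_of_E hE.le hz hi hg hj.1.1 hji) (by omega) (by omega))

/-- The third vertex of a path of faulty edges that does not start at its centre is separated. -/
theorem lace_path (hno : ∀ j ∈ I, ¬ (f c j ∧ f u j ∧ f w j)) (hm7 : m ≤ 7) (h1 : adj f I c u ≠ 0) (h2 : adj f I u w ≠ 0) :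
    Lace f I c := by
  obtain ⟨i, hi, hu, hci⟩ := exists_of_adj h1
  obtain ⟨k, hk, hw, huk⟩ := exists_of_adj h2
  have hui : f u i := by rw [hu]; simpa using hci
  have hik : i ≠ k := by rintro rfl; rw [hu, flip_flip] at hw; exact D.hwc hw
  refine D.lace_pair hi hci hui (fun h => hno i hi ⟨hci, hui, h⟩) hm7 fun h => ?_
  simp [hw, hu, flip_other hik] at h

theorem lace_tight (hdc : d f I c + 1 = m) (hm7 : m ≤ 7) (hno : ∀ j ∈ I, ¬ (f c j ∧ f u j ∧ f w j)) : Lace f I c := by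
  have h3 := E_rm3 (f := f) self_mem_S D.hu D.hw D.huc D.hwc D.hwu
  have hs := adj_sum_le_two (f := f) (I := I) (c := c) (u := u) (w := w)
  have hdu := D.du
  have hdw := D.dw
  have hF := D.faults
  have hm := D.hm
  have hcap : cap (m + 1) = 3 * m - 6 := by unfold cap; omega
  by_cases hE : E (((f.rm c).rm u).rm w) I c = 0
  · obtain ⟨j, hj⟩ := card_pos.1 (by have := D.exists_pair hdc; omega : 0 < (I.filter fun j => f c j ∧ f u j).card)
    simp only [mem_filter] at hj
    have := E_split (f := ((f.rm c).rm u).rm w) (c := c) hj.1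
    exact D.lace_pair hj.1 hj.2.1 hj.2.2 (fun h => hno j hj.1 ⟨hj.2.1, hj.2.2, h⟩) hm7 fun _ =>
      Or.inl ⟨by omega, by omega⟩
  obtain ⟨e, he⟩ := E_even (f := ((f.rm c).rm u).rm w) (I := I) (b := c)
  have h1 := adj_le_one (f := f) (I := I) (v := c) (u := u)
  have h2 := adj_le_one (f := f) (I := I) (v := c) (u := w)
  have h4 := adj_le_one (f := f) (I := I) (v := u) (u := w)
  by_cases hcu : adj f I c u = 0
  · exact D.swap.lace_path (fun j hj h => hno j hj ⟨h.1, h.2.2, h.2.1⟩) hm7 (by omega) (by rw [adj_comm]; omega)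
  by_cases hcw : adj f I c w = 0
  · exact D.lace_path hno hm7 hcu (by omega)
  obtain ⟨i₁, g1, g2, g3⟩ := exists_of_adj hcu
  obtain ⟨i₂, g4, g5, g6⟩ := exists_of_adj hcw
  exact D.lace_star hdc hm7 hno g2 g5 g1 g4 g3 g6 (by omega)

/-- Three vertices with many faults. -/
theorem lace (hstar : m = 8 → d f I c = 7 → E f I c = 38 → adj f I c u = 0 → adj f I c w = 0 → adj f I u w = 0 →
    Lace f I c) : Lace f I c := by
  by_cases hno : ∀ j ∈ I, ¬ (f c j ∧ f u j ∧ f w j)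
  · have hcov : I ⊆ (I.filter fun j => ¬ f c j) ∪ ((I.filter fun j => ¬ f u j) ∪ I.filter fun j => ¬ f w j) := by
      intro j hj
      have := hno j hj
      simp only [mem_union, mem_filter]; tauto
    have h1 := (card_le_card hcov).trans ((card_union_le _ _).trans (Nat.add_le_add_left (card_union_le _ _) _))
    have g1 := D.filter_good c
    have g2 := D.filter_good u
    have g3 := D.filter_good w
    have := D.du
    have := D.dw
    have := D.dc
    have := D.card
    have := D.deg c self_mem_S
    by_cases hdc : d f I c + 2 = m
    · exact D.lace_equal hdc (by omega) hno
    · exact D.lace_tight (by omega) (by omega) hno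
  · push Not at hno
    obtain ⟨j, hj, h1, h2, h3⟩ := hno
    exact D.lace_common hj h1 h2 h3 hstar

end Three
end HC

namespace HC

variable {n m : ℕ} {f : Flt n} {I J K : Finset (Fin n)} {b c u v w z x y a d' e : V n} {i j k : Fin n}

theorem flip_flip_ne {p q : Fin n} (h : p ≠ q) : (flip q (flip p x)) i ≠ x i ↔ i = p ∨ i = q := by
  by_cases h1 : i = q
  · subst h1; rw [flip_same, flip_other h.symm]; simp
  · rw [flip_other h1]
    by_cases h2 : i = p
    · subst h2; simp
    · rw [flip_other h2]; simp [h1, h2]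

/-- Two vertices have at most two common neighbours. -/
theorem not_three_common (hxy : x ≠ y) (hab : a ≠ b) (haz : a ≠ z) (hbz : b ≠ z) (h1 : adj f I x a ≠ 0) (h2 : adj f I x b ≠ 0)
    (h3 : adj f I x z ≠ 0) (h4 : adj f I a y ≠ 0) (h5 : adj f I b y ≠ 0) (h6 : adj f I z y ≠ 0) : False := by
  obtain ⟨i, -, rfl, -⟩ := exists_of_adj h1
  obtain ⟨j, -, rfl, -⟩ := exists_of_adj h2
  obtain ⟨k, -, rfl, -⟩ := exists_of_adj h3
  obtain ⟨p, -, g1, -⟩ := exists_of_adj h4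
  obtain ⟨q, -, g2, -⟩ := exists_of_adj h5
  obtain ⟨r, -, g3, -⟩ := exists_of_adj h6
  have hip : i ≠ p := by rintro rfl; exact hxy (by rw [g1, flip_flip])
  have hjq : j ≠ q := by rintro rfl; exact hxy (by rw [g2, flip_flip])
  have hkr : k ≠ r := by rintro rfl; exact hxy (by rw [g3, flip_flip])
  have e1 := (flip_flip_ne hip).1 (g1 ▸ g2 ▸ (flip_flip_ne (x := x) hjq).2 (Or.inl rfl))
  have e2 := (flip_flip_ne hip).1 (g1 ▸ g3 ▸ (flip_flip_ne (x := x) hkr).2 (Or.inl rfl))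
  have hij : i ≠ j := fun h => hab (h ▸ rfl)
  have hik : i ≠ k := fun h => haz (h ▸ rfl)
  have hjk : j ≠ k := fun h => hbz (h ▸ rfl)
  rcases e1 with e1 | e1
  · exact hij e1.symm
  rcases e2 with e2 | e2
  · exact hik e2.symm
  exact hjk (e1.trans e2.symm)

/-- Four vertices with many faults. -/
structure Four (f : Flt n) (I : Finset (Fin n)) (e : V n) (m : ℕ) (a b c d' : V n) : Prop extends Ctx f I e m where
  ha : a ∈ S I e
  hb : b ∈ S I e
  hc : c ∈ S I e
  hd : d' ∈ S I e
  hab : b ≠ a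
  hac : c ≠ a
  had : d' ≠ a
  hbc : c ≠ b
  hbd : d' ≠ b
  hcd : d' ≠ c
  da : m ≤ d f I a + 2
  db : m ≤ d f I b + 2
  dc : m ≤ d f I c + 2
  dd : m ≤ d f I d' + 2

namespace Four

theorem swap_ab (D : Four f I e m a b c d') : Four f I e m b a c d' :=
  ⟨D.toCtx, D.hb, D.ha, D.hc, D.hd, D.hab.symm, D.hbc, D.hbd, D.hac, D.had, D.hcd, D.db, D.da, D.dc, D.dd⟩

theorem swap_bc (D : Four f I e m a b c d') : Four f I e m a c b d' :=
  ⟨D.toCtx, D.ha, D.hc, D.hb, D.hd, D.hac, D.hab, D.had, D.hbc.symm, D.hcd, D.hbd, D.da, D.dc, D.db, D.dd⟩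

theorem swap_cd (D : Four f I e m a b c d') : Four f I e m a b d' c :=
  ⟨D.toCtx, D.ha, D.hb, D.hd, D.hc, D.hab, D.had, D.hac, D.hbd, D.hbc, D.hcd.symm, D.da, D.db, D.dd, D.dc⟩

variable (D : Four f I e m a b c d')
include D

theorem count : E f I e + 2 * (adj f I a b + adj f I a c + adj f I a d' + (adj f I b c + adj f I b d' + adj f I c d')) =
    E ((((f.rm a).rm b).rm c).rm d') I e + 2 * d f I a + 2 * d f I b + 2 * d f I c + 2 * d f I d' :=
  E_rm4 D.ha D.hb D.hc D.hd D.hab D.hac D.hbc D.had D.hbd D.hcd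

theorem small_le (hz : z ∈ S I e) (h1 : z ≠ a) (h2 : z ≠ b) (h3 : z ≠ c) (h4 : z ≠ d') :
    2 * d f I z ≤ E ((((f.rm a).rm b).rm c).rm d') I e + 2 * (adj f I a z + adj f I b z + adj f I c z + adj f I d' z) := by
  have e0 := two_d_le (f := (((f.rm a).rm b).rm c).rm d') hz
  have e1 := d_rm (f := f) (I := I) h1
  have e2 := d_rm (f := f.rm a) (I := I) h2
  have e3 := d_rm (f := (f.rm a).rm b) (I := I) h3
  have e4 := d_rm (f := ((f.rm a).rm b).rm c) (I := I) h4
  rw [adj_rm D.hab h1] at e2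
  rw [adj_rm D.hbc h2, adj_rm D.hac h1] at e3
  rw [adj_rm D.hcd h3, adj_rm D.hbd h2, adj_rm D.had h1] at e4
  omega

/-- Four vertices on a path of faulty edges. -/
theorem lace_path (hC : ∀ z ∈ S I e, m ≤ d f I z + 2 → z = a ∨ z = b ∨ z = c ∨ z = d')
    (h1 : adj f I b a ≠ 0) (h2 : adj f I b c ≠ 0) (h3 : adj f I c d' ≠ 0)
    (ht : ∀ z ∈ S I e, d f I z + 1 = m → adj f I a d' ≠ 0) : Lace f I e := by
  obtain ⟨i, hi, ha, fi⟩ := exists_of_adj h1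
  obtain ⟨j, hj, hc, fj⟩ := exists_of_adj h2
  obtain ⟨k, hk, hd, fk⟩ := exists_of_adj h3
  have hij : i ≠ j := by rintro rfl; exact D.hac (hc.trans ha.symm)
  have hjk : j ≠ k := by rintro rfl; exact D.hbd (by rw [hd, hc, flip_flip])
  have hcj : f c j := by rw [hc]; simpa using fj
  have hsq : ∀ z ∈ S I e, d f I z + 1 = m → f a j ∧ f d' j := by
    intro z hz h
    obtain ⟨l, hl, hd', fl⟩ := exists_of_adj (ht z hz h)
    have hil : i ≠ l := by rintro rfl; exact D.hbd (by rw [hd', ha, flip_flip])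
    have : l = j := by
      rw [ha] at hd'; rw [hc] at hd
      rcases (flip_flip_ne (x := b) hil).1 (hd' ▸ hd ▸ (flip_flip_ne (x := b) hjk).2 (Or.inl rfl)) with h | h
      · exact absurd h.symm hij
      · exact h.symm
    subst this
    exact ⟨fl, by rw [hd']; simpa using fl⟩
  have haj : a j = b j := by rw [ha, flip_other hij.symm]
  have hcj' : c j ≠ b j := by rw [hc]; simp
  have hdj : d' j ≠ b j := by rw [hd, flip_other hjk]; exact hcj'
  have hpair : ∀ {x y}, x ∈ S I e → m ≤ d f I x + 2 → f x j → m ≤ d f I y + 2 → x ≠ y → y ∈ S I e →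
      (∀ z ∈ S I e, d f I z + 1 = m → f y j) → (d f I x + 2 = m ∧ f x j) ∨ (d f I y + 2 = m ∧ f y j) := by
    intro x y hx dx fx dy hxy hy hs
    have := D.deg x hx
    have := D.deg y hy
    by_cases hx2 : d f I x + 2 = m
    · exact Or.inl ⟨hx2, fx⟩
    · refine Or.inr ⟨?_, hs x hx (by omega)⟩
      by_contra hy2
      exact hxy (D.uniq x hx y hy (by omega) (by omega))
  have D' := D.toCtx.move D.hb
  refine (Lace_congr D.hb).1 (D'.lace_M hj ?_ (D'.opp_le hj self_mem_S D.db) ?_ ?_)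
  · have := D.toCtx.opp_le hj D.hc D.dc
    rwa [hc, flip_flip] at this
  · rw [S_eq D.hb]
    intro z hz h
    rcases hC z hz (by omega) with rfl | rfl | rfl | rfl
    exacts [(hsq _ hz h).1, fj, hcj, (hsq _ hz h).2]
  · rw [S_eq D.hb]
    intro z hz y hy hzy hj' hz2 hy2
    have nac : a j ≠ c j := haj.trans_ne hcj'.symm
    have nad : a j ≠ d' j := haj.trans_ne hdj.symm
    have pab := hpair D.hb D.db fj D.da D.hab D.ha fun z hz h => (hsq z hz h).1
    have pcd := hpair D.hc D.dc hcj D.dd D.hcd.symm D.hd fun z hz h => (hsq z hz h).2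
    rcases hC z hz hz2 with rfl | rfl | rfl | rfl <;> rcases hC y hy hy2 with rfl | rfl | rfl | rfl <;>
      first
      | exact absurd rfl hzy
      | exact pab
      | exact pab.symm
      | exact pcd
      | exact pcd.symm
      | exact absurd hj' nac
      | exact absurd hj'.symm nac
      | exact absurd hj' nad
      | exact absurd hj'.symm nad
      | exact absurd hj' hcj'
      | exact absurd hj'.symm hcj'
      | exact absurd hj' hdj
      | exact absurd hj'.symm hdj

theorem lace_even (h1 : par a = par b) (h2 : par c = par d') (h3 : par a ≠ par c) : Lace f I e := by
  have hs := D.count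
  rw [adj_eq_zero_of_par h1, adj_eq_zero_of_par h2] at hs
  have g1 := adj_le_one (f := f) (I := I) (v := a) (u := c)
  have g2 := adj_le_one (f := f) (I := I) (v := a) (u := d')
  have g3 := adj_le_one (f := f) (I := I) (v := b) (u := c)
  have g4 := adj_le_one (f := f) (I := I) (v := b) (u := d')
  have hF := D.faults
  have hm := D.hm
  have := D.da
  have := D.db
  have := D.dc
  have := D.dd
  unfold cap at hF
  have hC : ∀ z ∈ S I e, m ≤ d f I z + 2 → z = a ∨ z = b ∨ z = c ∨ z = d' := by
    intro z hz hzm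
    by_contra! h
    obtain ⟨k1, k2, k3, k4⟩ := h
    have hle := D.small_le hz k1 k2 k3 k4
    have l1 := adj_le_one (f := f) (I := I) (v := a) (u := z)
    have l2 := adj_le_one (f := f) (I := I) (v := b) (u := z)
    have l3 := adj_le_one (f := f) (I := I) (v := c) (u := z)
    have l4 := adj_le_one (f := f) (I := I) (v := d') (u := z)
    by_cases hp : par a = par z
    · rw [adj_eq_zero_of_par hp, adj_eq_zero_of_par (h1.symm.trans hp)] at hle
      refine not_three_common (f := f) (I := I) D.hcd.symm D.hab.symm k1.symm k2.symm ?_ ?_ ?_ ?_ ?_ ?_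
      all_goals first | omega | (rw [adj_comm]; omega)
    · have hp' : par c = par z := by
        revert hp h3; cases par a <;> cases par c <;> cases par z <;> simp
      rw [adj_eq_zero_of_par hp', adj_eq_zero_of_par (h2.symm.trans hp')] at hle
      refine not_three_common (f := f) (I := I) D.hab.symm D.hcd.symm k3.symm k4.symm ?_ ?_ ?_ ?_ ?_ ?_
      all_goals first | omega | (rw [adj_comm]; omega)
  have ht : ∀ z ∈ S I e, d f I z + 1 = m → adj f I a c ≠ 0 ∧ adj f I a d' ≠ 0 ∧ adj f I b c ≠ 0 ∧ adj f I b d' ≠ 0 := by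
    intro z hz h
    rcases hC z hz (by omega) with rfl | rfl | rfl | rfl <;> omega
  have c1 := adj_comm (f := f) (I := I) (v := a) (u := c)
  have c2 := adj_comm (f := f) (I := I) (v := a) (u := d')
  have c3 := adj_comm (f := f) (I := I) (v := b) (u := c)
  have c4 := adj_comm (f := f) (I := I) (v := b) (u := d')
  by_cases n1 : adj f I a c = 0
  · exact D.swap_cd.swap_bc.lace_path (fun z hz h => by rcases hC z hz h with h | h | h | h <;> simp [h]) (by omega)
      (by omega) (by omega) fun z hz h => (ht z hz h).1
  by_cases n2 : adj f I a d' = 0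
  · exact D.swap_bc.lace_path (fun z hz h => by rcases hC z hz h with h | h | h | h <;> simp [h]) (by omega)
      (by omega) (by omega) fun z hz h => (ht z hz h).2.1
  by_cases n3 : adj f I b c = 0
  · exact D.swap_ab.swap_cd.swap_bc.lace_path (fun z hz h => by rcases hC z hz h with h | h | h | h <;> simp [h])
      (by omega) (by omega) (by omega) fun z hz h => (ht z hz h).2.2.1
  exact D.swap_ab.swap_bc.lace_path (fun z hz h => by rcases hC z hz h with h | h | h | h <;> simp [h]) (by omega)
    (by omega) (by omega) fun z hz h => (ht z hz h).2.2.2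

theorem lace_odd (h1 : par b ≠ par a) (h2 : par c ≠ par a) (h3 : par d' ≠ par a) : Lace f I e := by
  have p1 : par b = par c := by revert h1 h2; cases par b <;> cases par c <;> cases par a <;> simp
  have p2 : par b = par d' := by revert h1 h3; cases par b <;> cases par d' <;> cases par a <;> simp
  have hs := D.count
  rw [adj_eq_zero_of_par p1, adj_eq_zero_of_par p2, adj_eq_zero_of_par (p1.symm.trans p2)] at hs
  have g1 := adj_le_one (f := f) (I := I) (v := a) (u := b)
  have g2 := adj_le_one (f := f) (I := I) (v := a) (u := c)
  have g3 := adj_le_one (f := f) (I := I) (v := a) (u := d')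
  have hF := D.faults
  have hm := D.hm
  have := D.da
  have := D.db
  have := D.dc
  have := D.dd
  have hm5 : m = 5 := by unfold cap at hF; omega
  have hcap : cap (m + 1) = 9 ∧ cap m = 6 := by subst hm5; decide
  rw [hcap.1] at hF
  have hC : ∀ z ∈ S I e, m ≤ d f I z + 2 → ∀ p : V n → Prop, p a → p b → p c → p d' → p z := by
    intro z hz hzm p pa pb pc pd
    by_contra! h
    have k1 : z ≠ a := fun e => h (e ▸ pa)
    have k2 : z ≠ b := fun e => h (e ▸ pb)
    have k3 : z ≠ c := fun e => h (e ▸ pc)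
    have k4 : z ≠ d' := fun e => h (e ▸ pd)
    have hle := D.small_le hz k1 k2 k3 k4
    have l1 := adj_le_one (f := f) (I := I) (v := a) (u := z)
    have l2 := adj_le_one (f := f) (I := I) (v := b) (u := z)
    have l3 := adj_le_one (f := f) (I := I) (v := c) (u := z)
    have l4 := adj_le_one (f := f) (I := I) (v := d') (u := z)
    by_cases hp : par a = par z
    · rw [adj_eq_zero_of_par hp] at hle
      refine not_three_common (f := f) (I := I) k1.symm D.hbc.symm D.hbd.symm D.hcd.symm ?_ ?_ ?_ ?_ ?_ ?_ <;> omega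
    · have hp' : par b = par z := by
        revert hp h1; cases par a <;> cases par b <;> cases par z <;> simp
      rw [adj_eq_zero_of_par hp', adj_eq_zero_of_par (p1.symm.trans hp'), adj_eq_zero_of_par (p2.symm.trans hp')] at hle
      omega
  obtain ⟨j, hj, hb, fj⟩ := exists_of_adj (show adj f I a b ≠ 0 by omega)
  obtain ⟨k, hk, hc, fk⟩ := exists_of_adj (show adj f I a c ≠ 0 by omega)
  obtain ⟨l, hl, hd, fl⟩ := exists_of_adj (show adj f I a d' ≠ 0 by omega)
  have hjk : j ≠ k := by rintro rfl; exact D.hbc (hc.trans hb.symm)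
  have hjl : j ≠ l := by rintro rfl; exact D.hbd (hd.trans hb.symm)
  have hkl : k ≠ l := by rintro rfl; exact D.hcd (hd.trans hc.symm)
  have hcj : c j = a j := by rw [hc, flip_other hjk]
  have hdj : d' j = a j := by rw [hd, flip_other hjl]
  have hbj : b j ≠ a j := by rw [hb]; simp
  have bj : f b j := by rw [hb]; simpa using fj
  refine (Lace_congr D.ha).1 ?_
  have D' := D.toCtx.move D.ha
  have ht : ∀ z ∈ S I a, d f I z + 1 ≠ m := by
    intro z hz; rw [S_eq D.ha] at hz
    exact fun h => hC z hz (by omega) (fun z => d f I z + 1 ≠ m) (by omega) (by omega) (by omega) (by omega) h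
  have hC0 : ∀ z ∈ S I a, z j = a j → m ≤ d f I z + 2 → z = a ∨ z = c ∨ z = d' := by
    intro z hz hzj h; rw [S_eq D.ha] at hz
    exact hC z hz h (fun z => z j = a j → z = a ∨ z = c ∨ z = d') (by simp) (fun h => absurd h hbj) (by simp) (by simp) hzj
  have hC1 : ∀ z ∈ S I a, z j ≠ a j → m ≤ d f I z + 2 → z = b := by
    intro z hz hzj h; rw [S_eq D.ha] at hz
    exact hC z hz h (fun z => z j ≠ a j → z = b) (by simp) (by simp) (by simp [hcj]) (by simp [hdj]) hzj
  have hE0 : E f (I.erase j) a ≤ 2 * cap m := by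
    have := D.toCtx.opp_le hj D.hb D.db
    rwa [hb, flip_flip] at this
  by_cases hM : f c j ∨ f d' j
  · refine D'.lace_M hj hE0 (D'.opp_le hj self_mem_S D.da) (fun z hz h => absurd h (ht z hz)) ?_
    intro z hz y hy hzy hj' hz2 hy2
    by_cases hzj : z j = a j
    · rcases hC0 z hz hzj hz2 with rfl | rfl | rfl <;> rcases hC0 y hy (hj'.symm.trans hzj) hy2 with rfl | rfl | rfl <;>
        first
        | exact absurd rfl hzy
        | exact Or.inl ⟨by omega, fj⟩
        | exact Or.inr ⟨by omega, fj⟩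
        | exact hM.imp (fun h => ⟨by omega, h⟩) fun h => ⟨by omega, h⟩
        | exact hM.symm.imp (fun h => ⟨by omega, h⟩) fun h => ⟨by omega, h⟩
    · exact absurd ((hC1 z hz hzj hz2).trans (hC1 y hy (hj' ▸ hzj) hy2).symm) hzy
  rw [not_or] at hM
  have haS : a ∈ S (I.erase j) a := self_mem_S
  have hcS : c ∈ S (I.erase j) a := (mem_erase_iff hj).2 ⟨by rw [S_eq D.ha]; exact D.hc, hcj⟩
  have hdS : d' ∈ S (I.erase j) a := (mem_erase_iff hj).2 ⟨by rw [S_eq D.ha]; exact D.hd, hdj⟩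
  have hbS : b ∈ S (I.erase j) (flip j a) := (mem_erase_flip_iff hj).2 ⟨by rw [S_eq D.ha]; exact D.hb, hbj⟩
  have e3 := E_rm3 (f := f) haS hcS hdS D.hac D.had D.hcd
  rw [adj_eq_zero_of_par (p1.symm.trans p2)] at e3
  have l1 := adj_le_one (f := f) (I := I.erase j) (v := a) (u := c)
  have l2 := adj_le_one (f := f) (I := I.erase j) (v := a) (u := d')
  have da := d_erase (f := f) (z := a) hj
  have db := d_erase (f := f) (z := b) hj
  have dc := d_erase (f := f) (z := c) hj
  have dd := d_erase (f := f) (z := d') hj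
  rw [if_pos fj] at da
  rw [if_pos bj] at db
  rw [if_neg hM.1] at dc
  rw [if_neg hM.2] at dd
  have eb := two_d_le (f := f) hbS
  have hsp := E_split (f := f) (c := a) hj
  rw [E_congr D.ha] at hsp
  have haB : a ∈ Bl f (I.erase j) a j := mem_Bl.2 ⟨haS, fj⟩
  have hB := card_pos.2 ⟨a, haB⟩
  obtain ⟨i, hi⟩ : ((I.filter (f c)).erase k).Nonempty := by
    have := pred_card_le_card_erase (s := I.filter (f c)) (a := k)
    have : (I.filter (f c)).card = d f I c := rfl
    exact card_pos.1 (by omega)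
  simp only [mem_erase, mem_filter] at hi
  obtain ⟨hik, hiI, fci⟩ := hi
  have hij : i ≠ j := by rintro rfl; exact hM.1 fci
  have hiIj := mem_erase.2 ⟨hij, hiI⟩
  have hbS' := (flip_mem hiIj).2 hcS
  have nb : ¬ f (flip i c) j := fun h => by
    have := card_le_one.1 (by omega : (Bl f (I.erase j) a j).card ≤ 1) _ (mem_Bl.2 ⟨hbS', h⟩) _ haB
    rw [hc] at this
    exact hik ((flip_dir_inj _ _ _).1 (flip_eq_iff.1 this).symm)
  have hdb : d f I (flip i c) + 3 ≤ m := by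
    by_contra h
    rcases hC0 _ (S_erase_sub hbS') ((mem_erase_iff hj).1 hbS').2 (by omega) with h | h | h
    · exact nb (h ▸ fj)
    · exact flip_ne i c h
    · have := congrArg par h; rw [← p2, p1] at this; simp at this
  refine D'.lace_P hj hiIj hcS fci hM.1 nb (by omega) (Or.inl (by omega))
    (fun z hz h => absurd h (ht z (S_erase_sub hz))) ?_ (by omega) (by omega) (by omega)
  intro z hz y hy hzy hz2 hy2
  rcases hC0 z (S_erase_sub hz) ((mem_erase_iff hj).1 hz).2 hz2 with rfl | rfl | rfl <;>
    rcases hC0 y (S_erase_sub hy) ((mem_erase_iff hj).1 hy).2 hy2 with rfl | rfl | rfl <;>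
      first
      | exact absurd rfl hzy
      | exact Or.inl ⟨by omega, Or.inl fj⟩
      | exact Or.inr ⟨by omega, Or.inl fj⟩
      | exact Or.inl ⟨by omega, Or.inr (Or.inl rfl)⟩
      | exact Or.inr ⟨by omega, Or.inr (Or.inl rfl)⟩

theorem lace : Lace f I e := by
  by_cases h1 : par a = par b <;> by_cases h2 : par a = par c <;> by_cases h3 : par a = par d'
  · have hs := D.count
    rw [adj_eq_zero_of_par h1, adj_eq_zero_of_par h2, adj_eq_zero_of_par h3, adj_eq_zero_of_par (h1.symm.trans h2),
      adj_eq_zero_of_par (h1.symm.trans h3), adj_eq_zero_of_par (h2.symm.trans h3)] at hs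
    have := D.faults
    have := D.hm
    have := D.da
    have := D.db
    have := D.dc
    have := D.dd
    unfold cap at *
    omega
  · exact D.swap_cd.swap_bc.swap_ab.lace_odd h3 (h1 ▸ h3) (h2 ▸ h3)
  · exact D.swap_bc.swap_ab.lace_odd h2 (h1 ▸ h2) (h3 ▸ h2)
  · exact D.lace_even h1 (by revert h2 h3; cases par a <;> cases par c <;> cases par d' <;> simp) h2
  · exact D.swap_ab.lace_odd h1 (h2 ▸ h1) (h3 ▸ h1)
  · exact D.swap_bc.lace_even h2 (by revert h1 h3; cases par a <;> cases par b <;> cases par d' <;> simp) h1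
  · exact D.swap_cd.swap_bc.lace_even h3 (by revert h1 h2; cases par a <;> cases par b <;> cases par c <;> simp) h1
  · exact D.lace_odd (Ne.symm h1) (Ne.symm h2) (Ne.symm h3)

end Four
end HC

namespace HC
variable {n m : ℕ} {f : Flt n} {I J K : Finset (Fin n)} {b c u v w z x y a : V n} {i j k : Fin n}

theorem four_split (hI : I.card = 4) (hj : j ∈ I) (h0 : E f (I.erase j) c ≤ 2) (h1 : E f (I.erase j) (flip j c) ≤ 2)
    (hE : E f I c ≤ 6) : Lace f I c := by
  have hc : (I.erase j).card = 3 := by rw [card_erase_of_mem hj, hI]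
  have := E_split (f := f) (c := c) hj
  have hne : (I.erase j).Nonempty := card_pos.1 (by omega)
  refine lace_split hj (lace_of_few hne (by omega)) (lace_of_few hne (by omega)) ?_
  rw [hc]; omega

theorem four_clean (hI : I.card = 4) (hj : j ∈ I) (h0 : E f (I.erase j) c = 4) (h1 : E f (I.erase j) (flip j c) = 0)
    (hE : E f I c = 6) (hd : ∀ z ∈ S (I.erase j) c, d f (I.erase j) z ≤ 1) : Lace f I c := by
  have hc : (I.erase j).card = 3 := by rw [card_erase_of_mem hj, hI]
  have hB : (Bl f (I.erase j) c j).card = 1 := by have := E_split (f := f) (c := c) hj; omega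
  have hsum : ∑ z ∈ Bl f (I.erase j) c j, d f (I.erase j) z ≤ 1 := by
    refine (sum_le_card_nsmul _ _ 1 fun z hz => hd z (Bl_subset hz)).trans ?_
    simp [hB]
  obtain ⟨a, ha, i, hi, fab, na, nb⟩ := exists_fault_avoid (f := f) (Bl_subset (f := f) (j := j)) (by rw [h0]; omega)
  have hb := (flip_mem hi).2 ha
  have hne : (I.erase j).Nonempty := ⟨i, hi⟩
  have hu := E_un ha hi fab
  have ga := gd_add_d (f := f) (J := I.erase j) (a := a)
  have gb := gd_add_d (f := f) (J := I.erase j) (a := flip i a)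
  have da := hd a ha
  have db := hd _ hb
  refine (Det.of_two hj hi ha fab (not_Bl_iff ha na) (not_Bl_iff hb nb) (lace_of_few hne (by omega))
    (lace_of_few hne (by omega)) (twoAll_of_few (by omega) (by omega)) (hyp_of_few (by omega) (by omega))
    (by rw [hB, hc]; norm_num)).lace_clean ?_ ?_ ?_ ?_ ?_ <;> omega

/-- A vertex with two faults in a `4`-cube with three faults. -/
theorem four_deg_two (hI : I.card = 4) (ha : a ∈ S I c) (hda : d f I a = 2) (hE : E f I c = 6) (hd : ∀ z ∈ S I c, d f I z ≤ 2) :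
    Lace f I c := by
  obtain ⟨j, k, hjk, hs⟩ := card_eq_two.1 (show (I.filter (f a)).card = 2 from hda)
  have hj : j ∈ I ∧ f a j := by rw [← mem_filter, hs]; simp
  have hk : k ∈ I ∧ f a k := by rw [← mem_filter, hs]; simp
  rw [← S_eq ha] at hd
  rw [← E_congr ha] at hE
  rw [← Lace_congr ha]
  clear hs ha
  have half : ∀ {i l : Fin n}, i ∈ I → f a i → l ∈ I → f a l → l ≠ i →
      E f (I.erase i) a + E f (I.erase i) (flip i a) ≤ 4 ∧ 2 ≤ E f (I.erase i) a := by
    intro i l hi fi hl fl hil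
    have := E_split (f := f) (c := a) hi
    have := card_pos.2 ⟨a, mem_Bl.2 ⟨self_mem_S (I := I.erase i), fi⟩⟩
    have := E_pos self_mem_S (mem_erase.2 ⟨hil, hl⟩) fl
    omega
  have hkj := mem_erase.2 ⟨hjk.symm, hk.1⟩
  have h1 := half hj.1 hj.2 hk.1 hk.2 hjk.symm
  obtain ⟨p, hp⟩ := E_even (f := f) (I := I.erase j) (b := a)
  obtain ⟨q, hq⟩ := E_even (f := f) (I := I.erase j) (b := flip j a)
  by_cases h0 : E f (I.erase j) a ≤ 2
  · exact four_split hI hj.1 h0 (by omega) hE.le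
  by_cases hall : ∀ z ∈ S (I.erase j) a, d f (I.erase j) z ≤ 1
  · exact four_clean hI hj.1 (by omega) (by omega) hE hall
  push Not at hall
  obtain ⟨z, hz, dz⟩ := hall
  have hr := E_rm (f := f) hz
  have fz : z = a ∨ flip k a = z := by
    by_contra h
    push Not at h
    exact not_fault_of_E (by omega) self_mem_S hkj (rm_iff.2 ⟨hk.2, h.1.symm, h.2⟩)
  have hdz := d_erase (f := f) (z := z) hj.1
  have hdz2 := hd z (S_erase_sub hz)
  rcases fz with rfl | rfl
  · rw [if_pos hj.2] at hdz; omega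
  obtain ⟨l, hl⟩ : (((I.erase j).filter (f (flip k a))).erase k).Nonempty := by
    have := pred_card_le_card_erase (s := (I.erase j).filter (f (flip k a))) (a := k)
    have : ((I.erase j).filter (f (flip k a))).card = d f (I.erase j) (flip k a) := rfl
    exact card_pos.1 (by omega)
  simp only [mem_erase, mem_filter] at hl
  have h2 := half hk.1 hk.2 hj.1 hj.2 hjk
  have := E_pos (b := flip k a) self_mem_S (mem_erase.2 ⟨hl.1, hl.2.1.2⟩) hl.2.2
  exact four_split hI hk.1 (by omega) (by omega) hE.le

theorem tol_four : Tol n 4 := by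
  intro f I b hI hd _ hE
  replace hE : E f I b ≤ 6 := hE
  by_cases h4 : E f I b ≤ 4
  · exact lace_of_few (card_pos.1 (by omega)) (by omega)
  have hE6 : E f I b = 6 := by
    obtain ⟨p, hp⟩ := E_even (f := f) (I := I) (b := b)
    omega
  by_cases hall : ∀ z ∈ S I b, d f I z ≤ 1
  swap
  · push Not at hall
    obtain ⟨a, ha, da⟩ := hall
    exact four_deg_two hI ha (by have := hd a ha; omega) hE6 fun z hz => by have := hd z hz; omega
  obtain ⟨a, ha, j, hj, fj⟩ := exists_fault (f := f) (I := I) (b := b) (by omega)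
  have hone : ∀ c ∈ S I b, ∀ z ∈ S (I.erase j) c, d f (I.erase j) z ≤ 1 := fun c hc z hz => by
    have := hall z (by rw [← S_eq hc]; exact S_erase_sub hz)
    have := d_erase (f := f) (z := z) hj
    omega
  have hfa := (flip_mem hj).2 ha
  obtain ⟨p, hp⟩ := E_even (f := f) (I := I.erase j) (b := a)
  obtain ⟨q, hq⟩ := E_even (f := f) (I := I.erase j) (b := flip j a)
  have hs := E_split (f := f) (c := a) hj
  have := card_pos.2 ⟨a, mem_Bl.2 ⟨self_mem_S (I := I.erase j), fj⟩⟩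
  rw [E_congr ha] at hs
  by_cases h0 : E f (I.erase j) a ≤ 2
  · by_cases h1 : E f (I.erase j) (flip j a) ≤ 2
    · rw [← Lace_congr ha]
      exact four_split hI hj h0 h1 (by rw [E_congr ha]; omega)
    · rw [← Lace_congr hfa]
      exact four_clean hI hj (by omega) (by rw [flip_flip]; omega) (by rw [E_congr hfa]; omega) (hone _ hfa)
  · rw [← Lace_congr ha]
    exact four_clean hI hj (by omega) (by omega) (by rw [E_congr ha]; omega) (hone _ ha)

theorem five_split (hI : I.card = 5) (hj : j ∈ I) (h0 : E f (I.erase j) c ≤ 6) (h1 : E f (I.erase j) (flip j c) ≤ 6)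
    (hd : ∀ z ∈ S I c, d f I z ≤ 2 ∨ d f I z = 3 ∧ f z j) (hE : E f I c ≤ 12) : Lace f I c := by
  have hc : (I.erase j).card = 4 := by rw [card_erase_of_mem hj, hI]
  have hL : ∀ b ∈ S I c, E f (I.erase j) b ≤ 6 → Lace f (I.erase j) b := fun b hb h =>
    tol_four f _ b hc (fun z hz => by
      have h1 := hd z (by rw [← S_eq hb]; exact S_erase_sub hz)
      have h2 := d_erase (f := f) (z := z) hj
      rcases h1 with h1 | ⟨h1, h3⟩
      · omega
      · rw [if_pos h3] at h2; omega) (fun h => absurd rfl h) h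
  have := E_split (f := f) (c := c) hj
  refine lace_split hj (hL c self_mem_S h0) (hL _ ((flip_mem hj).2 self_mem_S) h1) ?_
  rw [hc]; omega

theorem five_un (hI : I.card = 5) (hj : j ∈ I) (h0 : E f (I.erase j) c = 8)
    (hd : ∀ z ∈ S I c, d f I z ≤ 2 ∨ d f I z = 3 ∧ f z j) (ha : a ∈ S (I.erase j) c) (hi : i ∈ I.erase j) (fab : f a i) :
    Lace (f.un a i) (I.erase j) c := by
  have hc : (I.erase j).card = 4 := by rw [card_erase_of_mem hj, hI]
  refine tol_four _ _ c hc (fun z hz => ?_) (fun h => absurd rfl h) (show _ ≤ 6 by have := E_un ha hi fab; omega)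
  have h1 := hd z (S_erase_sub hz)
  have h2 := d_erase (f := f) (z := z) hj
  have h3 := un_rm_le_d (f := f) (a := a) (i := i) (I := I.erase j) (z := z)
  rcases h1 with h1 | ⟨h1, h4⟩
  · omega
  · rw [if_pos h4] at h2; omega

theorem five_det (hI : I.card = 5) (hj : j ∈ I) (h0 : E f (I.erase j) c = 8) (h1 : E f (I.erase j) (flip j c) ≤ 2)
    (hB : (Bl f (I.erase j) c j).card ≤ 2)
    (hd : ∀ z ∈ S I c, d f I z ≤ 2 ∨ d f I z = 3 ∧ f z j) (ha : a ∈ S (I.erase j) c) (hi : i ∈ I.erase j) (fab : f a i)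
    (na : ¬ f a j) (nb : ¬ f (flip i a) j) : Det f I c j i a (flip i a) := by
  have hc : (I.erase j).card = 4 := by rw [card_erase_of_mem hj, hI]
  exact .of_two hj hi ha fab na nb (five_un hI hj h0 hd ha hi fab) (lace_of_few ⟨i, hi⟩ (by omega))
    (twoAll_of_few (by omega) (by omega)) (hyp_of_few (by omega) (by omega)) (by rw [hc]; norm_num; omega)

theorem five_loose (hI : I.card = 5) (hj : j ∈ I) (h0 : E f (I.erase j) c = 8) (h1 : E f (I.erase j) (flip j c) = 0)
    (hd : ∀ z ∈ S I c, d f I z ≤ 2) (hE : E f I c ≤ 12) : Lace f I c := by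
  have hc : (I.erase j).card = 4 := by rw [card_erase_of_mem hj, hI]
  have hs := E_split (f := f) (c := c) hj
  have hB : (Bl f (I.erase j) c j).card ≤ 2 := by omega
  have hX : ∑ z ∈ Bl f (I.erase j) c j, d f (I.erase j) z ≤ 2 := by
    refine (sum_Bl_le hj (fun z hz => ⟨S_erase_sub (Bl_subset hz), (mem_Bl.1 hz).2⟩) (r := 1)
      fun z hz => hd z (S_erase_sub (Bl_subset hz))).trans (by omega)
  have hr := E_rmS_le (f := f) (Bl_subset (f := f) (J := I.erase j) (c := c) (j := j))
  set g := f.rmS (Bl f (I.erase j) c j) with hg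
  have det : ∀ {a i}, a ∈ S (I.erase j) c → i ∈ I.erase j → g a i → Det f I c j i a (flip i a) := fun {a i} ha hi h => by
    obtain ⟨h, h2, h3⟩ := rmS_iff.1 h
    exact five_det hI hj h0 (by omega) hB (fun z hz => .inl (hd z hz)) ha hi h (not_Bl_iff ha h2)
      (not_Bl_iff ((flip_mem hi).2 ha) h3)
  have cond : ∀ {a}, a ∈ S (I.erase j) c → Cond f (I.erase j) c j a := fun {a} ha => by
    have := gd_add_d (f := f) (J := I.erase j) (a := a)
    have := hd a (S_erase_sub ha)
    have := d_erase (f := f) (z := a) hj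
    exact cond_of_few ha (by omega) (by omega)
  obtain ⟨a, ha, i, hi, ga⟩ := exists_fault (f := g) (I := I.erase j) (b := c) (by omega)
  have := E_un ha hi ga
  obtain ⟨a', ha', i', hi', ga'⟩ := exists_fault (f := g.un a i) (I := I.erase j) (b := c) (by omega)
  obtain ⟨ga', hne⟩ := un_iff.1 ga'
  intro x hx y hy hxy
  by_cases h : x = flip j a ∧ y = flip j (flip i a) ∨ x = flip j (flip i a) ∧ y = flip j a
  · refine (det ha' hi' ga').path hx hy hxy (.inl (cond ha')) (.inl (cond ((flip_mem hi').2 ha'))) fun h' => ?_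
    refine absurd ?_ hne
    have : (a' = a ∧ flip i' a' = flip i a) ∨ (a' = flip i a ∧ flip i' a' = a) := by
      rcases h with ⟨rfl, rfl⟩ | ⟨rfl, rfl⟩ <;> simp only [flip_inj] at h' <;> rcases h' with ⟨h1, h2⟩ | ⟨h1, h2⟩
      · exact .inl ⟨h1.symm, h2.symm⟩
      · exact .inr ⟨h2.symm, h1.symm⟩
      · exact .inr ⟨h1.symm, h2.symm⟩
      · exact .inl ⟨h2.symm, h1.symm⟩
    rcases this with ⟨rfl, h2⟩ | ⟨rfl, h2⟩
    · exact ⟨(flip_dir_inj _ _ _).1 h2, .inl rfl⟩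
    · refine ⟨(flip_dir_inj i' i (flip i a)).1 ?_, .inr rfl⟩
      rw [h2, flip_flip]
  · exact (det ha hi ga).path hx hy hxy (.inl (cond ha)) (.inl (cond ((flip_mem hi).2 ha))) fun h' => absurd h' h

/-- The final dichotomy at a vertex with three faults in a `5`-cube. -/
theorem five_tight_sum (hj : j ∈ I) (hE : E (f.rm v) I v ≤ 6)
    (h4 : ∀ k ∈ I, f v k → 4 ≤ E (f.rm v) (I.erase k) v) (h0 : E (f.rm v) (I.erase j) v = 4)
    (ha : a ∈ S (I.erase j) v) (hi : i ∈ I.erase j) (hab : (f.rm v) a i) (hp : par (flip i a) = par v)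
    (da : 2 ≤ d f (I.erase j) a) (db : 2 ≤ d f (I.erase j) (flip i a)) : False := by
  obtain ⟨fab, na, nb⟩ := rm_iff.1 hab
  have hb := (flip_mem hi).2 ha
  have rb := d_rm (f := f) (I := I.erase j) nb
  rw [adj_eq_zero_of_par hp.symm] at rb
  by_cases hadj : adj f (I.erase j) v a = 0
  · have ra := d_rm (f := f) (I := I.erase j) na
    have e1 := E_rm (f := f.rm v) hb
    have e2 := d_le_rm_succ (f := f.rm v) (I := I.erase j) (ne_flip i a)
    have e3 := two_d_le (f := (f.rm v).rm (flip i a)) ha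
    omega
  · obtain ⟨k, hk, rfl, fk⟩ := exists_of_adj hadj
    have hkI := mem_of_mem_erase hk
    have e1 := E_rm (f := f.rm v) (S_erase_sub hb)
    have hik : i ≠ k := by rintro rfl; simp at nb
    have e2 : E ((f.rm v).rm (flip i (flip k v))) (I.erase k) v = E (f.rm v) (I.erase k) v :=
      E_rm_of_notMem fun h => by
        rw [mem_S] at h
        have := h k (by simp)
        rw [flip_other hik.symm] at this
        simp at this
    have e3 : E ((f.rm v).rm (flip i (flip k v))) (I.erase k) v ≤ E ((f.rm v).rm (flip i (flip k v))) I v :=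
      E_mono (erase_subset _ _)
    have e4 := h4 k hkI fk
    have e5 : d (f.rm v) (I.erase j) (flip i (flip k v)) ≤ d (f.rm v) I (flip i (flip k v)) := by
      have := d_erase (f := f.rm v) (z := flip i (flip k v)) hj
      omega
    omega

theorem five_tight (hI : I.card = 5) (hv : d f I v = 3) (hd : ∀ z ∈ S I v, z ≠ v → d f I z ≤ 2) (hE : E f I v ≤ 12) :
    Lace f I v := by
  have hr := E_rm (f := f) (I := I) (self_mem_S (b := v))
  have hd' : ∀ j, f v j → ∀ z ∈ S I v, d f I z ≤ 2 ∨ d f I z = 3 ∧ f z j := fun j fj z hz => by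
    by_cases h : z = v
    · subst h; exact .inr ⟨hv, fj⟩
    · exact .inl (hd z hz h)
  have opp : ∀ j ∈ I, E f (I.erase j) (flip j v) = E (f.rm v) (I.erase j) (flip j v) := fun j hj =>
    (E_rm_of_notMem fun h => by rw [mem_S] at h; simpa using h j (by simp)).symm
  have sp := fun j (hj : j ∈ I) => E_split (f := f.rm v) (c := v) hj
  have dv : ∀ j ∈ I, f v j → d f (I.erase j) v = 2 := fun j hj fj => by
    have := d_erase (f := f) (z := v) hj; rw [if_pos fj] at this; omega
  have near : ∀ j ∈ I, f v j → E f (I.erase j) v = E (f.rm v) (I.erase j) v + 4 := fun j hj fj => by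
    have := E_rm (f := f) (I := I.erase j) (self_mem_S (b := v)); rw [dv j hj fj] at this; omega
  by_cases hM : ∃ j ∈ I, f v j ∧ E (f.rm v) (I.erase j) v ≤ 2
  · obtain ⟨j, hj, fj, h⟩ := hM
    refine five_split hI hj (by rw [near j hj fj]; omega) ?_ (hd' j fj) hE
    rw [opp j hj]; have := sp j hj; omega
  push Not at hM
  have h4 : ∀ k ∈ I, f v k → 4 ≤ E (f.rm v) (I.erase k) v := fun k hk fk => by
    obtain ⟨p, hp⟩ := E_even (f := f.rm v) (I := I.erase k) (b := v)
    have := hM k hk fk; omega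
  obtain ⟨j, hj, fj, h0⟩ : ∃ j ∈ I, f v j ∧ E (f.rm v) (I.erase j) v = 4 := by
    by_contra! hno
    have h6 : ∀ k ∈ I.filter (f v), E (f.rm v) I v ≤ E (f.rm v) (I.erase k) v + 0 := fun k hk => by
      obtain ⟨hk, fk⟩ := mem_filter.1 hk
      obtain ⟨p, hp⟩ := E_even (f := f.rm v) (I := I.erase k) (b := v)
      have := h4 k hk fk; have := hno k hk fk
      omega
    have h7 := E_le_of_out (filter_subset _ I) subset_rfl h6
    have hc : (I \ I.filter (f v)).card = 2 := by
      rw [card_sdiff_of_subset (filter_subset _ _), hI]; change 5 - d f I v = 2; omega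
    have h8 := E_eq_le_four (f := f.rm v) (v := v) hc fun i _ h => (rm_iff.1 h).2.1 rfl
    obtain ⟨k, hk⟩ : (I.filter (f v)).Nonempty := card_pos.1 (show 0 < d f I v by omega)
    obtain ⟨hkI, fk⟩ := mem_filter.1 hk
    have h9 := hno k hkI fk
    have h10 := h4 k hkI fk
    have := sp k hkI
    omega
  have hs := sp j hj
  have hs' := E_split (f := f) (c := v) hj
  have hn := near j hj fj
  have ho := opp j hj
  have hvB : v ∈ Bl f (I.erase j) v j := mem_Bl.2 ⟨self_mem_S, fj⟩
  have hBe := card_erase_of_mem hvB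
  have hBp := card_pos.2 ⟨v, hvB⟩
  have hB : (Bl f (I.erase j) v j).card ≤ 2 := by omega
  have hsub : (Bl f (I.erase j) v j).erase v ⊆ S (I.erase j) v := (erase_subset _ _).trans Bl_subset
  have hsum : ∑ z ∈ (Bl f (I.erase j) v j).erase v, d (f.rm v) (I.erase j) z ≤ 1 := by
    refine (sum_le_card_nsmul _ _ 1 fun z hz => ?_).trans (by rw [hBe]; simp; omega)
    obtain ⟨hzv, hz⟩ := mem_erase.1 hz
    have h1 := hd z (S_erase_sub (Bl_subset hz)) hzv
    have h2 := d_erase (f := f) (z := z) hj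
    rw [if_pos (mem_Bl.1 hz).2] at h2
    have h3 := d_rm_le (f := f) (I := I.erase j) (v := v) (z := z)
    omega
  obtain ⟨a, ha, i, hi, hab, na, nb⟩ := exists_fault_avoid hsub (by omega : 2 * ∑ z ∈ _, d (f.rm v) (I.erase j) z < _)
  obtain ⟨fab, hav, hbv⟩ := rm_iff.1 hab
  have hb := (flip_mem hi).2 ha
  have na' : ¬ f a j := not_Bl_iff ha fun h => na (mem_erase.2 ⟨hav, h⟩)
  have nb' : ¬ f (flip i a) j := not_Bl_iff hb fun h => nb (mem_erase.2 ⟨hbv, h⟩)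
  have D := five_det hI hj (by omega) (by omega) hB (hd' j fj) ha hi fab na' nb'
  have key : d f (I.erase j) a ≤ 1 ∨ d f (I.erase j) (flip i a) ≤ 1 := by
    by_contra! h
    by_cases hp : par (flip i a) = par v
    · exact five_tight_sum hj (by omega) h4 h0 ha hi hab hp h.1 h.2
    · refine five_tight_sum (a := flip i a) (i := i) hj (by omega) h4 h0 hb hi (by rwa [Flt.symm]) ?_ h.2 (by rw [flip_flip]; exact h.1)
      rw [par_flip] at hp
      rw [flip_flip]
      revert hp
      cases par a <;> cases par v <;> simp
  have hc : (I.erase j).card = 4 := by rw [card_erase_of_mem hj, hI]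
  have ga := gd_add_d (f := f) (J := I.erase j) (a := a)
  have gb := gd_add_d (f := f) (J := I.erase j) (a := flip i a)
  have da := d_erase (f := f) (z := a) hj
  have db := d_erase (f := f) (z := flip i a) hj
  have da' := hd a (S_erase_sub ha) hav
  have db' := hd _ (S_erase_sub hb) hbv
  refine D.lace_clean ?_ ?_ ?_ ?_ ?_ <;> omega

theorem tol_five : Tol n 5 := by
  intro f I b hI hd hu hE
  replace hE : E f I b ≤ 12 := hE
  by_cases ht : ∃ v ∈ S I b, d f I v = 3
  · obtain ⟨v, hv, dv⟩ := ht
    rw [← Lace_congr hv]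
    refine five_tight hI dv (fun z hz hzv => ?_) (by rw [E_congr hv]; exact hE)
    rw [S_eq hv] at hz
    have := hd z hz
    have : ¬ d f I z + 2 = 5 := fun h => hzv (hu (by norm_num) z hz v hv h (by omega))
    omega
  push Not at ht
  have hd2 : ∀ z ∈ S I b, d f I z ≤ 2 := fun z hz => by
    have := hd z hz; have := ht z hz; omega
  obtain ⟨p, hp⟩ := E_even (f := f) (I := I) (b := b)
  obtain ⟨j, hj, h8⟩ : ∃ j ∈ I, E f I b ≤ 2 * (Bl f (I.erase j) b j).card + 8 := by
    by_contra! h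
    have h1 : ∑ j ∈ I, 2 * (Bl f (I.erase j) b j).card ≤ I.card • (E f I b - 10) :=
      sum_le_card_nsmul _ _ _ fun j hj => by have := h j hj; omega
    rw [← E_eq_sum, hI, smul_eq_mul] at h1
    obtain ⟨j, hj⟩ : I.Nonempty := card_pos.1 (by omega)
    have := h j hj
    omega
  have hs := E_split (f := f) (c := b) hj
  obtain ⟨q, hq⟩ := E_even (f := f) (I := I.erase j) (b := b)
  obtain ⟨r, hr⟩ := E_even (f := f) (I := I.erase j) (b := flip j b)
  by_cases h0 : E f (I.erase j) b ≤ 6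
  · by_cases h1 : E f (I.erase j) (flip j b) ≤ 6
    · exact five_split hI hj h0 h1 (fun z hz => .inl (hd2 z hz)) hE
    · have hb : flip j b ∈ S I b := (flip_mem hj).2 self_mem_S
      rw [← Lace_congr hb]
      refine five_loose hI hj (by omega) (by rw [flip_flip]; omega) (fun z hz => hd2 z (by rwa [S_eq hb] at hz)) (by rw [E_congr hb]; exact hE)
  · exact five_loose hI hj (by omega) (by omega) hd2 hE

end HC

namespace HC
variable {n m : ℕ} {f : Flt n} {I J K : Finset (Fin n)} {b c u v w z x y a : V n} {i j k : Fin n}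

/-! A depth-first search for Hamiltonian paths in small cubes, written for evaluation by the kernel:
vertices are numbers, sets of vertices are bit masks. -/

/-- `g k`, where `k` is brought to normal form first. -/
def force {α : Type} (k : ℕ) (g : ℕ → α) : α := Nat.rec (g 0) (fun k _ => g (Nat.succ k)) k

/-- `b` if the bit masks `s` and `p` meet, otherwise `c`. -/
def hit {α : Type} (s p : ℕ) (b c : α) : α := Nat.rec c (fun _ _ => b) (Nat.land s p)

/-- Whether `p` holds for some entry of `l`. -/
def someOf (l : List ℕ) (p : ℕ → Bool) : Bool := List.rec false (fun a _ ih => Bool.rec ih true (p a)) l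

/-- Row `c` of the adjacency matrix `A` of a graph with `N` vertices. -/
def row (A N c : ℕ) : ℕ := Nat.shiftRight A (Nat.mul N c)

/-- A neighbour in `s` of `cur` that has to be visited next, if there is one, otherwise `s`. -/
def urgent (A N un s cur : ℕ) (ds : List ℕ) : ℕ :=
  List.rec s (fun k _ ih => force (Nat.xor cur k) fun z => force (Nat.pow 2 z) fun p =>
    hit s p (force (Nat.land (row A N z) un) fun q => hit q (Nat.pred q) ih p) ih) ds

/-- Search for a path from `cur` to `t` through the set `un` of `e + 1` unvisited vertices. -/
def search (A N t : ℕ) (ds : List ℕ) (e : ℕ) : ℕ → ℕ → Bool :=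
  Nat.rec (fun cur _ => hit (row A N cur) (Nat.pow 2 t) true false)
    (fun _ ih cur un => force (Nat.land (row A N cur) (Nat.xor un (Nat.pow 2 t))) fun s =>
      force (Nat.land s (urgent A N un s cur ds)) fun s => someOf ds fun k => force (Nat.xor cur k) fun z =>
        force (Nat.pow 2 z) fun p => hit s p (ih z (Nat.xor un p)) false) e

theorem force_eq {α : Type} (k : ℕ) (g : ℕ → α) : force k g = g k := by cases k <;> rfl

theorem someOf_iff {l : List ℕ} {p : ℕ → Bool} : someOf l p = true ↔ ∃ a ∈ l, p a = true := by
  induction l with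
  | nil => simp [someOf]
  | cons a l ih =>
    have : someOf (a :: l) p = Bool.rec (someOf l p) true (p a) := rfl
    rw [this]
    cases h : p a <;> simp [h, ih]

theorem hit_iff {s z : ℕ} {b : Bool} : hit s (2 ^ z) b false = true ↔ s.testBit z = true ∧ b = true := by
  have h : Nat.land s (2 ^ z) = s &&& 2 ^ z := rfl
  rw [hit, h, Nat.and_two_pow]
  cases hs : s.testBit z
  · simp
  · obtain ⟨q, hq⟩ := Nat.exists_eq_succ_of_ne_zero (Nat.two_pow_pos z).ne'
    simp [hq]

theorem search_sound {A N t : ℕ} {ds : List ℕ} (φ : ℕ → V n)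
    (hA : ∀ c < N, ∀ z < N, (row A N c).testBit z = true → R f (φ c) (φ z)) (ht : t < N) :
    ∀ e cur un, cur < N → (∀ z, un.testBit z = true → z < N) → un.testBit t = true → search A N t ds e cur un = true →
      ∃ L : List ℕ, L.Nodup ∧ L.length = e + 1 ∧ (∀ z ∈ L, un.testBit z = true) ∧
        Path (R f) (φ cur ::ₘ (L.map φ : Multiset (V n))) (φ cur) (φ t) := by
  intro e
  induction e with
  | zero =>
    intro cur un hcur _ hut h
    have h : hit (row A N cur) (2 ^ t) true false = true := h
    exact ⟨[t], by simp, rfl, by simpa using hut, by simpa using .cons (hA _ hcur _ ht (hit_iff.1 h).1) (.single _)⟩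
  | succ e ih =>
    intro cur un hcur hun hut h
    have h : force (row A N cur &&& (un ^^^ 2 ^ t)) (fun s => force (s &&& urgent A N un s cur ds) fun s =>
        someOf ds fun k => force (cur ^^^ k) fun z => force (2 ^ z) fun p =>
          hit s p (search A N t ds e z (un ^^^ p)) false) = true := h
    simp only [force_eq, someOf_iff, hit_iff, Nat.testBit_and, Nat.testBit_xor, Nat.testBit_two_pow,
      Bool.and_eq_true] at h
    obtain ⟨k, -, ⟨⟨h1, h2⟩, -⟩, h3⟩ := h
    set z := cur ^^^ k
    have htz : t ≠ z := by rintro h; simp [← h, hut] at h2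
    simp only [htz, decide_false, Bool.xor_false] at h2
    obtain ⟨L, hL, hl, hm, hp⟩ := ih z (un ^^^ 2 ^ z) (hun z h2)
      (fun y hy => by
        by_cases hyz : z = y
        · exact hyz ▸ hun z h2
        · exact hun y (by simpa [hyz] using hy))
      (by simpa [htz.symm] using hut) h3
    refine ⟨z :: L, List.nodup_cons.2 ⟨fun hz => by simpa [h2] using hm z hz, hL⟩, by simp [hl], ?_, ?_⟩
    · intro y hy
      rcases List.mem_cons.1 hy with rfl | hy
      · exact h2
      · have := hm y hy
        by_cases hyz : z = y
        · exact hyz ▸ h2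
        · simpa [hyz] using this
    · exact .cons (hA _ hcur _ (hun z h2) h1) hp

/-- The vertex that differs from `v` in those directions of `ks` whose bit is set in `c`. -/
def code : List (Fin n) → V n → ℕ → V n
  | [], v, _ => v
  | k :: ks, v, c => if c.testBit 0 then flip k (code ks v (c / 2)) else code ks v (c / 2)

/-- The parity of the last `m` binary digits of `c`. -/
def cpar : ℕ → ℕ → Bool
  | 0, _ => false
  | m + 1, c => c.testBit 0 ^^ cpar m (c / 2)

theorem code_zero (ks : List (Fin n)) : code ks v 0 = v := by
  induction ks with
  | nil => rfl
  | cons k ks ih => simpa [code] using ih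

theorem par_code (ks : List (Fin n)) (c : ℕ) : par (code ks v c) = (par v ^^ cpar ks.length c) := by
  induction ks generalizing c with
  | nil => simp [code, cpar]
  | cons k ks ih =>
    rw [code, List.length_cons, cpar]
    split_ifs with h <;> simp [h, ih, -Nat.testBit_zero]

theorem code_of_notMem {ks : List (Fin n)} {c : ℕ} (hi : i ∉ ks) : code ks v c i = v i := by
  induction ks generalizing c with
  | nil => rfl
  | cons k ks ih =>
    rw [List.mem_cons, not_or] at hi
    rw [code]
    split_ifs
    · rw [flip_other hi.1, ih hi.2]
    · exact ih hi.2

theorem code_getElem {ks : List (Fin n)} (hk : ks.Nodup) {c q : ℕ} (hq : q < ks.length) :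
    code ks v c ks[q] = (v ks[q] ^^ c.testBit q) := by
  induction ks generalizing c q with
  | nil => simp at hq
  | cons k ks ih =>
    rw [List.nodup_cons] at hk
    rw [code]
    cases q with
    | zero =>
      simp only [List.getElem_cons_zero]
      split_ifs with h <;> simp [h, code_of_notMem hk.1, -Nat.testBit_zero]
    | succ q =>
      have hq' : q < ks.length := by simpa using hq
      have hne : ks[q] ≠ k := fun h => hk.1 (h ▸ List.getElem_mem hq')
      simp only [List.getElem_cons_succ, Nat.testBit_succ]
      split_ifs
      · rw [flip_other hne, ih hk.2]
      · exact ih hk.2 hq'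

theorem code_xor {ks : List (Fin n)} {c q : ℕ} (hq : q < ks.length) :
    code ks v (c ^^^ 2 ^ q) = flip ks[q] (code ks v c) := by
  induction ks generalizing c q with
  | nil => simp at hq
  | cons k ks ih =>
    rw [code, code, Nat.xor_div_two, Nat.testBit_xor]
    cases q with
    | zero => cases h : c.testBit 0 <;> simp
    | succ q =>
      have h2 : 2 ^ (q + 1) / 2 = 2 ^ q := by omega
      have h0 : (2 ^ (q + 1)).testBit 0 = false := by simp
      rw [h0, Bool.xor_false, h2, ih (by simpa using hq)]
      split_ifs
      · exact flip_comm _ _ _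
      · rfl

theorem code_mem {ks : List (Fin n)} (hI : ks.toFinset = I) {c : ℕ} : code ks v c ∈ S I v :=
  mem_S.2 fun i hi => code_of_notMem (by rwa [← hI, List.mem_toFinset] at hi)

theorem code_inj {ks : List (Fin n)} (hk : ks.Nodup) {c d : ℕ} (hc : c < 2 ^ ks.length) (hd : d < 2 ^ ks.length)
    (h : code ks v c = code ks v d) : c = d := by
  refine Nat.eq_of_testBit_eq fun q => ?_
  by_cases hq : q < ks.length
  · have := congrFun h ks[q]
    rw [code_getElem hk, code_getElem hk] at this
    simpa using this
  · rw [Nat.testBit_lt_two_pow (hc.trans_le (Nat.pow_le_pow_right (by norm_num) (by omega))),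
      Nat.testBit_lt_two_pow (hd.trans_le (Nat.pow_le_pow_right (by norm_num) (by omega)))]

theorem image_code {ks : List (Fin n)} (hk : ks.Nodup) (hI : ks.toFinset = I) :
    (range (2 ^ ks.length)).image (code ks v) = S I v := by
  refine eq_of_subset_of_card_le (fun z hz => ?_) ?_
  · obtain ⟨c, -, rfl⟩ := mem_image.1 hz
    exact code_mem hI
  · rw [card_image_of_injOn fun c hc d hd h => code_inj hk (by simpa using hc) (by simpa using hd) h, card_S, ← hI,
      List.toFinset_card_of_nodup hk, card_range]

theorem exists_code {ks : List (Fin n)} (hk : ks.Nodup) (hI : ks.toFinset = I) (hz : z ∈ S I v) :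
    ∃ c < 2 ^ ks.length, z = code ks v c := by
  rw [← image_code hk hI] at hz
  obtain ⟨c, hc, rfl⟩ := mem_image.1 hz
  exact ⟨c, by simpa using hc, rfl⟩

/-- The faults given by the masks `st` of faulty directions. -/
def faulty (st : ℕ → ℕ) (c q : ℕ) : Bool := (st c).testBit q || (st (c ^^^ 2 ^ q)).testBit q

/-- The bit mask of the neighbours of `c` across healthy edges. -/
def nbrs (m : ℕ) (st : ℕ → ℕ) (c : ℕ) : ℕ :=
  (List.range m).foldr (fun q s => if faulty st c q then s else 2 ^ (c ^^^ 2 ^ q) ||| s) 0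

/-- The matrix whose `k` rows, of length `N`, are `r o, r (o + 1), …`. -/
def matrix (r : ℕ → ℕ) (N : ℕ) : ℕ → ℕ → ℕ
  | 0, _ => 0
  | k + 1, o => r o ||| matrix r N k (o + 1) <<< N

/-- Search all pairs of vertices of different parity, taking directions in the order `ord`. -/
def check (m : ℕ) (st : ℕ → ℕ) (ord : ℕ → ℕ → List ℕ) : Bool :=
  force (matrix (nbrs m st) (2 ^ m) (2 ^ m) 0) fun A =>
    (List.range (2 ^ m)).all fun x => cpar m x || (List.range (2 ^ m)).all fun y => !cpar m y ||
      force ((2 ^ 2 ^ m - 1) ^^^ 2 ^ x) fun un => search A (2 ^ m) y (ord x y) (2 ^ m - 2) x un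

theorem nbrs_testBit {st : ℕ → ℕ} {c z : ℕ} (h : (nbrs m st c).testBit z = true) :
    ∃ q < m, z = c ^^^ 2 ^ q ∧ faulty st c q = false := by
  have : ∀ l : List ℕ, (l.foldr (fun q s => if faulty st c q then s else 2 ^ (c ^^^ 2 ^ q) ||| s) 0).testBit z = true →
      ∃ q ∈ l, z = c ^^^ 2 ^ q ∧ faulty st c q = false := by
    intro l
    induction l with
    | nil => simp
    | cons q l ih =>
      intro h
      rw [List.foldr_cons] at h
      split_ifs at h with hf
      · obtain ⟨r, hr, h⟩ := ih h
        exact ⟨r, List.mem_cons_of_mem _ hr, h⟩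
      · rw [Nat.testBit_or, Bool.or_eq_true, Nat.testBit_two_pow, decide_eq_true_eq] at h
        rcases h with h | h
        · exact ⟨q, List.mem_cons_self, h.symm, by simpa using hf⟩
        · obtain ⟨r, hr, h⟩ := ih h
          exact ⟨r, List.mem_cons_of_mem _ hr, h⟩
  simpa using this _ h

theorem row_matrix {r : ℕ → ℕ} {N l o c z : ℕ} (hr : ∀ c < o + l, ∀ z, (r c).testBit z = true → z < N) (hc : c < l)
    (hz : z < N) (h : (row (matrix r N l o) N c).testBit z = true) : (r (o + c)).testBit z = true := by
  replace h : (matrix r N l o).testBit (N * c + z) = true := by rwa [← Nat.testBit_shiftRight]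
  induction l generalizing o c with
  | zero => simp at hc
  | succ l ih =>
    rw [matrix, Nat.testBit_or, Bool.or_eq_true, Nat.testBit_shiftLeft] at h
    cases c with
    | zero => simpa [hz, not_le.2 hz] using h
    | succ c =>
      rcases h with h | h
      · have := hr _ (by omega) _ h
        have := Nat.le_mul_of_pos_right N (show 0 < c + 1 by omega)
        omega
      · rw [Bool.and_eq_true, show N * (c + 1) + z - N = N * c + z by rw [mul_add]; omega] at h
        have := ih (fun c hc => hr c (by omega)) (by omega) h.2
        rwa [show o + (c + 1) = o + 1 + c by omega]

theorem lace_of_check {ks : List (Fin n)} {st : ℕ → ℕ} {ord : ℕ → ℕ → List ℕ} (hk : ks.Nodup) (hI : ks.toFinset = I)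
    (hst : ∀ c < 2 ^ ks.length, ∀ q (hq : q < ks.length), f (code ks v c) ks[q] → faulty st c q = true)
    (hc : check ks.length st ord = true) : Lace f I v := by
  set N := 2 ^ ks.length
  have key : ∀ x < N, ∀ y < N, cpar ks.length x = false → cpar ks.length y = true →
      Path (R f) (S I v).val (code ks v x) (code ks v y) := by
    intro x hx y hy px py
    simp only [check, force_eq, List.all_eq_true, List.mem_range, Bool.or_eq_true, Bool.not_eq_true'] at hc
    have hs := ((hc x hx).resolve_left (by simp [px]) y hy).resolve_left (by simp [py])
    have hxy : x ≠ y := by rintro rfl; simp [px] at py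
    have hlt : ∀ c < N, ∀ z, (nbrs ks.length st c).testBit z = true → z < N := by
      intro c hc z hz
      obtain ⟨q, hq, rfl, -⟩ := nbrs_testBit hz
      exact Nat.xor_lt_two_pow hc (Nat.pow_lt_pow_right (by norm_num) hq)
    have hun : ∀ z, ((2 ^ N - 1) ^^^ 2 ^ x).testBit z = true ↔ z < N ∧ z ≠ x := by
      intro z
      rw [Nat.testBit_xor, Nat.testBit_two_pow_sub_one, Nat.testBit_two_pow]
      have := eq_comm (a := z) (b := x)
      by_cases h1 : z < N
      · by_cases h2 : x = z <;> simp [h1, h2, this]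
      · have : x ≠ z := by omega
        simp [h1, this]
    obtain ⟨L, hL, hl, hm, hp⟩ := search_sound (f := f) (code ks v) (fun c hc z hz h => by
      have := row_matrix (by simpa using hlt) hc hz h
      rw [zero_add] at this
      obtain ⟨q, hq, rfl, hf⟩ := nbrs_testBit this
      rw [code_xor hq]
      exact R_flip fun h => by simp [hst c hc q hq h] at hf) hy _ _ _ hx (fun z hz => ((hun z).1 hz).1)
      ((hun y).2 ⟨hy, hxy.symm⟩) hs
    have hn : (x :: L).Nodup := List.nodup_cons.2 ⟨fun h => ((hun x).1 (hm x h)).2 rfl, hL⟩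
    have hM : ∀ c ∈ x :: L, c < N := by
      intro c hc
      rcases List.mem_cons.1 hc with rfl | hc
      · exact hx
      · exact ((hun c).1 (hm c hc)).1
    refine hp.of_eq ?_
    have hmn : (((x :: L).map (code ks v) : List (V n)) : Multiset (V n)).Nodup :=
      Multiset.coe_nodup.2 (hn.map_on fun c hc d hd h => code_inj hk (hM c hc) (hM d hd) h)
    refine Multiset.eq_of_le_of_card_le ((Multiset.le_iff_subset hmn).2 fun z hz => ?_) ?_
    · obtain ⟨c, -, rfl⟩ := List.mem_map.1 (Multiset.mem_coe.1 hz)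
      exact code_mem hI
    · rw [card_val, ← hI, List.toFinset_card_of_nodup hk, Multiset.card_cons, Multiset.coe_card, List.length_map, hl]
      omega
  intro x hx y hy hxy
  obtain ⟨p, hp, rfl⟩ := exists_code hk hI hx
  obtain ⟨q, hq, rfl⟩ := exists_code hk hI hy
  rw [par_code, par_code] at hxy
  cases h1 : cpar ks.length p <;> cases h2 : cpar ks.length q <;> simp only [h1, h2, ne_eq, not_true] at hxy
  · exact key p hp q hq h1 h2
  · exact (key q hq p hp h2 h1).rev R_symm
end HC

namespace HC
variable {n m : ℕ} {f : Flt n} {I J K : Finset (Fin n)} {b c u v w z x y a p q : V n} {i j k : Fin n}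

/-- All faults of the subcube lie on the stars of three centres, no two of which are joined by a fault; a direction
separates centres only where this cannot be avoided by the detour arguments. -/
structure Stars (f : Flt n) (I : Finset (Fin n)) (c u w : V n) : Prop where
  hu : u ∈ S I c
  hw : w ∈ S I c
  huc : u ≠ c
  hwc : w ≠ c
  hwu : w ≠ u
  cov : ∀ z ∈ S I c, ∀ i ∈ I, f z i → (z = c ∨ z = u ∨ z = w) ∨ flip i z = c ∨ flip i z = u ∨ flip i z = w
  ncu : ∀ i ∈ I, f c i → flip i c ≠ u
  ncw : ∀ i ∈ I, f c i → flip i c ≠ w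
  nuw : ∀ i ∈ I, f u i → flip i u ≠ w
  near : ∀ i ∈ I, f c i → f u i ∨ f w i → u i = c i ∧ w i = c i
  same : ∀ i ∈ I, ¬ f c i → f u i → f w i → u i = w i

theorem Stars.swap (h : Stars f I c u w) : Stars f I c w u where
  hu := h.hw
  hw := h.hu
  huc := h.hwc
  hwc := h.huc
  hwu := h.hwu.symm
  cov z hz i hi hf := by have := h.cov z hz i hi hf; tauto
  ncu := h.ncw
  ncw := h.ncu
  nuw i hi hf := by
    rintro rfl
    exact h.nuw i hi ((f.symm w i).2 hf) (flip_flip i w)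
  near i hi h1 h2 := (h.near i hi h1 h2.symm).symm
  same i hi h1 h2 h3 := (h.same i hi h1 h3 h2).symm

theorem Stars.E_eq_zero (h : Stars f I c u w) (hj : j ∈ I) (huj : u j = c j) (hwj : w j = c j) :
    E f (I.erase j) (flip j c) = 0 := by
  by_contra hE
  obtain ⟨z, hz, i, hi, hf⟩ := exists_fault hE
  obtain ⟨hz, hzj⟩ := (mem_erase_flip_iff hj).1 hz
  have hij := ne_of_mem_erase hi
  have hfj : flip i z j = z j := flip_other hij.symm z
  rcases h.cov z hz i (mem_of_mem_erase hi) hf with (e | e | e) | e | e | e <;> have e := congrFun e j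
  exacts [hzj e, hzj (e.trans huj), hzj (e.trans hwj), hzj (hfj ▸ e), hzj (hfj ▸ e.trans huj), hzj (hfj ▸ e.trans hwj)]

theorem Stars.of_mem_Bl (h : Stars f I c u w) (hj : j ∈ I) (huj : u j = c j) (hwj : w j = c j)
    (hz : z ∈ Bl f (I.erase j) c j) : z = c ∨ z = u ∨ z = w := by
  obtain ⟨hz, hf⟩ := mem_Bl.1 hz
  obtain ⟨hz, hzj⟩ := (mem_erase_iff hj).1 hz
  have hfj : flip j z j = !z j := flip_same j z
  rcases h.cov z hz j hj hf with h | e | e | e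
  · exact h
  all_goals rw [e] at hfj; simp [huj, hwj, hzj] at hfj

/-- A detour around one centre, splitting along a direction that is healthy only there. -/
theorem Stars.step (h : Stars f I c u w) (hI : 6 ≤ I.card) (hT : ∀ z, z = c ∨ z = u ∨ z = w → z = a ∨ z = p ∨ z = q)
    (hj : j ∈ I) (ha : a ∈ S (I.erase j) c) (huj : u j = c j) (hwj : w j = c j) (na : ¬ f a j) (fp : f p j) (fq : f q j)
    (hk : k ∈ I) (fk : f a k) (hp : flip k a ≠ p) (hq : flip k a ≠ q) (L : Lace (f.un a k) (I.erase j) c) :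
    Lace f I c := by
  have hkj : k ∈ I.erase j := mem_erase.2 ⟨by rintro rfl; exact na fk, hk⟩
  have hc : (I.erase j).card + 1 = I.card := card_erase_add_one hj
  have hb := (flip_mem hkj).2 ha
  have hBl : ∀ z ∈ Bl f (I.erase j) c j, z = p ∨ z = q := fun z hz =>
    (hT z (h.of_mem_Bl hj huj hwj hz)).resolve_left (by rintro rfl; exact na (mem_Bl.1 hz).2)
  have hB : (Bl f (I.erase j) c j).card ≤ 2 :=
    (card_le_card (t := {p, q}) fun z hz => by simpa using hBl z hz).trans card_le_two
  have nb : ¬ f (flip k a) j := fun hf => by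
    rcases hBl _ (mem_Bl.2 ⟨hb, hf⟩) with e | e
    exacts [hp e, hq e]
  have hE := h.E_eq_zero hj huj hwj
  have hd : d f (I.erase j) (flip k a) ≤ ((Bl f (I.erase j) c j).filter fun z => ¬ par z = par (flip k a)).card + 1 := by
    rw [d, ← card_erase_add_one (a := k) (by simpa [hkj] using (f.symm a k).2 fk)]
    refine Nat.add_le_add_right (card_le_card_of_injOn (fun i => flip i (flip k a)) ?_ fun i _ l _ e => by
      simpa using e) 1
    intro i hi
    simp only [coe_erase, coe_filter, Set.mem_sdiff, Set.mem_ofPred_eq, Set.mem_singleton_iff] at hi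
    obtain ⟨⟨hi, fi⟩, hik⟩ := hi
    have hi' := mem_of_mem_erase hi
    have hbI := ((mem_erase_iff hj).1 hb).1
    have hz := (flip_mem hi).2 hb
    have : flip i (flip k a) = p ∨ flip i (flip k a) = q := by
      rcases h.cov _ hbI i hi' fi with e | e
      · rcases hT _ e with e | e | e
        exacts [absurd e (flip_ne k a), absurd e hp, absurd e hq]
      · refine (hT _ e).resolve_left fun e => hik ?_
        rw [eq_comm, eq_flip_iff] at e
        simpa using e.symm
    simp only [coe_filter, Set.mem_ofPred_eq, mem_Bl]
    exact ⟨⟨hz, by rcases this with e | e <;> rwa [e]⟩, by simp⟩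
  have hs := card_filter_add_card_filter_not (s := Bl f (I.erase j) c j) fun z => par z = par (flip k a)
  have hg := gd_add_d (f := f) (J := I.erase j) (a := flip k a)
  have hpow : 2 ^ 4 ≤ 2 ^ ((I.erase j).card - 1) := Nat.pow_le_pow_right (by norm_num) (by omega)
  exact (Det.of_two hj hkj ha fk na nb L (lace_of_few ⟨k, hkj⟩ (Or.inr hE)) (twoAll_of_few (by omega) (Or.inr hE))
    (hyp_of_few (by omega) (Or.inr hE)) (by omega)).lace_one_end (cond_of_few hb (by omega) (by omega)) (by omega)

theorem Stars.erase (h : Stars f I c u w) (huj : u j = c j) (hwj : w j = c j) (hj : j ∈ I) :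
    Stars f (I.erase j) c u w where
  hu := (mem_erase_iff hj).2 ⟨h.hu, huj⟩
  hw := (mem_erase_iff hj).2 ⟨h.hw, hwj⟩
  huc := h.huc
  hwc := h.hwc
  hwu := h.hwu
  cov z hz i hi hf := h.cov z ((mem_erase_iff hj).1 hz).1 i (mem_of_mem_erase hi) hf
  ncu i hi := h.ncu i (mem_of_mem_erase hi)
  ncw i hi := h.ncw i (mem_of_mem_erase hi)
  nuw i hi := h.nuw i (mem_of_mem_erase hi)
  near i hi := h.near i (mem_of_mem_erase hi)
  same i hi := h.same i (mem_of_mem_erase hi)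

/-- Directions faulty at all centres can be removed. -/
theorem Stars.strip (h : Stars f I c u w) (hK : K ⊆ I) (hcK : 3 ≤ K.card) (hf : ∀ i ∈ I, i ∉ K → f c i ∧ f u i ∧ f w i) :
    Stars f K c u w ∧ (Lace f K c → Lace f I c) := by
  obtain ⟨r, hr⟩ : ∃ r, (I \ K).card = r := ⟨_, rfl⟩
  induction r generalizing I with
  | zero =>
    obtain rfl := hK.antisymm (sdiff_eq_empty_iff_subset.1 (card_eq_zero.1 hr))
    exact ⟨h, id⟩
  | succ r ih =>
    obtain ⟨j, hjd⟩ := card_pos.1 (show 0 < (I \ K).card by omega)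
    obtain ⟨hj, hjK⟩ := mem_sdiff.1 hjd
    obtain ⟨fc, fu, fw⟩ := hf j hj hjK
    obtain ⟨huj, hwj⟩ := h.near j hj fc (Or.inl fu)
    have hsub : K ⊆ I.erase j := fun i hi => mem_erase.2 ⟨by rintro rfl; exact hjK hi, hK hi⟩
    obtain ⟨h1, h2⟩ := ih (h.erase huj hwj hj) hsub (fun i hi => hf i (mem_of_mem_erase hi))
      (by rw [erase_sdiff_comm, card_erase_of_mem hjd, hr]; rfl)
    refine ⟨h1, fun L => lace_split hj (h2 L) (lace_of_few (card_pos.1 ?_) (Or.inr (h.E_eq_zero hj huj hwj))) ?_⟩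
    · have := card_le_card hsub; omega
    · have hB : (Bl f (I.erase j) c j).card ≤ 3 :=
        (card_le_card (t := {c, u, w}) fun z hz => by simpa using h.of_mem_Bl hj huj hwj hz).trans card_le_three
      have := Nat.pow_le_pow_right (n := 2) (by norm_num) (hcK.trans (card_le_card hsub))
      omega

theorem un_iff_of_ne (h1 : z ≠ a) (h2 : f z k → flip k z ≠ a) : (f.un a k) z i ↔ f z i := by
  rw [un_iff]
  refine and_iff_left_of_imp ?_
  rintro hf ⟨rfl, e | e⟩
  · exact h1 e
  · exact h2 hf (by rw [e, flip_flip])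

/-- Three disjoint stars that leave `2`, `3` and `3` healthy directions at their centres. -/
structure Star (f : Flt n) (I : Finset (Fin n)) (c u w : V n) : Prop extends Stars f I c u w where
  gc : gd f I c = 2
  gu : gd f I u = 3
  gw : gd f I w = 3
  two : 2 ≤ (I.filter fun i => f c i ∧ f u i ∧ f w i).card

theorem Star.swap (h : Star f I c u w) : Star f I c w u where
  toStars := h.toStars.swap
  gc := h.gc
  gu := h.gw
  gw := h.gu
  two := by simpa only [and_comm, and_left_comm] using h.two

theorem gd_un_of_ne (hj : j ∈ I) (h1 : z ≠ a) (h2 : f z k → flip k z ≠ a) (fz : f z j) :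
    gd (f.un a k) (I.erase j) z = gd f I z := by
  unfold gd
  congr 1
  ext i
  simp only [mem_filter, mem_erase, un_iff_of_ne h1 h2]
  exact ⟨fun h => ⟨h.1.2, h.2⟩, fun h => ⟨⟨by rintro rfl; exact h.2 fz, h.1⟩, h.2⟩⟩

theorem gd_un_self (hj : j ∈ I) (hk : k ∈ I) (na : ¬ f a j) (fa : f a k) : gd (f.un a k) (I.erase j) a = gd f I a := by
  have h1 := gd_add_d (f := f.un a k) (J := I.erase j) (a := a)
  have h2 := gd_add_d (f := f) (J := I) (a := a)
  have h3 := d_un_left hk fa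
  have h4 := d_erase (f := f.un a k) (z := a) hj
  have h5 : ¬ (f.un a k) a j := fun h => na (un_iff.1 h).1
  rw [if_neg h5] at h4
  have := card_erase_add_one hj
  omega

/-- A detour that shrinks the subcube and keeps the configuration. -/
theorem Star.step (h : Star f I c u w) (hI : 6 ≤ I.card) (haq : a = c ∧ q = w ∨ a = w ∧ q = c) (hj : j ∈ I)
    (huj : u j = c j) (hwj : w j = c j) (na : ¬ f a j) (fu : f u j) (fq : f q j) (hk : k ∈ I) (fk : f a k)
    (nu : ¬ f u k) (ih : Star (f.un a k) (I.erase j) c u w → Lace (f.un a k) (I.erase j) c) : Lace f I c := by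
  have hs := h.toStars.erase huj hwj hj
  have hu : ∀ {i}, (f.un a k) u i ↔ f u i := un_iff_of_ne
    (by rcases haq with ⟨rfl, -⟩ | ⟨rfl, -⟩; exacts [h.huc, h.hwu.symm]) fun hf => absurd hf nu
  have hq : q ≠ a ∧ (f q k → flip k q ≠ a) := by
    rcases haq with ⟨rfl, rfl⟩ | ⟨rfl, rfl⟩
    · refine ⟨h.hwc, fun hf e => h.ncw k hk fk ?_⟩
      rw [← e, flip_flip]
    · exact ⟨h.hwc.symm, h.ncw k hk⟩
  have hq' : ∀ {i}, (f.un a k) q i ↔ f q i := un_iff_of_ne hq.1 hq.2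
  have hau : flip k a ≠ u := fun e => nu (by rw [← e]; exact (f.symm a k).2 fk)
  have haq' : flip k a ≠ q := fun e => hq.2 (by rw [← e]; exact (f.symm a k).2 fk) (by rw [← e, flip_flip])
  refine h.toStars.step hI (a := a) (p := u) (q := q) (by rcases haq with ⟨rfl, rfl⟩ | ⟨rfl, rfl⟩ <;> tauto) hj ?_ huj hwj
    na fu fq hk fk hau haq' (ih ?_)
  · rcases haq with ⟨rfl, -⟩ | ⟨rfl, -⟩
    exacts [self_mem_S, hs.hw]
  · have hgq : gd (f.un a k) (I.erase j) q = gd f I q := gd_un_of_ne hj hq.1 hq.2 fq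
    have hga : gd (f.un a k) (I.erase j) a = gd f I a := gd_un_self hj hk na fk
    have hle : ∀ {z i}, (f.un a k) z i → f z i := fun hf => (un_iff.1 hf).1
    have hne : ∀ {z i}, f z i → ¬ (f.un a k) z i → i = k := fun hf hn => by
      by_contra hik
      exact hn (un_iff.2 ⟨hf, fun e => hik e.1⟩)
    refine ⟨⟨hs.hu, hs.hw, h.huc, h.hwc, h.hwu, fun z hz i hi hf => hs.cov z hz i hi (hle hf),
      fun i hi hf => hs.ncu i hi (hle hf), fun i hi hf => hs.ncw i hi (hle hf), fun i hi hf => hs.nuw i hi (hle hf),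
      fun i hi hf hf' => hs.near i hi (hle hf) (hf'.imp hle hle), fun i hi hf h1 h2 => hs.same i hi (fun hf' => ?_)
      (hle h1) (hle h2)⟩, ?_, ?_, ?_, ?_⟩
    · exact nu (hne hf' hf ▸ hle h1)
    · rcases haq with ⟨rfl, rfl⟩ | ⟨rfl, rfl⟩
      exacts [hga.trans h.gc, hgq.trans h.gc]
    · exact (gd_un_of_ne hj (by rcases haq with ⟨rfl, -⟩ | ⟨rfl, -⟩; exacts [h.huc, h.hwu.symm])
        (fun hf => absurd hf nu) fu).trans h.gu
    · rcases haq with ⟨rfl, rfl⟩ | ⟨rfl, rfl⟩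
      exacts [hgq.trans h.gw, hga.trans h.gw]
    · refine h.two.trans (card_le_card fun i hi => ?_)
      simp only [mem_filter, mem_erase] at hi ⊢
      obtain ⟨hi, f1, f2, f3⟩ := hi
      have hik : i ≠ k := by rintro rfl; exact nu f2
      have hun : ∀ {z}, f z i → (f.un a k) z i := fun hf => un_iff.2 ⟨hf, fun e => hik e.1⟩
      refine ⟨⟨?_, hi⟩, hun f1, hun f2, hun f3⟩
      rintro rfl
      rcases haq with ⟨rfl, -⟩ | ⟨rfl, -⟩
      exacts [na f1, na f3]
end HC

namespace HC
variable {n m : ℕ} {f : Flt n} {I J K : Finset (Fin n)} {b c u v w z x y a p q : V n} {i j k : Fin n}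

/-- The stars at `0`, `p` and `q` with masks `s`, `t` and `r`. -/
def stars (s p t q r c : ℕ) : ℕ := cond (c.beq 0) s (cond (c.beq p) t (cond (c.beq q) r 0))

/-- The centres of the stars are distinct and not joined by faults. -/
def apart (m s p t q r : ℕ) : Bool :=
  !p.beq 0 && !q.beq 0 && !p.beq q && (List.range m).all fun i =>
    !(s.testBit i && ((2 ^ i).beq p || (2 ^ i).beq q)) && !(t.testBit i && ((2 ^ i).beq p || (p ^^^ 2 ^ i).beq q)) &&
      !(r.testBit i && ((2 ^ i).beq q || (q ^^^ 2 ^ i).beq p))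

/-- Reads the choice of an entry of `l` for the pair `x`, `y` off the base `4` digits of `T`. -/
def table (T : ℕ) (l : List (List ℕ)) (x y : ℕ) : List ℕ := l.getD ((T >>> (2 * (x / 2 * 16 + y / 2))) % 4) []

theorem check_crossed : ((List.range 16).all fun p => (List.range 16).all fun q => !apart 4 12 p 2 q 1 ||
    (p.testBit 3 && !p.testBit 2) || (p.beq 6 && (q.beq 5 || q.beq 9)) ||
    check 4 (stars 12 p 2 q 1) fun _ _ => [1, 2, 4, 8]) = true := by decide +kernel

theorem check_crossed_five : check 5 (stars 28 6 18 5 17) (table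
    151463309771667830303442834686669891010898080927027190559095637769592688739324661197153784048360045809405253668800754426658133914601199681430209486791968
    [[1, 8, 16, 2, 4], [1, 2, 4, 16, 8], [8, 2, 1, 16, 4], [2, 16, 1, 4, 8]]) = true := by decide +kernel

theorem check_crossed_nine : check 5 (stars 28 6 18 9 17) (table
    2277207486740092057120984156966113413278761786796865964944471574250366708898991206235543974536591314660271319135341547390699282920070319504162887700381701
    [[1, 2, 4, 16, 8], [2, 8, 1, 16, 4], [2, 16, 8, 1, 4], [8, 16, 2, 1, 4]]) = true := by decide +kernel

theorem check_aligned : ((List.range 16).all fun p => (List.range 16).all fun q => !apart 4 12 p 2 q 2 ||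
    !p.testBit 1 || !q.testBit 1 || (p.testBit 3 && !p.testBit 2) || (p.beq 6 && q.beq 10) ||
    check 4 (stars 12 p 2 q 2) fun _ _ => [1, 2, 4, 8]) = true := by decide +kernel

theorem check_aligned_ten : check 5 (stars 28 6 18 10 18) (table
    1073260447322723563713218179354371155080674224191596998075962634403275055262236995511026431884119206519476487797342629254647067728235169877959198705229194
    [[4, 1, 8, 2, 16], [8, 4, 2, 16, 1], [4, 16, 1, 8, 2], [2, 8, 4, 16, 1]]) = true := by decide +kernel

theorem check_pair : ([3, 7, 11, 15].all fun p => check 4 (stars 12 p 3 0 0) fun _ _ => [1, 2, 4, 8]) = true := by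
  decide +kernel
end HC

namespace HC
variable {n m : ℕ} {f : Flt n} {I J K : Finset (Fin n)} {b c u v w z x y a : V n} {i j k l p q : Fin n}

section
variable {ks : List (Fin n)} {s t r g h : ℕ}

theorem Stars.lace_of_check (H : Stars f I c u w) (hk : ks.Nodup) (hI : ks.toFinset = I) (hg : g < 2 ^ ks.length)
    (hh : h < 2 ^ ks.length) (hu : u = code ks c g) (hw : w = code ks c h)
    (hs : ∀ i (hi : i < ks.length), f c ks[i] → s.testBit i = true)
    (ht : ∀ i (hi : i < ks.length), f u ks[i] → t.testBit i = true)
    (hr : ∀ i (hi : i < ks.length), f w ks[i] → r.testBit i = true) {ord : ℕ → ℕ → List ℕ}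
    (hc : check ks.length (stars s g t h r) ord = true) : Lace f I c := by
  have h0 := Nat.two_pow_pos ks.length
  have hg0 : g ≠ 0 := by rintro rfl; exact H.huc (hu.trans (code_zero ks))
  have hh0 : h ≠ 0 := by rintro rfl; exact H.hwc (hw.trans (code_zero ks))
  have hgh : h ≠ g := by rintro rfl; exact H.hwu (hw.trans hu.symm)
  have s0 : stars s g t h r 0 = s := rfl
  have hb : ∀ {a b : ℕ}, a ≠ b → a.beq b = false := fun h => Bool.eq_false_iff.2 fun e => h (Nat.eq_of_beq_eq_true e)
  have sg : stars s g t h r g = t := by simp [stars, hb hg0]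
  have sh : stars s g t h r h = r := by simp [stars, hb hh0, hb hgh]
  have key : ∀ z < 2 ^ ks.length, ∀ i (hi : i < ks.length), f (code ks c z) ks[i] →
      code ks c z = c ∨ code ks c z = u ∨ code ks c z = w → (stars s g t h r z).testBit i = true := by
    rintro z hz i hi hf (e | e | e)
    · obtain rfl := code_inj hk hz h0 (e.trans (code_zero ks).symm)
      rw [s0]; exact hs i hi (by rwa [e] at hf)
    · obtain rfl := code_inj hk hz hg (e.trans hu)
      rw [sg]; exact ht i hi (by rwa [e] at hf)
    · obtain rfl := code_inj hk hz hh (e.trans hw)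
      rw [sh]; exact hr i hi (by rwa [e] at hf)
  refine HC.lace_of_check hk hI (fun z hz i hi hf => ?_) hc
  rw [faulty, Bool.or_eq_true]
  rcases H.cov _ (code_mem hI) ks[i] (hI ▸ List.mem_toFinset.2 (List.getElem_mem hi)) hf with e | e
  · exact Or.inl (key z hz i hi hf e)
  · refine Or.inr (key _ (Nat.xor_lt_two_pow hz (Nat.pow_lt_pow_right (by norm_num) hi)) i hi ?_ ?_) <;>
      rw [code_xor hi]
    exacts [(f.symm _ _).2 hf, e]

theorem Stars.apart (H : Stars f I c u w) (hI : ks.toFinset = I) (hu : u = code ks c g) (hw : w = code ks c h)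
    (hs : ∀ i (hi : i < ks.length), s.testBit i = true → f c ks[i])
    (ht : ∀ i (hi : i < ks.length), t.testBit i = true → f u ks[i])
    (hr : ∀ i (hi : i < ks.length), r.testBit i = true → f w ks[i]) : apart ks.length s g t h r = true := by
  have hmem : ∀ i (hi : i < ks.length), ks[i] ∈ I := fun i hi => hI ▸ List.mem_toFinset.2 (List.getElem_mem hi)
  have fl0 : ∀ i (hi : i < ks.length), code ks c (2 ^ i) = flip ks[i] c := fun i hi => by
    have := code_xor (v := c) (c := 0) hi
    rwa [code_zero, Nat.zero_xor] at this
  have F : ∀ {z v : V n} {i}, f z i → v = flip i z → f v i ∧ z = flip i v := by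
    rintro z v i hf rfl
    exact ⟨(f.symm z i).2 hf, (flip_flip i z).symm⟩
  simp only [HC.apart, Bool.and_eq_true, Bool.not_eq_true', List.all_eq_true, List.mem_range, Bool.or_eq_true,
    Nat.beq_eq, ← Bool.not_eq_true]
  refine ⟨⟨⟨?_, ?_⟩, ?_⟩, fun i hi => ⟨⟨?_, ?_⟩, ?_⟩⟩
  · rintro rfl; exact H.huc (hu.trans (code_zero ks))
  · rintro rfl; exact H.hwc (hw.trans (code_zero ks))
  · rintro rfl; exact H.hwu (hw.trans hu.symm)
  · rintro ⟨hb, rfl | rfl⟩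
    · exact H.ncu _ (hmem i hi) (hs i hi hb) (by rw [hu, fl0 i hi])
    · exact H.ncw _ (hmem i hi) (hs i hi hb) (by rw [hw, fl0 i hi])
  · rintro ⟨hb, rfl | rfl⟩ <;> have hf := ht i hi hb
    · obtain ⟨h1, h2⟩ := F hf (v := c) (by rw [hu, fl0 i hi, flip_flip])
      exact H.ncu _ (hmem i hi) h1 h2.symm
    · exact H.nuw _ (hmem i hi) hf (by rw [hw, code_xor hi, hu])
  · rintro ⟨hb, rfl | rfl⟩ <;> have hf := hr i hi hb
    · obtain ⟨h1, h2⟩ := F hf (v := c) (by rw [hw, fl0 i hi, flip_flip])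
      exact H.ncw _ (hmem i hi) h1 h2.symm
    · obtain ⟨h1, h2⟩ := F hf (v := u) (by rw [hu, code_xor hi, hw])
      exact H.nuw _ (hmem i hi) h1 h2.symm

/-- Reduces laceability to a check on a subcube that contains all directions healthy at some centre. -/
theorem Stars.exists_codes (H : Stars f I c u w) (hk : ks.Nodup) (hK : ks.toFinset ⊆ I) (h3 : 3 ≤ ks.length)
    (hf : ∀ i ∈ I, i ∉ ks → f c i ∧ f u i ∧ f w i) (hs : ∀ i l, ks[i]? = some l → (f c l ↔ s.testBit i = true))
    (ht : ∀ i l, ks[i]? = some l → (f u l ↔ t.testBit i = true))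
    (hr : ∀ i l, ks[i]? = some l → (f w l ↔ r.testBit i = true)) :
    ∃ g < 2 ^ ks.length, ∃ h < 2 ^ ks.length, u = code ks c g ∧ w = code ks c h ∧ HC.apart ks.length s g t h r = true ∧
      ∀ ord, check ks.length (stars s g t h r) ord = true → Lace f I c := by
  obtain ⟨H', L⟩ := H.strip hK (by rwa [List.toFinset_card_of_nodup hk]) fun i hi hn => hf i hi (by simpa using hn)
  obtain ⟨g, hg, hu⟩ := exists_code hk rfl H'.hu
  obtain ⟨h, hh, hw⟩ := exists_code hk rfl H'.hw
  exact ⟨g, hg, h, hh, hu, hw, H'.apart rfl hu hw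
    (fun i hi => (hs i _ (List.getElem?_eq_getElem hi)).2)
    (fun i hi => (ht i _ (List.getElem?_eq_getElem hi)).2)
    fun i hi => (hr i _ (List.getElem?_eq_getElem hi)).2,
    fun ord hc => L (H'.lace_of_check hk rfl hg hh hu hw
    (fun i hi => (hs i _ (List.getElem?_eq_getElem hi)).1)
    (fun i hi => (ht i _ (List.getElem?_eq_getElem hi)).1) (fun i hi => (hr i _ (List.getElem?_eq_getElem hi)).1) hc)⟩
end

variable {e e' : Fin n}

theorem Star.exists_common (H : Star f I c u w) : ∃ l ∈ I, f c l ∧ f u l ∧ f w l := by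
  obtain ⟨l, hl⟩ := card_pos.1 (lt_of_lt_of_le zero_lt_two H.two)
  exact ⟨l, mem_filter.1 hl⟩

theorem Star.lace_crossed_aux (H : Star f I c u w) (hk : [p, q, e, e'].Nodup) (hK : [p, q, e, e'].toFinset ⊆ I)
    (hc : ∀ i ∈ I, ¬ f c i ↔ i = p ∨ i = q) (hu : ∀ i ∈ I, ¬ f u i ↔ i = p ∨ i = e ∨ i = e')
    (hw : ∀ i ∈ I, ¬ f w i ↔ i = q ∨ i = e ∨ i = e') (he : u e' ≠ c e' → u e ≠ c e) : Lace f I c := by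
  obtain ⟨l, hl, lc, lu, lw⟩ := H.exists_common
  have hne := hk
  simp only [List.nodup_cons, List.mem_cons, List.not_mem_nil, or_false, not_or, not_false_eq_true,
    List.nodup_nil, and_true] at hne
  obtain ⟨⟨n1, n2, n3⟩, ⟨n4, n5⟩, n6⟩ := hne
  simp only [List.toFinset_cons, List.toFinset_nil, insert_empty_eq, insert_subset_iff, singleton_subset_iff] at hK
  obtain ⟨k1, k2, k3, k4⟩ := hK
  replace hc : ∀ i ∈ I, f c i ↔ i ≠ p ∧ i ≠ q := fun i hi => by have := hc i hi; tauto
  replace hu : ∀ i ∈ I, f u i ↔ i ≠ p ∧ i ≠ e ∧ i ≠ e' := fun i hi => by have := hu i hi; tauto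
  replace hw : ∀ i ∈ I, f w i ↔ i ≠ q ∧ i ≠ e ∧ i ≠ e' := fun i hi => by have := hw i hi; tauto
  have l1 := (hc l hl).1 lc
  have l2 := (hu l hl).1 lu
  have hk' : [p, q, e, e', l].Nodup := by
    simp [n1, n2, n3, n4, n5, n6, Ne.symm l1.1, Ne.symm l1.2, Ne.symm l2.2.1, Ne.symm l2.2.2]
  obtain ⟨g', hg', h', hh', hgu', hhw', -, L'⟩ := H.exists_codes (s := 28) (t := 18) (r := 17) hk'
    (by simp [insert_subset_iff, *]) (by simp)
    (fun i hi hn => by simp at hn; simp [hc i hi, hu i hi, hw i hi, hn])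
    (by rintro (_ | _ | _ | _ | _ | i) x hx <;> simp_all [Nat.testBit_eq_decide_div_mod_eq, eq_comm])
    (by rintro (_ | _ | _ | _ | _ | i) x hx <;> simp_all [Nat.testBit_eq_decide_div_mod_eq, eq_comm])
    (by rintro (_ | _ | _ | _ | _ | i) x hx <;> simp_all [Nat.testBit_eq_decide_div_mod_eq, eq_comm])
  clear l1 l2 lc lu lw
  obtain ⟨g, hg, h, hh, hgu, hhw, ha, L⟩ := H.exists_codes (s := 12) (t := 2) (r := 1) hk
    (by simp [insert_subset_iff, *]) (by simp) (fun i hi hn => by simp at hn; simp [hc i hi, hu i hi, hw i hi, hn])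
    (by rintro (_ | _ | _ | _ | i) x hx <;> (clear hgu' hhw' L'; simp_all [Nat.testBit_eq_decide_div_mod_eq, eq_comm]))
    (by rintro (_ | _ | _ | _ | i) x hx <;> (clear hgu' hhw' L'; simp_all [Nat.testBit_eq_decide_div_mod_eq, eq_comm]))
    (by rintro (_ | _ | _ | _ | i) x hx <;> (clear hgu' hhw' L'; simp_all [Nat.testBit_eq_decide_div_mod_eq, eq_comm]))
  have b2 := code_getElem (v := c) (c := g) hk (q := 2) (by simp)
  have b3 := code_getElem (v := c) (c := g) hk (q := 3) (by simp)
  simp only [List.getElem_cons_succ, List.getElem_cons_zero, ← hgu] at b2 b3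
  rw [b2, b3] at he
  have hchk := check_crossed
  simp only [List.all_eq_true, List.mem_range, Bool.or_eq_true, Bool.and_eq_true, Bool.not_eq_true', Nat.beq_eq] at hchk
  rcases hchk g hg h hh with ((h1 | ⟨h1, h2⟩) | ⟨rfl, h2⟩) | h1
  · simp_all
  · simp [h1, h2] at he
  · have e1 : g' = 6 := code_inj (v := c) hk' hg' (by simp) (by rw [← hgu', hgu]; simp [code])
    subst e1
    rcases h2 with rfl | rfl
    · have e2 : h' = 5 := code_inj (v := c) hk' hh' (by simp) (by rw [← hhw', hhw]; simp [code])
      subst e2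
      exact L' _ check_crossed_five
    · have e2 : h' = 9 := code_inj (v := c) hk' hh' (by simp) (by rw [← hhw', hhw]; simp [code])
      subst e2
      exact L' _ check_crossed_nine
  · exact L _ h1

theorem Star.lace_crossed (H : Star f I c u w) (hk : [p, q, e, e'].Nodup) (hK : [p, q, e, e'].toFinset ⊆ I)
    (hc : ∀ i ∈ I, ¬ f c i ↔ i = p ∨ i = q) (hu : ∀ i ∈ I, ¬ f u i ↔ i = p ∨ i = e ∨ i = e')
    (hw : ∀ i ∈ I, ¬ f w i ↔ i = q ∨ i = e ∨ i = e') : Lace f I c := by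
  by_cases he : u e' ≠ c e' → u e ≠ c e
  · exact H.lace_crossed_aux hk hK hc hu hw he
  · have hs : [p, q, e', e].Perm [p, q, e, e'] := ((List.Perm.swap e e' []).cons q).cons p
    exact H.lace_crossed_aux (hs.nodup_iff.2 hk) (List.toFinset_eq_of_perm _ _ hs ▸ hK) hc
      (by simpa only [or_comm (a := _ = e)] using hu) (by simpa only [or_comm (a := _ = e)] using hw) (by tauto)

theorem Star.lace_aligned_aux (H : Star f I c u w) (hk : [p, q, e, e'].Nodup) (hK : [p, q, e, e'].toFinset ⊆ I)
    (hc : ∀ i ∈ I, ¬ f c i ↔ i = p ∨ i = q) (hu : ∀ i ∈ I, ¬ f u i ↔ i = p ∨ i = e ∨ i = e')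
    (hw : ∀ i ∈ I, ¬ f w i ↔ i = p ∨ i = e ∨ i = e') (huq : u q ≠ c q)
    (hwq : w q ≠ c q) (he : u e' ≠ c e' → u e ≠ c e) : Lace f I c := by
  obtain ⟨l, hl, lc, lu, lw⟩ := H.exists_common
  have hne := hk
  simp only [List.nodup_cons, List.mem_cons, List.not_mem_nil, or_false, not_or, not_false_eq_true,
    List.nodup_nil, and_true] at hne
  obtain ⟨⟨n1, n2, n3⟩, ⟨n4, n5⟩, n6⟩ := hne
  simp only [List.toFinset_cons, List.toFinset_nil, insert_empty_eq, insert_subset_iff, singleton_subset_iff] at hK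
  obtain ⟨k1, k2, k3, k4⟩ := hK
  replace hc : ∀ i ∈ I, f c i ↔ i ≠ p ∧ i ≠ q := fun i hi => by have := hc i hi; tauto
  replace hu : ∀ i ∈ I, f u i ↔ i ≠ p ∧ i ≠ e ∧ i ≠ e' := fun i hi => by have := hu i hi; tauto
  replace hw : ∀ i ∈ I, f w i ↔ i ≠ p ∧ i ≠ e ∧ i ≠ e' := fun i hi => by have := hw i hi; tauto
  have l1 := (hc l hl).1 lc
  have l2 := (hu l hl).1 lu
  have hk' : [p, q, e, e', l].Nodup := by
    simp [n1, n2, n3, n4, n5, n6, Ne.symm l1.1, Ne.symm l1.2, Ne.symm l2.2.1, Ne.symm l2.2.2]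
  obtain ⟨g', hg', h', hh', hgu', hhw', -, L'⟩ := H.exists_codes (s := 28) (t := 18) (r := 18) hk'
    (by simp [insert_subset_iff, *]) (by simp)
    (fun i hi hn => by simp at hn; simp [hc i hi, hu i hi, hw i hi, hn])
    (by rintro (_ | _ | _ | _ | _ | i) x hx <;> simp_all [Nat.testBit_eq_decide_div_mod_eq, eq_comm])
    (by rintro (_ | _ | _ | _ | _ | i) x hx <;> simp_all [Nat.testBit_eq_decide_div_mod_eq, eq_comm])
    (by rintro (_ | _ | _ | _ | _ | i) x hx <;> simp_all [Nat.testBit_eq_decide_div_mod_eq, eq_comm])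
  clear l1 l2 lc lu lw
  obtain ⟨g, hg, h, hh, hgu, hhw, ha, L⟩ := H.exists_codes (s := 12) (t := 2) (r := 2) hk
    (by simp [insert_subset_iff, *]) (by simp) (fun i hi hn => by simp at hn; simp [hc i hi, hu i hi, hw i hi, hn])
    (by rintro (_ | _ | _ | _ | i) x hx <;> (clear hgu' hhw' L'; simp_all [Nat.testBit_eq_decide_div_mod_eq, eq_comm]))
    (by rintro (_ | _ | _ | _ | i) x hx <;> (clear hgu' hhw' L'; simp_all [Nat.testBit_eq_decide_div_mod_eq, eq_comm]))
    (by rintro (_ | _ | _ | _ | i) x hx <;> (clear hgu' hhw' L'; simp_all [Nat.testBit_eq_decide_div_mod_eq, eq_comm]))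
  have b1 := code_getElem (v := c) (c := g) hk (q := 1) (by simp)
  have b1' := code_getElem (v := c) (c := h) hk (q := 1) (by simp)
  have b2 := code_getElem (v := c) (c := g) hk (q := 2) (by simp)
  have b3 := code_getElem (v := c) (c := g) hk (q := 3) (by simp)
  simp only [List.getElem_cons_succ, List.getElem_cons_zero, ← hgu, ← hhw] at b1 b1' b2 b3
  rw [b2, b3] at he
  rw [b1] at huq
  rw [b1'] at hwq
  have hchk := check_aligned
  simp only [List.all_eq_true, List.mem_range, Bool.or_eq_true, Bool.and_eq_true, Bool.not_eq_true', Nat.beq_eq] at hchk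
  rcases hchk g hg h hh with ((((h1 | h1) | h1) | ⟨h1, h2⟩) | ⟨rfl, rfl⟩) | h1
  · simp_all
  · simp [h1] at huq
  · simp [h1] at hwq
  · simp [h1, h2] at he
  · have e1 : g' = 6 := code_inj (v := c) hk' hg' (by simp) (by rw [← hgu', hgu]; simp [code])
    have e2 : h' = 10 := code_inj (v := c) hk' hh' (by simp) (by rw [← hhw', hhw]; simp [code])
    subst e1 e2
    exact L' _ check_aligned_ten
  · exact L _ h1

theorem Star.lace_aligned (H : Star f I c u w) (hk : [p, q, e, e'].Nodup) (hK : [p, q, e, e'].toFinset ⊆ I)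
    (hc : ∀ i ∈ I, ¬ f c i ↔ i = p ∨ i = q) (hu : ∀ i ∈ I, ¬ f u i ↔ i = p ∨ i = e ∨ i = e')
    (hw : ∀ i ∈ I, ¬ f w i ↔ i = p ∨ i = e ∨ i = e') (huq : u q ≠ c q)
    (hwq : w q ≠ c q) : Lace f I c := by
  by_cases he : u e' ≠ c e' → u e ≠ c e
  · exact H.lace_aligned_aux hk hK hc hu hw huq hwq he
  · have hs : [p, q, e', e].Perm [p, q, e, e'] := ((List.Perm.swap e e' []).cons q).cons p
    exact H.lace_aligned_aux (hs.nodup_iff.2 hk) (List.toFinset_eq_of_perm _ _ hs ▸ hK) hc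
      (by simpa only [or_comm (a := _ = e)] using hu) (by simpa only [or_comm (a := _ = e)] using hw) huq hwq (by tauto)

end HC

namespace HC
variable {n m : ℕ} {f : Flt n} {I J K : Finset (Fin n)} {b c u v w z x y a : V n} {i j k l p q e e' : Fin n}

theorem E_le_of_star (ha : a ∈ S I b) (h : ∀ z ∈ S I b, ∀ i ∈ I, f z i → z = a ∨ flip i z = a) :
    E f I b ≤ 2 * d f I a := by
  rw [E_rm ha, Nat.add_eq_right.2]
  by_contra hE
  obtain ⟨z, hz, i, hi, hf⟩ := exists_fault hE
  rw [rm_iff] at hf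
  rcases h z hz i hi hf.1 with e | e
  exacts [hf.2.1 e, hf.2.2 e]

theorem Star.lace_nested (H : Star f I c u w) (hp : p ∈ I) (hq : q ∈ I) (he : e ∈ I) (hpq : p ≠ q) (hpe : p ≠ e)
    (hqe : q ≠ e) (hc : ∀ i ∈ I, ¬ f c i ↔ i = p ∨ i = q) (hu : ∀ i ∈ I, ¬ f u i ↔ i = p ∨ i = q ∨ i = e)
    (hw : ∀ i ∈ I, ¬ f w i ↔ i = p ∨ i = q ∨ i = e) : Lace f I c := by
  have hK : {p, q, e} ⊆ I := by simp [insert_subset_iff, *]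
  have h3 : ({p, q, e} : Finset (Fin n)).card = 3 := card_eq_three.2 ⟨p, q, e, hpq, hpe, hqe, rfl⟩
  obtain ⟨H', L⟩ := H.strip hK h3.ge fun i hi hn => by
    have := hc i hi; have := hu i hi; have := hw i hi
    simp only [mem_insert, mem_singleton] at hn; tauto
  refine L (lace_of_few ⟨p, by simp⟩ (Or.inl ?_))
  have h1 : E f {p, q, e} c ≤ 2 * d f {p, q, e} c := by
    refine E_le_of_star self_mem_S fun z hz i hi hf => ?_
    have nu : ¬ f u i := (hu i (hK hi)).2 (by simpa using hi)
    have nw : ¬ f w i := (hw i (hK hi)).2 (by simpa using hi)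
    have hf' := (f.symm z i).2 hf
    rcases H'.cov z hz i hi hf with (e | e | e) | e | e | e
    exacts [Or.inl e, absurd (e ▸ hf) nu, absurd (e ▸ hf) nw, Or.inr e, absurd (e ▸ hf') nu, absurd (e ▸ hf') nw]
  have h2 : d f {p, q, e} c ≤ 1 := by
    refine (card_le_card (t := {e}) fun i hi => ?_).trans (by simp)
    obtain ⟨hi, hf⟩ := mem_filter.1 hi
    have := hc i (hK hi)
    simp only [mem_insert, mem_singleton] at hi ⊢
    tauto
  omega

/-- Two stars in a four-dimensional cube, each healthy in the two directions in which the other is not. -/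
theorem lace_of_pair (hk : [p, q, e, e'].Nodup) (hu : u ∈ S [p, q, e, e'].toFinset c)
    (cov : ∀ z ∈ S [p, q, e, e'].toFinset c, ∀ i ∈ [p, q, e, e'].toFinset, f z i →
      (z = c ∨ z = u) ∨ flip i z = c ∨ flip i z = u) (hup : u p ≠ c p) (huq : u q ≠ c q)
    (cp : ¬ f c p) (cq : ¬ f c q) (ue : ¬ f u e) (ue' : ¬ f u e') : Lace f [p, q, e, e'].toFinset c := by
  obtain ⟨g, hg, hgu⟩ := exists_code hk rfl hu
  have b0 := code_getElem (v := c) (c := g) hk (q := 0) (by simp)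
  have b1 := code_getElem (v := c) (c := g) hk (q := 1) (by simp)
  simp only [List.getElem_cons_succ, List.getElem_cons_zero, ← hgu] at b0 b1
  rw [b0] at hup
  rw [b1] at huq
  have hg0 : g ≠ 0 := by rintro rfl; simp at hup
  have sg : stars 12 g 3 0 0 g = 3 := by
    simp [stars, Bool.eq_false_iff.2 fun h : g.beq 0 = true => hg0 (Nat.eq_of_beq_eq_true h)]
  have key : ∀ z < 2 ^ [p, q, e, e'].length, ∀ i (hi : i < [p, q, e, e'].length),
      f (code [p, q, e, e'] c z) [p, q, e, e'][i] →
      (code [p, q, e, e'] c z = c ∨ code [p, q, e, e'] c z = u) → (stars 12 g 3 0 0 z).testBit i = true := by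
    rintro z hz i hi hf (h | h)
    · obtain rfl := code_inj hk hz (Nat.two_pow_pos _) (h.trans (code_zero _).symm)
      rw [h] at hf
      change Nat.testBit 12 i = true
      clear * - hi hf cp cq
      rcases i with _ | _ | _ | _ | i
      exacts [absurd hf cp, absurd hf cq, rfl, rfl, absurd hi (by simp)]
    · obtain rfl := code_inj hk hz hg (h.trans hgu)
      rw [h] at hf
      rw [sg]
      clear * - hi hf ue ue'
      rcases i with _ | _ | _ | _ | i
      exacts [rfl, rfl, absurd hf ue, absurd hf ue', absurd hi (by simp)]
  have hchk := check_pair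
  simp only [List.all_eq_true] at hchk
  refine lace_of_check hk rfl (fun z hz i hi hf => ?_) (hchk g ?_)
  · rw [faulty, Bool.or_eq_true]
    rcases cov _ (code_mem rfl) _ (List.mem_toFinset.2 (List.getElem_mem hi)) hf with h | h
    · exact Or.inl (key z hz i hi hf h)
    · refine Or.inr (key _ (Nat.xor_lt_two_pow hz (Nat.pow_lt_pow_right (by norm_num) hi)) i hi ?_ ?_) <;>
        rw [code_xor hi]
      exacts [(f.symm _ _).2 hf, h]
  · replace hg : g < 16 := hg
    clear * - hg hup huq
    interval_cases g <;> simp_all [Nat.testBit_eq_decide_div_mod_eq]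

theorem Star.lace_disjoint_aux (H : Star f I c u w) (hk : [p, q, e, e'].Nodup) (hks : k ∉ [p, q, e, e'])
    (hK : insert k [p, q, e, e'].toFinset ⊆ I) (hc : ∀ i ∈ I, ¬ f c i ↔ i = p ∨ i = q)
    (hu : ∀ i ∈ I, ¬ f u i ↔ i = k ∨ i = e ∨ i = e') (hw : ∀ i ∈ I, ¬ f w i ↔ i = k ∨ i = e ∨ i = e')
    (hup : u p ≠ c p) (huq : u q ≠ c q) (huk : u k = c k) (hwk : w k ≠ c k) : Lace f I c := by
  obtain ⟨T, hT⟩ : ∃ T, T = [p, q, e, e'].toFinset := ⟨_, rfl⟩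
  have hkT : k ∉ T := by simpa [hT] using hks
  rw [← hT] at hK
  have hT4 : T.card = 4 := hT ▸ List.toFinset_card_of_nodup hk
  have hTe : (insert k T).erase k = T := erase_insert hkT
  have hkm : k ∈ insert k T := mem_insert_self _ _
  obtain ⟨H', L⟩ := H.strip hK (by rw [card_insert_of_notMem hkT]; omega) fun i hi hn => by
    have := hc i hi; have := hu i hi; have := hw i hi
    simp only [hT, mem_insert, List.mem_toFinset, List.mem_cons, List.not_mem_nil, or_false] at hn; tauto
  have nu : ¬ f u k := (hu k (hK hkm)).2 (Or.inl rfl)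
  have nw : ¬ f w k := (hw k (hK hkm)).2 (Or.inl rfl)
  have huT : u ∈ S T c := hTe ▸ (mem_erase_iff hkm).2 ⟨H'.hu, huk⟩
  have hwT : w ∈ S T (flip k c) := hTe ▸ (mem_erase_flip_iff hkm).2 ⟨H'.hw, hwk⟩
  have hfl : ∀ z, ∀ i ∈ T, flip i z k = z k := fun z i hi => flip_other (by rintro rfl; exact hkT hi) z
  refine L (lace_split hkm ?_ ?_ ?_) <;> rw [hTe]
  · subst hT
    refine lace_of_pair hk huT (fun z hz i hi hf => ?_) hup huq ((hc p (hK (by simp))).2 (by simp))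
      ((hc q (hK (by simp))).2 (by simp)) ((hu e (hK (by simp))).2 (by simp))
      ((hu e' (hK (by simp))).2 (by simp))
    have hz' := hz
    rw [← hTe, mem_erase_iff hkm] at hz'
    have hz2 := (hfl z i hi).trans hz'.2
    rcases H'.cov z hz'.1 i (mem_insert_of_mem hi) hf with (h | h | h) | h | h | h
    exacts [Or.inl (Or.inl h), Or.inl (Or.inr h), absurd (h ▸ hz'.2) hwk, Or.inr (Or.inl h), Or.inr (Or.inr h),
      absurd (h ▸ hz2) hwk]
  · refine lace_of_few (card_pos.1 (by omega)) (Or.inl ?_)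
    have h1 : E f T (flip k c) ≤ 2 * d f T w := by
      refine E_le_of_star hwT fun z hz i hi hf => ?_
      rw [← hTe, mem_erase_flip_iff hkm] at hz
      have hz' := (hfl z i hi).trans_ne hz.2
      rcases H'.cov z hz.1 i (mem_insert_of_mem hi) hf with (h | h | h) | h | h | h
      exacts [absurd (h ▸ rfl) hz.2, absurd (h ▸ huk) hz.2, Or.inl h, absurd (h ▸ rfl) hz', absurd (h ▸ huk) hz', Or.inr h]
    have h2 : d f T w ≤ 2 := by
      refine (card_le_card (t := {p, q}) fun i hi => ?_).trans card_le_two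
      obtain ⟨hi, hf⟩ := mem_filter.1 hi
      have := hw i (hK (mem_insert_of_mem hi))
      have : i ∈ [p, q, e, e'].toFinset := hT ▸ hi
      simp only [List.mem_toFinset, List.mem_cons, List.not_mem_nil, or_false] at this
      rw [mem_insert, mem_singleton]
      clear * - this hw hK hi hf
      grind
    omega
  · have hB : (Bl f T c k).card ≤ 1 := by
      refine (card_le_card (t := {c}) fun z hz => ?_).trans (by simp)
      obtain ⟨hz, hf⟩ := mem_Bl.1 hz
      rw [← hTe, mem_erase_iff hkm] at hz
      have hz' : flip k z k ≠ c k := by rw [flip_same, hz.2]; simp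
      have hf' := (f.symm z k).2 hf
      rw [mem_singleton]
      rcases H'.cov z hz.1 k hkm hf with (h | h | h) | h | h | h
      exacts [h, absurd (h ▸ hf) nu, absurd (h ▸ hf) nw, absurd (h ▸ rfl) hz', absurd (h ▸ hf') nu, absurd (h ▸ hf') nw]
    rw [hT4]
    omega
end HC

namespace HC
variable {n m : ℕ} {f : Flt n} {I J K : Finset (Fin n)} {b c u v w z x y a : V n} {i j k l p q e e' : Fin n}

theorem Star.lace_disjoint (H : Star f I c u w) (hp : p ∈ I) (hq : q ∈ I) (hpq : p ≠ q)
    (hc : ∀ i ∈ I, ¬ f c i ↔ i = p ∨ i = q) (fp : f u p) (fq : f u q) (huw : ∀ i ∈ I, f u i ↔ f w i)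
    (hup : u p ≠ c p) (huq : u q ≠ c q) (hwp : w p ≠ c p) (hwq : w q ≠ c q) : Lace f I c := by
  obtain ⟨k, hk⟩ : ∃ k, u k ≠ w k := by
    by_contra! h
    exact H.hwu (funext h).symm
  have hkI : k ∈ I := by
    by_contra h
    exact hk ((mem_S.1 H.hu k h).trans (mem_S.1 H.hw k h).symm)
  have hkp : k ≠ p := by rintro rfl; exact hk ((Bool.eq_not.2 hup).trans (Bool.eq_not.2 hwp).symm)
  have hkq : k ≠ q := by rintro rfl; exact hk ((Bool.eq_not.2 huq).trans (Bool.eq_not.2 hwq).symm)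
  have nuk : ¬ f u k := fun h => by
    obtain ⟨h1, h2⟩ := H.near k hkI (not_not.1 fun hn => ((hc k hkI).1 hn).elim hkp hkq) (Or.inl h)
    exact hk (h1.trans h2.symm)
  have hkG : k ∈ I.filter (fun i => ¬ f u i) := mem_filter.2 ⟨hkI, nuk⟩
  have hG : (I.filter fun i => ¬ f u i).card = 3 := H.gu
  obtain ⟨e, e', hee, hE⟩ := card_eq_two.1 ((card_erase_of_mem hkG).trans (by rw [hG]))
  have hu : ∀ i ∈ I, ¬ f u i ↔ i = k ∨ i = e ∨ i = e' := fun i hi => by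
    have := Finset.ext_iff.1 hE i
    simp only [mem_erase, mem_filter, mem_insert, mem_singleton] at this
    grind
  have hw : ∀ i ∈ I, ¬ f w i ↔ i = k ∨ i = e ∨ i = e' := fun i hi => by rw [← huw i hi, hu i hi]
  have he : e ∈ I ∧ e ≠ k := by
    have := Finset.ext_iff.1 hE e
    simp at this; tauto
  have he' : e' ∈ I ∧ e' ≠ k := by
    have := Finset.ext_iff.1 hE e'
    simp at this; tauto
  have ne1 : ∀ i ∈ I, f u i → i ≠ e ∧ i ≠ e' := fun i hi h => by have := hu i hi; tauto
  have h1 : [p, q, e, e'].Nodup := by simp [hpq, ne1 p hp fp, ne1 q hq fq, hee]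
  have h2 : k ∉ [p, q, e, e'] := by simp [hkp, hkq, he.2.symm, he'.2.symm]
  have h3 : insert k [p, q, e, e'].toFinset ⊆ I := by simp [insert_subset_iff, *]
  by_cases huk : u k = c k
  · exact H.lace_disjoint_aux h1 h2 h3 hc hu hw hup huq huk fun h => hk (huk.trans h.symm)
  · exact H.swap.lace_disjoint_aux h1 h2 h3 hc hw hu hwp hwq (by
      by_contra h; exact hk ((Bool.eq_not.2 huk).trans (Bool.eq_not.2 h).symm)) huk

theorem Star.six_le_card (H : Star f I c u w) (hk : k ∈ I) (hf : f u k) (h : ¬ f c k ∨ ¬ f w k) : 6 ≤ I.card := by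
  have hG : (I.filter fun i => ¬ f u i).card = 3 := H.gu
  have h2 := H.two
  have hd : Disjoint (I.filter fun i => ¬ f u i) (I.filter fun i => f c i ∧ f u i ∧ f w i) :=
    disjoint_filter.2 fun i _ h1 h2 => h1 h2.2.1
  have hs : insert k (I.filter (fun i => ¬ f u i) ∪ I.filter fun i => f c i ∧ f u i ∧ f w i) ⊆ I :=
    insert_subset hk (union_subset (filter_subset _ _) (filter_subset _ _))
  have := card_le_card hs
  rw [card_insert_of_notMem (by simp [hf, -not_and]; tauto), card_union_of_disjoint hd] at this
  omega

theorem exists_of_gd_le (h : gd f I w ≤ gd f I u) (hj : j ∈ I) (hu : f u j) (hw : ¬ f w j) :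
    ∃ k ∈ I, f w k ∧ ¬ f u k := by
  by_contra! hn
  refine absurd (card_lt_card (s := I.filter fun i => ¬ f u i) (t := I.filter fun i => ¬ f w i) ?_) (not_lt.2 h)
  refine Finset.ssubset_iff_subset_ne.2 ⟨fun i hi => ?_, fun e => ?_⟩
  · rw [mem_filter] at hi ⊢
    exact ⟨hi.1, fun h => hi.2 (hn i hi.1 h)⟩
  · exact (mem_filter.1 (e.symm ▸ mem_filter.2 ⟨hj, hw⟩ : j ∈ I.filter fun i => ¬ f u i)).2 hu

theorem Star.lace_of_terminal (H : Star f I c u w) (hc : ∀ i ∈ I, f c i → (f u i ↔ f w i))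
    (hs : ∀ i ∈ I, ¬ f c i → f u i → f w i → u i ≠ c i) : Lace f I c := by
  obtain ⟨p, q, hpq, hG⟩ := card_eq_two.1 (H.gc : (I.filter fun i => ¬ f c i).card = 2)
  have hG' : ∀ i, (i ∈ I ∧ ¬ f c i) ↔ i = p ∨ i = q := fun i => by
    simpa using Finset.ext_iff.1 hG i
  have hp := (hG' p).2 (Or.inl rfl)
  have hq := (hG' q).2 (Or.inr rfl)
  have hcI : ∀ i ∈ I, ¬ f c i ↔ i = p ∨ i = q := fun i hi => by rw [← hG', and_iff_right hi]
  have hqJ : q ∉ (I.erase p).erase q := by simp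
  have hpJ : p ∉ insert q ((I.erase p).erase q) := by simp [hpq]
  have hI : I = insert p (insert q ((I.erase p).erase q)) := by
    rw [insert_erase (mem_erase.2 ⟨hpq.symm, hq.1⟩), insert_erase hp.1]
  have hT : ((I.erase p).erase q).filter (fun i => ¬ f w i) = ((I.erase p).erase q).filter fun i => ¬ f u i := by
    refine filter_congr fun i hi => ?_
    simp only [mem_erase] at hi
    rw [hc i hi.2.2 (not_not.1 fun h => ((hcI i hi.2.2).1 h).elim hi.2.1 hi.1)]
  have count : ∀ z, (I.filter fun i => ¬ f z i).card = (((I.erase p).erase q).filter fun i => ¬ f z i).card +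
      (if f z q then 0 else 1) + if f z p then 0 else 1 := fun z => by
    conv_lhs => rw [hI]
    rw [filter_insert, filter_insert]
    clear * - hpq
    split_ifs
    · simp
    · rw [card_insert_of_notMem (by simp)]
    · rw [card_insert_of_notMem (by simp)]
    · rw [card_insert_of_notMem (by simp [hpq]), card_insert_of_notMem (by simp)]
  have cu := (count u).symm.trans H.gu
  have cw := (count w).symm.trans H.gw
  rw [hT] at cw
  clear count
  obtain ⟨T, hTd⟩ : ∃ T, T = ((I.erase p).erase q).filter fun i => ¬ f u i := ⟨_, rfl⟩
  have mT : ∀ i, i ∈ T ↔ (i ≠ q ∧ i ≠ p ∧ i ∈ I) ∧ ¬ f u i := fun i => by simp [hTd]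
  have mT' : ∀ i, i ∈ T ↔ (i ≠ q ∧ i ≠ p ∧ i ∈ I) ∧ ¬ f w i := fun i => by simp [hTd, ← hT]
  rw [← hTd] at cu cw
  clear hTd hT
  clear hG' hG hI hpJ hqJ hc
  have two : T.card = 2 → ∃ e e', [p, q, e, e'].Nodup ∧ [q, p, e, e'].Nodup ∧ [p, q, e, e'].toFinset ⊆ I ∧
      [q, p, e, e'].toFinset ⊆ I ∧ ∀ i, i ∈ T ↔ i = e ∨ i = e' := fun h => by
    obtain ⟨e, e', hee, rfl⟩ := card_eq_two.1 h
    have h1 := (mT e).1 (by simp)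
    have h2 := (mT e').1 (by simp)
    refine ⟨e, e', ?_⟩
    simp [insert_subset_iff, hp.1, hq.1, h1.1, h2.1, hpq, hpq.symm, hee, h1.1.1.symm, h1.1.2.1.symm, h2.1.1.symm,
      h2.1.2.1.symm]
  by_cases up : f u p <;> by_cases uq : f u q <;> by_cases wp : f w p <;> by_cases wq : f w q <;>
    simp only [up, uq, wp, wq, if_true, if_false] at cu cw <;> try omega
  · exact H.lace_disjoint hp.1 hq.1 hpq hcI up uq
      (fun i hi => by have := mT i; have := mT' i; by_cases i = p <;> by_cases i = q <;> grind)
      (hs p hp.1 hp.2 up wp) (hs q hq.1 hq.2 uq wq)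
      (H.same p hp.1 hp.2 up wp ▸ hs p hp.1 hp.2 up wp) (H.same q hq.1 hq.2 uq wq ▸ hs q hq.1 hq.2 uq wq)
  · obtain ⟨e, e', -, hk, -, hK, hT⟩ := two (by omega)
    exact H.lace_aligned hk hK (fun i hi => (hcI i hi).trans or_comm) (by grind) (by grind) (hs p hp.1 hp.2 up wp)
      (H.same p hp.1 hp.2 up wp ▸ hs p hp.1 hp.2 up wp)
  · obtain ⟨e, e', -, hk, -, hK, hT⟩ := two (by omega)
    exact H.lace_crossed hk hK (fun i hi => (hcI i hi).trans or_comm) (by grind) (by grind)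
  · obtain ⟨e, e', hk, -, hK, -, hT⟩ := two (by omega)
    exact H.lace_crossed hk hK hcI (by grind) (by grind)
  · obtain ⟨e, e', hk, -, hK, -, hT⟩ := two (by omega)
    exact H.lace_aligned hk hK hcI (by grind) (by grind) (hs q hq.1 hq.2 uq wq)
      (H.same q hq.1 hq.2 uq wq ▸ hs q hq.1 hq.2 uq wq)
  · obtain ⟨e, rfl⟩ := card_eq_one.1 (show T.card = 1 by omega)
    have he := (mT e).1 (by simp)
    simp only [mem_singleton] at mT mT'
    exact H.lace_nested hp.1 hq.1 he.1.2.2 hpq he.1.2.1.symm he.1.1.symm hcI (by grind) (by grind)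

theorem Star.lace (H : Star f I c u w) : Lace f I c := by
  induction hN : I.card using Nat.strong_induction_on generalizing f I with | _ N ih
  by_contra hL
  have ih' : ∀ a k j, j ∈ I → Star (f.un a k) (I.erase j) c u w → Lace (f.un a k) (I.erase j) c := fun a k j hj h =>
    ih _ (hN ▸ card_erase_lt_of_mem hj) h rfl
  have key : ∀ {u w}, Star f I c u w → (∀ a k j, j ∈ I → Star (f.un a k) (I.erase j) c u w →
      Lace (f.un a k) (I.erase j) c) → ∀ j ∈ I, f c j → f u j → f w j := fun {u w} H ih j hj hc hu => by
    by_contra hw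
    obtain ⟨k, hk, wk, uk⟩ := exists_of_gd_le (H.gw.trans H.gu.symm).le hj hu hw
    obtain ⟨e1, e2⟩ := H.near j hj hc (Or.inl hu)
    exact hL (H.step (H.swap.six_le_card hk wk (Or.inr uk)) (Or.inr ⟨rfl, rfl⟩) hj e1 e2 hw hu hc hk wk uk (ih w k j hj))
  refine hL (H.lace_of_terminal (fun i hi hc => ⟨key H ih' i hi hc, key H.swap (fun a k j hj h => ih' a k j hj h.swap) i hi hc⟩)
    fun j hj hc hu hw he => hL ?_)
  obtain ⟨k, hk, ck, uk⟩ := exists_of_gd_le (f := f) (w := c) (u := u) (by rw [H.gc, H.gu]; norm_num) hj hu hc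
  exact H.step (H.six_le_card hj hu (Or.inl hc)) (Or.inl ⟨rfl, rfl⟩) hj he ((H.same j hj hc hu hw).symm.trans he)
    hc hu hw hk ck uk (ih' c k j hj)
end HC

namespace HC
variable {n m : ℕ} {f : Flt n} {I J K : Finset (Fin n)} {b c u v w z x y a : V n} {i j k : Fin n}

namespace Three

theorem cov (hE : E (((f.rm c).rm u).rm w) I c = 0) (hz : z ∈ S I c) (hi : i ∈ I) (hf : f z i) :
    (z = c ∨ z = u ∨ z = w) ∨ flip i z = c ∨ flip i z = u ∨ flip i z = w := by
  have := not_fault_of_E hE hz hi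
  simp only [rm_iff] at this
  tauto

theorem Bl_sub (hE : E (((f.rm c).rm u).rm w) I c = 0) (hj : j ∈ I) (hu : u j ≠ c j) (hw : w j = c j) :
    ∀ z ∈ Bl f (I.erase j) c j, (z = c ∧ f c j) ∨ (z = w ∧ f w j) ∨ z = flip j u := by
  intro z hz
  obtain ⟨hz, hf⟩ := mem_Bl.1 hz
  obtain ⟨hz, hzj⟩ := (mem_erase_iff hj).1 hz
  have hn : flip j z j ≠ c j := by rw [flip_same, hzj]; simp
  rcases cov hE hz hj hf with (h | h | h) | h | h | h
  exacts [Or.inl ⟨h, h ▸ hf⟩, absurd (h ▸ hzj) hu, Or.inr (Or.inl ⟨h, h ▸ hf⟩), absurd (h ▸ rfl) hn,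
    Or.inr (Or.inr (h ▸ (flip_flip j z).symm)), absurd (h ▸ hw) hn]

variable (D : Three f I c 8 u w) (hE : E (((f.rm c).rm u).rm w) I c = 0)
include D hE

theorem opp_E (hj : j ∈ I) (huj : f u j) (hu : u j ≠ c j) (hw : w j = c j) :
    E f (I.erase j) (flip j c) ≤ 10 := by
  have huS := (mem_erase_flip_iff hj).2 ⟨D.hu, hu⟩
  have h1 := E_le_of_star huS fun z hz i hi hf => by
    obtain ⟨hz, hzj⟩ := (mem_erase_flip_iff hj).1 hz
    obtain ⟨hij, hi⟩ := mem_erase.1 hi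
    have hn : flip i z j ≠ c j := by rwa [flip_other hij.symm]
    rcases cov hE hz hi hf with (h | h | h) | h | h | h
    exacts [absurd (h ▸ rfl) hzj, Or.inl h, absurd (h ▸ hw) hzj, absurd (h ▸ rfl) hn, Or.inr h, absurd (h ▸ hw) hn]
  have h2 := d_erase (f := f) (z := u) hj
  rw [if_pos huj] at h2
  have := D.du
  omega

theorem lace_near (hj : j ∈ I) (hcj : f c j) (huj : f u j) (hn : ¬ (u j = c j ∧ w j = c j)) : Lace f I c := by
  by_cases h : u j ≠ c j ∧ w j = c j ∧ ¬ f w j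
  · obtain ⟨hu, hw, hwj⟩ := h
    refine D.lace_third hj hcj huj hwj hw ?_ (by have := D.opp_E hE hj huj hu hw; omega) (Or.inr hu)
    refine (card_le_card (t := {c, flip j u}) fun z hz => ?_).trans card_le_two
    rw [mem_insert, mem_singleton]
    rcases Bl_sub hE hj hu hw z hz with h | h | h
    exacts [Or.inl h.1, absurd h.2 hwj, Or.inr h]
  · refine D.lace_M' hj ?_ (fun _ => hcj) (fun _ => Or.inr huj) (fun hw => Or.inr ?_) fun _ => Or.inl huj
    all_goals tauto

theorem lace_same (hdc : d f I c = 7) (hj : j ∈ I) (hcj : ¬ f c j) (huj : f u j) (hwj : f w j)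
    (hu : u j ≠ c j) (hw : w j = c j) : Lace f I c := by
  have h1 := D.opp_E hE hj huj hu hw
  have hB : (Bl f (I.erase j) c j).card ≤ 2 := by
    refine (card_le_card (t := {w, flip j u}) fun z hz => ?_).trans card_le_two
    rw [mem_insert, mem_singleton]
    rcases Bl_sub hE hj hu hw z hz with h | h | h
    exacts [absurd h.2 hcj, Or.inl h.1, Or.inr h]
  obtain ⟨k, hk, hkB⟩ : ∃ k ∈ I.filter (f c), flip k c ∉ Bl f (I.erase j) c j := by
    by_contra! h
    have := card_le_card_of_injOn (s := I.filter (f c)) (t := Bl f (I.erase j) c j) (fun i => flip i c) h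
      fun i _ k _ h => (flip_dir_inj _ _ _).1 h
    change d f I c ≤ _ at this
    omega
  obtain ⟨hkI, hck⟩ := mem_filter.1 hk
  have hkj : k ≠ j := by rintro rfl; exact hcj hck
  have hkIj := mem_erase.2 ⟨hkj, hkI⟩
  have hb := (flip_mem hkIj).2 (self_mem_S (b := c))
  have nb := not_Bl_iff hb hkB
  have hbS := S_erase_sub hb
  have hbu : flip k c ≠ u := fun h => nb (h ▸ huj)
  have hbw : flip k c ≠ w := fun h => nb (h ▸ hwj)
  have db : d f I (flip k c) ≤ 3 := by
    have e1 := d_rm (f := f) (I := I) (flip_ne k c)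
    have e2 := d_rm (f := f.rm c) (I := I) hbu
    have e3 := d_rm (f := (f.rm c).rm u) (I := I) hbw
    have e4 := two_d_le (f := ((f.rm c).rm u).rm w) hbS
    have a1 := adj_le_one (f := f) (I := I) (v := c) (u := flip k c)
    have a2 := adj_le_one (f := f.rm c) (I := I) (v := u) (u := flip k c)
    have a3 := adj_le_one (f := (f.rm c).rm u) (I := I) (v := w) (u := flip k c)
    omega
  have hgd := D.gd_add hj nb
  have hF := D.faults
  have hs := E_split (f := f) (c := c) hj
  have h2 := two_d_le (f := f) ((mem_erase_flip_iff hj).2 ⟨D.hu, hu⟩)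
  have h3 := d_erase (f := f) (z := u) hj
  rw [if_pos huj] at h3
  have hdu := D.du
  have c8 : cap 8 = 15 := rfl
  have c9 : cap (8 + 1) = 19 := rfl
  have hdet := D.det hj hkIj self_mem_S hck hcj nb (by omega) (Or.inl (by omega))
    (fun z hz h => Or.inr (Or.inl (D.tight (S_erase_sub hz) h))) fun z hz y hy hzy h1 h2 =>
      D.pairs (P := fun z y => (d f I z + 2 = 8 ∧ (f z j ∨ z = c ∨ z = flip k c)) ∨
        (d f I y + 2 = 8 ∧ (f y j ∨ y = c ∨ y = flip k c))) (fun _ _ h => h.symm) (Or.inr ⟨D.du, Or.inl huj⟩)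
        (Or.inr ⟨D.dw, Or.inl hwj⟩) (Or.inl ⟨D.du, Or.inl huj⟩) (S_erase_sub hz) (S_erase_sub hy) hzy h1 h2
  have hle := card_filter_le (Bl f (I.erase j) c j) fun z => par z = par (flip k c)
  exact hdet.lace_one_end (cond_of_few hb (by omega) (by omega)) (by omega)

end Three

theorem exists_two_common (hI : I.card = 9) (hc : gd f I c = 2) (hu : gd f I u = 3) (hw : gd f I w = 3)
    (h : ∃ j ∈ I, (f c j → ¬ f u j ∧ ¬ f w j) ∧ (¬ f c j → ¬ f u j ∨ ¬ f w j)) :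
    2 ≤ (I.filter fun i => f c i ∧ f u i ∧ f w i).card := by
  obtain ⟨j, hj, h⟩ := h
  have key := sum_le_sum fun (i : Fin n) (hi : i ∈ I) => (show 1 + (if i = j then 1 else 0) ≤
    (if ¬ f c i then 1 else 0) + (if ¬ f u i then 1 else 0) + (if ¬ f w i then 1 else 0) +
      if f c i ∧ f u i ∧ f w i then 1 else 0 by
    by_cases e : i = j
    · subst e; by_cases h1 : f c i <;> by_cases h2 : f u i <;> by_cases h3 : f w i <;> simp_all
    · by_cases h1 : f c i <;> by_cases h2 : f u i <;> by_cases h3 : f w i <;> simp_all)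
  simp only [sum_add_distrib, ← card_filter, sum_ite_eq', sum_const, hj, if_true, hI] at key
  change _ ≤ gd f I c + gd f I u + gd f I w + _ at key
  simp only [hc, hu, hw] at key
  simp at key
  omega

theorem Three.lace_nine (D : Three f I c 8 u w) (hdc : d f I c = 7) (hE : E f I c = 38) (hcu : adj f I c u = 0)
    (hcw : adj f I c w = 0) (huw : adj f I u w = 0) : Lace f I c := by
  by_contra hL
  have hdu := D.du
  have hdw := D.dw
  have hc := D.card
  have h3 := E_rm3 (f := f) self_mem_S D.hu D.hw D.huc D.hwc D.hwu
  have hE0 : E (((f.rm c).rm u).rm w) I c = 0 := by omega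
  have hE0' : E (((f.rm c).rm w).rm u) I c = 0 := by rwa [rm_comm]
  have far : ∀ {x y}, adj f I x y = 0 → ∀ i ∈ I, f x i → flip i x ≠ y := by
    rintro x y h i hi hf rfl
    rw [one_le_adj hi hf] at h
    cases h
  have near : ∀ i ∈ I, f c i → f u i ∨ f w i → u i = c i ∧ w i = c i := fun i hi h1 h2 => by
    by_contra hn
    rcases h2 with h2 | h2
    · exact hL (D.lace_near hE0 hi h1 h2 hn)
    · exact hL (D.swap.lace_near hE0' hi h1 h2 fun h => hn h.symm)
  have same : ∀ i ∈ I, ¬ f c i → f u i → f w i → u i = w i := fun i hi h1 h2 h3 => by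
    by_contra hn
    by_cases h : w i = c i
    · exact hL (D.lace_same hE0 hdc hi h1 h2 h3 (h ▸ hn) h)
    · have : u i = c i := by
        by_contra h'
        exact hn ((Bool.eq_not.2 h').trans (Bool.eq_not.2 h).symm)
      exact hL (D.swap.lace_same hE0' hdc hi h1 h3 h2 h this)
  have g1 := gd_add_d (f := f) (J := I) (a := c)
  have g2 := gd_add_d (f := f) (J := I) (a := u)
  have g3 := gd_add_d (f := f) (J := I) (a := w)
  obtain ⟨j, hj⟩ : ∃ j, u j ≠ w j := by
    by_contra! h
    exact D.hwu (funext h).symm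
  have hjI : j ∈ I := by
    by_contra h
    exact hj ((mem_S.1 D.hu j h).trans (mem_S.1 D.hw j h).symm)
  refine hL (Star.lace (u := u) (w := w) ⟨⟨D.hu, D.hw, D.huc, D.hwc, D.hwu, fun z hz i hi => cov hE0 hz hi, far hcu,
    far hcw, far huw, near, same⟩, by omega, by omega, by omega,
    exists_two_common (by omega) (by omega) (by omega) (by omega) ⟨j, hjI, fun h => ?_, fun h => ?_⟩⟩)
  · by_contra h'
    obtain ⟨e1, e2⟩ := near j hjI h (by tauto)
    exact hj (e1.trans e2.symm)
  · by_contra h'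
    exact hj (same j hjI h (by tauto) (by tauto))

end HC

namespace HC
variable {n m : ℕ} {f : Flt n} {I J K : Finset (Fin n)} {b c u v w z x y a : V n} {i j k : Fin n}

theorem tol_step (hm : 5 ≤ m) (T : Tol n m) (T' : 8 ≤ m → Tol n (m - 1)) : Tol n (m + 1) := by
  intro f I b hI hd hu hE
  have D : Ctx f I b m := ⟨hm, T, hI, fun z hz => by have := hd z hz; omega,
    fun z hz w hw h1 h2 => hu (by omega) z hz w hw (by omega) (by omega), hE⟩
  obtain h | hne := ((S I b).filter fun z => m ≤ d f I z + 2).eq_empty_or_nonempty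
  · rw [filter_eq_empty_iff] at h
    exact D.lace_no_big fun z hz => by have := h hz; omega
  obtain ⟨c, hc, hmax⟩ := exists_max_image _ (d f I) hne
  simp only [mem_filter, and_imp] at hc hmax
  rw [← Lace_congr hc.1]
  rw [← S_eq hc.1] at hmax
  replace D := D.move hc.1
  have eq : ∀ z ∈ S I c, z ≠ c → m ≤ d f I z + 2 → d f I z + 2 = m := fun z hz hzc h => by
    have h1 := D.deg z hz
    have h2 := D.deg c self_mem_S
    have h3 := hmax z hz h
    by_contra h4
    exact hzc (D.uniq z hz c self_mem_S (by omega) (by omega))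
  by_cases h1 : ∀ z ∈ S I c, z ≠ c → d f I z + 3 ≤ m
  · exact D.lace_one_big hc.2 h1
  push Not at h1
  obtain ⟨u, hu, huc, du⟩ := h1
  replace du := eq u hu huc (by omega)
  by_cases h2 : ∀ z ∈ S I c, z ≠ c → z ≠ u → d f I z + 3 ≤ m
  · exact D.lace_two_big T' hu huc hc.2 du h2
  push Not at h2
  obtain ⟨w, hw, hwc, hwu, dw⟩ := h2
  replace dw := eq w hw hwc (by omega)
  by_cases h3 : ∀ z ∈ S I c, m ≤ d f I z + 2 → z = c ∨ z = u ∨ z = w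
  · have H : Three f I c m u w := ⟨D, hu, hw, huc, hwc, hwu, hc.2, du, dw, h3⟩
    exact H.lace fun hm => by subst hm; exact H.lace_nine
  push Not at h3
  obtain ⟨e, he, de, hec, heu, hew⟩ := h3
  exact (⟨D, self_mem_S, hu, hw, he, huc, hwc, hec, hwu, heu, hew, hc.2, by omega, by omega, de⟩ : Four f I c m c u w e).lace

theorem tol (h : 4 ≤ m) : Tol n m := by
  induction m using Nat.strong_induction_on with
  | _ m ih =>
    rcases Nat.lt_or_ge 5 m with h5 | h5
    · obtain ⟨m, rfl⟩ : ∃ k, m = k + 1 := ⟨m - 1, by omega⟩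
      exact tol_step (by omega) (ih m (by omega) (by omega)) fun _ => ih _ (by omega) (by omega)
    · obtain rfl | rfl : m = 4 ∨ m = 5 := by omega
      · exact tol_four
      · exact tol_five

theorem Q_adj : (Q n).Adj x y ↔ ∃ i, y = flip i x := by
  have key : ∀ x y : V n, (univ.filter fun i => x i ≠ y i).card = 1 ↔ ∃ i, y = flip i x := fun x y => by
    rw [card_eq_one]
    refine exists_congr fun i => ⟨fun h => ?_, ?_⟩
    · ext k
      have hk := congrArg (k ∈ ·) h
      simp only [mem_filter, mem_univ, true_and, mem_singleton, eq_iff_iff] at hk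
      by_cases hki : k = i
      · subst hki
        rw [flip_same]
        have := hk.2 rfl
        revert this
        cases x k <;> cases y k <;> simp
      · rw [flip_other hki]
        by_contra hne
        exact hki (hk.1 (Ne.symm hne))
    · rintro rfl
      ext k
      simp only [mem_filter, mem_univ, true_and, mem_singleton]
      refine ⟨fun h => ?_, ?_⟩
      · by_contra hk
        exact h (flip_other hk x).symm
      · rintro rfl; simp
  rw [Q, fromRel_adj, key, key]
  constructor
  · rintro ⟨-, ⟨i, rfl⟩ | ⟨i, rfl⟩⟩
    · exact ⟨i, rfl⟩
    · exact ⟨i, by simp⟩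
  · rintro ⟨i, rfl⟩
    exact ⟨ne_flip i x, .inl ⟨i, rfl⟩⟩

/-- The faults given by a set of edges. -/
def Flt.ofEdges (F : Finset (Sym2 (V n))) : Flt n where
  p z i := s(z, flip i z) ∈ F
  symm z i := by rw [flip_flip, Sym2.eq_swap]

variable {F : Finset (Sym2 (V n))}

theorem adj_of_R (h : R (.ofEdges F) x y) : ((Q n).deleteEdges ↑F).Adj x y := by
  obtain ⟨i, rfl, h⟩ := h
  rw [deleteEdges_adj]
  exact ⟨Q_adj.2 ⟨i, rfl⟩, h⟩

theorem Path.exists_walk {α : Type*} {R : α → α → Prop} {G : SimpleGraph α} (hG : ∀ {x y}, R x y → G.Adj x y)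
    {M : Multiset α} {x y : α} (h : Path R M x y) : ∃ p : G.Walk x y, (p.support : Multiset α) = M := by
  induction h with
  | single x => exact ⟨.nil, rfl⟩
  | cons e _ ih =>
    obtain ⟨p, rfl⟩ := ih
    exact ⟨.cons (hG e) p, rfl⟩

theorem faultyDeg_add_d (v : V n) : faultyDeg F v + d (.ofEdges F) univ v = n := by
  have h : ((Q n).deleteEdges ↑F).neighborSet v = ↑((univ.filter fun i => ¬ Flt.ofEdges F v i).image (flip · v)) := by
    ext z
    simp only [mem_neighborSet, deleteEdges_adj, Q_adj, coe_image, coe_filter, mem_univ, true_and, Set.mem_image,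
      Set.mem_ofPred_eq]
    constructor
    · rintro ⟨⟨i, rfl⟩, h⟩; exact ⟨i, h, rfl⟩
    · rintro ⟨i, h, rfl⟩; exact ⟨⟨i, rfl⟩, h⟩
  rw [faultyDeg, h, Set.ncard_coe_finset, card_image_of_injective _ fun i k h => (flip_dir_inj _ _ _).1 h, d, add_comm,
    card_filter_add_card_filter_not, card_univ, Fintype.card_fin]

theorem E_ofEdges_le : E (.ofEdges F) univ b ≤ 2 * F.card := by
  have h : E (.ofEdges F) univ b = ((univ : Finset (V n × Fin n)).filter fun q => s(q.1, flip q.2 q.1) ∈ F).card := by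
    have : S univ b = univ := by ext; simp [mem_S]
    rw [E, this, card_filter, Fintype.sum_prod_type]
    refine sum_congr rfl fun z _ => ?_
    rw [d, card_filter]
    exact sum_congr rfl fun i _ => if_congr Iff.rfl rfl rfl
  rw [h]
  refine card_le_mul_card_image_of_maps_to (f := fun q : V n × Fin n => s(q.1, flip q.2 q.1))
    (fun q hq => (mem_filter.1 hq).2) 2 fun e _ => ?_
  induction e with | _ a a' =>
  refine (card_le_card_of_injOn Prod.fst (t := {a, a'}) (fun q hq => ?_) fun q hq r hr h => ?_).trans card_le_two
  · simp only [coe_filter, Set.mem_ofPred_eq, Sym2.eq_iff] at hq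
    rcases hq.2 with h | h <;> simp [h.1]
  · simp only [coe_filter, Set.mem_ofPred_eq] at hq hr
    obtain ⟨q1, q2⟩ := q
    obtain ⟨r1, r2⟩ := r
    obtain rfl : q1 = r1 := h
    have h := hq.2.trans hr.2.symm
    rw [Sym2.congr_right, flip_dir_inj] at h
    exact congrArg _ h

end HC

theorem main_fault_tolerant_hamiltonian_laceable (n : ℕ) (hn : 5 ≤ n)
    (F : Finset (Sym2 (Fin n → Bool)))
    (hFE : (F : Set (Sym2 (Fin n → Bool))) ⊆ (Q n).edgeSet)
    (hF : F.card ≤ 4 * n - 17)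
    (hdeg2 : ∀ v, 2 ≤ faultyDeg F v)
    (hone : ∀ v w, faultyDeg F v = 2 → faultyDeg F w = 2 → v = w)
    (x y : Fin n → Bool) (hxy : qparity x ≠ qparity y) :
    ∃ p : ((Q n).deleteEdges ↑F).Walk x y, p.IsHamiltonian := by
  have hmem : ∀ z, z ∈ HC.S univ x := fun z => by simp [HC.mem_S]
  have hd := HC.faultyDeg_add_d (F := F)
  have hE := HC.E_ofEdges_le (F := F) (b := x)
  have hL : HC.Lace (.ofEdges F) univ x := by
    refine HC.tol (m := n) (by omega) _ _ _ (by simp) (fun z _ => ?_) (fun _ z _ w _ hz hw => ?_) ?_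
    · have := hd z; have := hdeg2 z; omega
    · have := hd z; have := hd w
      exact hone z w (by omega) (by omega)
    · unfold HC.cap; omega
  obtain ⟨p, hp⟩ := (hL x (hmem x) y (hmem y) ((HC.par_ne_iff x y).2 hxy)).exists_walk HC.adj_of_R
  refine ⟨p, fun a => ?_⟩
  rw [← Multiset.coe_count, hp]
  exact Multiset.count_eq_one_of_mem (HC.S univ x).nodup (hmem a)
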